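/- arXiv:2007.05574 — 2 statements merged into one kernel-verified Lean document; each statement's English description precedes it below -/
import Mathlib

section
/- A commutative integral domain R is stable if and only if R has finite character and the localization R_m is stable for every maximal ideal m of R. -/
noncomputable section

open scoped nonZeroDivisors Pointwise

set_option synthInstance.maxHeartbeats 1000000
set_option maxHeartbeats 1000000

/-- For a nonzero ideal `I` of a domain `R`, viewed as a fractional ideal `J` of the quotient
field, the endomorphism ring `(I : I)` is `J / J` and `{z ∈ K | zI ⊆ (I : I)}` is `J / J / J`.
The ideal `I` is *stable* if it is invertible as an ideal of `(I : I)`, i.e.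
`I * ((I:I) : I) = (I:I)`. -/
def Ideal.IsStableIdeal {R : Type*} [CommRing R] [IsDomain R] (I : Ideal R) : Prop :=
  (I : FractionalIdeal R⁰ (FractionRing R)) *
      ((I : FractionalIdeal R⁰ (FractionRing R)) / (I : FractionalIdeal R⁰ (FractionRing R)) /
        (I : FractionalIdeal R⁰ (FractionRing R))) =
    (I : FractionalIdeal R⁰ (FractionRing R)) / (I : FractionalIdeal R⁰ (FractionRing R))

/-- A domain is *stable* if every nonzero ideal is stable. -/
def StableRing (R : Type*) [CommRing R] [IsDomain R] : Prop :=
  ∀ I : Ideal R, I ≠ ⊥ → I.IsStableIdeal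

/-- A domain is *finitely stable* if every nonzero finitely generated ideal is stable. -/
def FinitelyStableRing (R : Type*) [CommRing R] [IsDomain R] : Prop :=
  ∀ I : Ideal R, I ≠ ⊥ → I.FG → I.IsStableIdeal

/-- A ring has *finite character* if every nonzero element lies in only finitely many maximal
ideals. -/
def FiniteCharacterRing (R : Type*) [CommRing R] : Prop :=
  ∀ x : R, x ≠ 0 → {m : Ideal R | m.IsMaximal ∧ x ∈ m}.Finite

/-- The localization of a domain at a prime ideal is a stable domain. -/
def StableLocalizationAt (R : Type*) [CommRing R] [IsDomain R] (m : Ideal R)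
    (hm : m.IsPrime) : Prop :=
  letI := hm
  letI : IsDomain (Localization.AtPrime m) :=
    IsLocalization.isDomain_localization m.primeCompl_le_nonZeroDivisors
  StableRing (Localization.AtPrime m)

namespace StableAux

open Submodule

/-- Stability of a submodule of an overring. -/
def Q {R K : Type*} [CommRing R] [Field K] [Algebra R K] (S : Submodule R K) : Prop :=
  (1 : K) ∈ S * (S / (S * S))

section sat

variable {R K : Type*} [CommRing R] [Field K] [Algebra R K]

/-- The localization of `N` at the prime `m`, inside `K`. -/
def sat (m : Ideal R) [hm : m.IsPrime] (N : Submodule R K) : Submodule R K where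
  carrier := {w | ∃ s : R, s ∉ m ∧ s • w ∈ N}
  zero_mem' := ⟨1, fun h => hm.ne_top ((Ideal.eq_top_iff_one m).2 h), by simp⟩
  add_mem' := by
    rintro a b ⟨s, hs, ha⟩ ⟨t, ht, hb⟩
    refine ⟨s * t, fun h => (hm.mem_or_mem h).elim hs ht, ?_⟩
    rw [smul_add]
    refine N.add_mem ?_ ?_
    · rw [mul_comm, mul_smul]; exact N.smul_mem _ ha
    · rw [mul_smul]; exact N.smul_mem _ hb
  smul_mem' := by
    rintro c a ⟨s, hs, ha⟩
    exact ⟨s, hs, by rw [smul_comm]; exact N.smul_mem _ ha⟩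

theorem mem_sat {m : Ideal R} [m.IsPrime] {N : Submodule R K} {w : K} :
    w ∈ sat m N ↔ ∃ s : R, s ∉ m ∧ s • w ∈ N := Iff.rfl

theorem le_sat (m : Ideal R) [hm : m.IsPrime] (N : Submodule R K) : N ≤ sat m N :=
  fun w hw => ⟨1, fun h => hm.ne_top ((Ideal.eq_top_iff_one m).2 h), by simpa using hw⟩

theorem sat_mono (m : Ideal R) [m.IsPrime] {N P : Submodule R K} (h : N ≤ P) :
    sat m N ≤ sat m P := fun _ ⟨s, hs, hw⟩ => ⟨s, hs, h hw⟩

theorem sat_sat (m : Ideal R) [hm : m.IsPrime] (N : Submodule R K) :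
    sat m (sat m N) ≤ sat m N := by
  rintro w ⟨s, hs, t, ht, h⟩
  exact ⟨t * s, fun h => (hm.mem_or_mem h).elim ht hs, by rwa [mul_smul]⟩

theorem sat_comm (m n : Ideal R) [m.IsPrime] [n.IsPrime] (N : Submodule R K) :
    sat m (sat n N) ≤ sat n (sat m N) := by
  rintro w ⟨s, hs, t, ht, h⟩
  exact ⟨t, ht, s, hs, by rwa [smul_comm]⟩

theorem sat_mul (m : Ideal R) [hm : m.IsPrime] (N P : Submodule R K) :
    sat m N * sat m P ≤ sat m (N * P) := by
  rw [Submodule.mul_le]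
  rintro a ⟨s, hs, ha⟩ b ⟨t, ht, hb⟩
  refine ⟨s * t, fun h => (hm.mem_or_mem h).elim hs ht, ?_⟩
  rw [← smul_mul_smul_comm]
  exact Submodule.mul_mem_mul ha hb

theorem mulMono {A B C D : Submodule R K} (h : A ≤ B) (h' : C ≤ D) : A * C ≤ B * D :=
  Submodule.mul_le.2 fun _ ha _ hc => Submodule.mul_mem_mul (h ha) (h' hc)

theorem spanle {z : K} {A B : Submodule R K} :
    span R {z} * A ≤ B ↔ ∀ a ∈ A, z * a ∈ B := by
  rw [Submodule.mul_le]
  constructor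
  · intro h a ha
    exact h _ (Submodule.mem_span_singleton_self z) _ ha
  · intro h w hw a ha
    obtain ⟨c, rfl⟩ := Submodule.mem_span_singleton.1 hw
    rw [smul_mul_assoc]
    exact B.smul_mem _ (h a ha)

theorem div_mul_le (A B : Submodule R K) : A / B * B ≤ A :=
  Submodule.le_div_iff_mul_le.1 le_rfl

/-- a fg submodule contained in `sat m N` is carried into `N` by one element -/
theorem exists_smul_le (m : Ideal R) [hm : m.IsPrime] (A N : Submodule R K) (hA : A.FG)
    (h : A ≤ sat m N) : ∃ s : R, s ∉ m ∧ ∀ a ∈ A, s • a ∈ N := by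
  induction A, hA using Submodule.fg_induction with
  | singleton x =>
    obtain ⟨s, hs, hx⟩ := h (Submodule.mem_span_singleton_self x)
    refine ⟨s, hs, fun a ha => ?_⟩
    obtain ⟨c, rfl⟩ := Submodule.mem_span_singleton.1 ha
    rw [smul_comm]; exact N.smul_mem _ hx
  | sup A B _ _ ihA ihB =>
    obtain ⟨s, hs, hsA⟩ := ihA (le_sup_left.trans h)
    obtain ⟨t, ht, htB⟩ := ihB (le_sup_right.trans h)
    refine ⟨s * t, fun h => (hm.mem_or_mem h).elim hs ht, fun a ha => ?_⟩
    obtain ⟨u, hu, v, hv, rfl⟩ := Submodule.mem_sup.1 ha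
    rw [smul_add]
    refine N.add_mem ?_ ?_
    · rw [mul_comm, mul_smul]; exact N.smul_mem _ (hsA u hu)
    · rw [mul_smul]; exact N.smul_mem _ (htB v hv)

theorem mem_of_forall_sat (N : Submodule R K) (w : K)
    (h : ∀ (m : Ideal R) (hm : m.IsMaximal), w ∈ @sat R K _ _ _ m hm.isPrime N) : w ∈ N := by
  let a : Ideal R := N.comap (LinearMap.toSpanSingleton R K w)
  have ha : a = ⊤ := by
    by_contra hne
    obtain ⟨m, hm, hle⟩ := Ideal.exists_le_maximal a hne
    obtain ⟨s, hs, hw⟩ := h m hm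
    exact hs (hle (show s ∈ a by simpa [a] using hw))
  have : (1 : R) ∈ a := ha ▸ Submodule.mem_top
  simpa [a] using this

theorem Q_sat (m : Ideal R) [hm : m.IsPrime] (S : Submodule R K) (h : Q S) : Q (sat m S) := by
  refine mulMono (le_sat m S) ?_ h
  rw [Submodule.le_div_iff_mul_le]
  calc S / (S * S) * (sat m S * sat m S)
      ≤ sat m (S / (S * S)) * sat m (S * S) := mulMono (le_sat _ _) (sat_mul _ _ _)
    _ ≤ sat m (S / (S * S) * (S * S)) := sat_mul _ _ _
    _ ≤ sat m S := sat_mono _ (div_mul_le _ _)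

/-- the key step for the converse -/
theorem key (m n : Ideal R) [hm : m.IsPrime] [hn : n.IsPrime] (S : Submodule R K)
    (h : Q (sat n S)) (z : K) (hz : ∀ w ∈ S * S, z * w ∈ sat m S) :
    ∃ s : R, s ∉ m ∧ ∀ w ∈ S * S, s • (z * w) ∈ sat n S := by
  set T := sat n S with hT
  set W := T / (T * T) with hW
  obtain ⟨F, G, hF, hG, h1⟩ := Submodule.mem_span_mul_finite_of_mem_mul h
  set A := span R (F : Set K) with hA
  have hAT : A ≤ T := span_le.2 hF
  have h1 : (1 : K) ∈ A * W := by
    rw [← Submodule.span_mul_span] at h1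
    exact mulMono le_rfl (span_le.2 hG) h1
  have hAfg : (A * A).FG := Submodule.FG.mul ⟨F, rfl⟩ ⟨F, rfl⟩
  have hz' : span R {z} * (S * S) ≤ sat m S := by
    rw [spanle]
    exact hz
  have hzA : span R {z} * (A * A) ≤ sat m T := by
    calc span R {z} * (A * A) ≤ sat n (span R {z}) * sat n (S * S) :=
          mulMono (le_sat _ _) ((mulMono hAT hAT).trans (sat_mul _ _ _))
      _ ≤ sat n (span R {z} * (S * S)) := sat_mul _ _ _
      _ ≤ sat n (sat m S) := sat_mono _ hz'
      _ ≤ sat m T := sat_comm _ _ _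
  obtain ⟨s, hs, hsA⟩ := exists_smul_le m _ _
    (Submodule.FG.mul (Submodule.fg_span_singleton z) hAfg) hzA
  refine ⟨s, hs, fun w hw => ?_⟩
  have hB : span R {s • z} * (A * A) ≤ T := by
    rw [spanle]
    intro a ha
    rw [smul_mul_assoc]
    exact hsA _ (Submodule.mul_mem_mul (Submodule.mem_span_singleton_self z) ha)
  have h3 : s • (z * w) ∈ span R {s • z} * ((A * W) * (A * W)) * (S * S) := by
    rw [← smul_mul_assoc]
    refine Submodule.mul_mem_mul ?_ hw
    have := Submodule.mul_mem_mul (Submodule.mem_span_singleton_self (R := R) (s • z))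
      (Submodule.mul_mem_mul h1 h1)
    simpa using this
  have hSS : S * S ≤ T * T := mulMono (le_sat _ _) (le_sat _ _)
  have hWT : W * (T * T) ≤ T := div_mul_le _ _
  have h4 : span R {s • z} * ((A * W) * (A * W)) * (S * S) ≤ T := by
    calc _ = (span R {s • z} * (A * A)) * (W * (W * (S * S))) := by ring
      _ ≤ T * (W * (W * (T * T))) := by gcongr
      _ ≤ T * (W * T) := by gcongr
      _ = W * (T * T) := by ring
      _ ≤ T := hWT
  exact h4 h3

theorem Q_of_smul (d : K) (hd : d ≠ 0) (J : Submodule R K) (h : Q (span R {d} * J)) : Q J := by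
  have hd' : span R {d⁻¹} * span R {d} = (1 : Submodule R K) := by
    rw [Submodule.span_mul_span, Set.singleton_mul_singleton, inv_mul_cancel₀ hd,
      Submodule.one_eq_span]
  set D := span R {d}
  set D' := span R {d⁻¹}
  set W := (D * J) / (D * J * (D * J))
  have hW : W * (D * J * (D * J)) ≤ D * J := div_mul_le _ _
  have h1 : D * W ≤ J / (J * J) := by
    rw [Submodule.le_div_iff_mul_le]
    calc D * W * (J * J) = 1 * (D * W * (J * J)) := by rw [one_mul]
      _ = D' * (W * (D * J * (D * J))) := by rw [← hd']; ring
      _ ≤ D' * (D * J) := by gcongr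
      _ = J := by rw [← mul_assoc, hd', one_mul]
  have h2 : (1 : K) ∈ J * (D * W) := by
    have : J * (D * W) = D * J * W := by ring
    rw [this]; exact h
  exact mulMono le_rfl h1 h2

end sat

section frac

variable {R : Type*} [CommRing R] [IsDomain R]

theorem stable_iff0 (I : Ideal R) (hI : I ≠ ⊥) :
    I.IsStableIdeal ↔ Q (IsLocalization.coeSubmodule (FractionRing R) I) := by
  have hJ : (I : FractionalIdeal R⁰ (FractionRing R)) ≠ 0 :=
    FractionalIdeal.coeIdeal_ne_zero.2 hI
  unfold Ideal.IsStableIdeal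
  rw [← FractionalIdeal.coeToSubmodule_inj, FractionalIdeal.coe_mul, FractionalIdeal.coe_div hJ,
    FractionalIdeal.coe_div hJ, FractionalIdeal.coe_coeIdeal]
  unfold Q
  set S := IsLocalization.coeSubmodule (FractionRing R) I
  have hdd : S / S / S = S / (S * S) := by
    apply le_antisymm
    · rw [Submodule.le_div_iff_mul_le, ← mul_assoc]
      refine (mulMono (div_mul_le _ _) le_rfl).trans (div_mul_le _ _)
    · rw [Submodule.le_div_iff_mul_le, Submodule.le_div_iff_mul_le, mul_assoc]
      exact div_mul_le _ _
  rw [hdd]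
  constructor
  · intro h
    rw [h, Submodule.mem_div_iff_forall_mul_mem]
    intro y hy
    rwa [one_mul]
  · intro h
    apply le_antisymm
    · rw [Submodule.le_div_iff_mul_le]
      calc S * (S / (S * S)) * S = S / (S * S) * (S * S) := by ring
        _ ≤ S := div_mul_le _ _
    · intro y hy
      have h1 : y * 1 ∈ S / S * (S * (S / (S * S))) := Submodule.mul_mem_mul hy h
      rw [mul_one, ← mul_assoc] at h1
      exact mulMono (div_mul_le _ _) le_rfl h1

theorem stable_iff (K : Type*) [Field K] [Algebra R K] [IsFractionRing R K] (I : Ideal R)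
    (hI : I ≠ ⊥) : I.IsStableIdeal ↔ Q (IsLocalization.coeSubmodule K I) := by
  rw [stable_iff0 I hI]
  let e := FractionRing.algEquiv R K
  have hmap : (IsLocalization.coeSubmodule (FractionRing R) I).map e.toLinearMap =
      IsLocalization.coeSubmodule K I := by
    ext y
    simp only [Submodule.mem_map, IsLocalization.mem_coeSubmodule]
    constructor
    · rintro ⟨_, ⟨a, ha, rfl⟩, rfl⟩
      exact ⟨a, ha, (e.commutes a).symm⟩
    · rintro ⟨a, ha, rfl⟩
      exact ⟨_, ⟨a, ha, rfl⟩, e.commutes a⟩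
  rw [← hmap]
  set S := IsLocalization.coeSubmodule (FractionRing R) I
  have hmul (A B : Submodule R (FractionRing R)) :
      (A * B).map e.toLinearMap = A.map e.toLinearMap * B.map e.toLinearMap :=
    Submodule.map_mul A B e.toAlgHom
  unfold Q
  rw [← hmul, ← Submodule.map_div, ← hmul]
  constructor
  · intro h
    exact ⟨1, h, map_one e⟩
  · rintro ⟨y, hy, h⟩
    have : y = 1 := e.injective (by rw [map_one]; exact h)
    rwa [← this]

end frac

section loc

variable {R : Type*} [CommRing R] [IsDomain R]

theorem stable_loc_iff (m : Ideal R) [hm : m.IsPrime] (L K : Type*) [CommRing L] [IsDomain L]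
    [Field K] [Algebra R L] [Algebra R K] [Algebra L K] [IsScalarTower R L K]
    [IsLocalization.AtPrime L m] [IsFractionRing R K] (I : Ideal R) (hI : I ≠ ⊥) :
    (I.map (algebraMap R L)).IsStableIdeal ↔ Q (sat m (IsLocalization.coeSubmodule K I)) := by
  have : IsFractionRing L K :=
    IsFractionRing.isFractionRing_of_isDomain_of_isLocalization m.primeCompl L K
  have hinj : Function.Injective (algebraMap R L) :=
    IsLocalization.injective L m.primeCompl_le_nonZeroDivisors
  rw [stable_iff K _ (fun h => hI ((Ideal.map_eq_bot_iff_of_injective hinj).1 h))]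
  have hres : (IsLocalization.coeSubmodule K (I.map (algebraMap R L))).restrictScalars R =
      sat m (IsLocalization.coeSubmodule K I) := by
    ext y
    simp only [Submodule.restrictScalars_mem, IsLocalization.mem_coeSubmodule, mem_sat]
    constructor
    · rintro ⟨b, hb, rfl⟩
      obtain ⟨⟨a, s⟩, h⟩ := (IsLocalization.mem_map_algebraMap_iff m.primeCompl L).1 hb
      refine ⟨s, s.2, a, a.2, ?_⟩
      rw [IsScalarTower.algebraMap_apply R L K, ← h, Algebra.smul_def,
        IsScalarTower.algebraMap_apply R L K, ← map_mul, mul_comm]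
    · rintro ⟨s, hs, a, ha, h⟩
      have hsp : IsLocalization.mk' L a (⟨s, hs⟩ : m.primeCompl) * algebraMap R L s =
          algebraMap R L a := IsLocalization.mk'_spec L a (⟨s, hs⟩ : m.primeCompl)
      refine ⟨IsLocalization.mk' L a (⟨s, hs⟩ : m.primeCompl), ?_, ?_⟩
      · rw [IsLocalization.mem_map_algebraMap_iff m.primeCompl L]
        exact ⟨⟨⟨a, ha⟩, ⟨s, hs⟩⟩, hsp⟩
      · have hs0 : algebraMap R K s ≠ 0 := by
          intro h0
          have : s = 0 := by simpa using h0
          exact hs (this ▸ m.zero_mem)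
        apply mul_left_cancel₀ hs0
        rw [← Algebra.smul_def s y, ← h, IsScalarTower.algebraMap_apply R L K s, ← map_mul,
          mul_comm, hsp, ← IsScalarTower.algebraMap_apply]
  rw [← hres]
  set T := IsLocalization.coeSubmodule K (I.map (algebraMap R L))
  have hdiv (A B : Submodule L K) : (A / B).restrictScalars R =
      A.restrictScalars R / B.restrictScalars R := rfl
  unfold Q
  rw [← Submodule.restrictScalars_mul, ← hdiv, ← Submodule.restrictScalars_mul]
  rfl

end loc

end StableAux

open StableAux Submodule in
theorem StableAux.finite_char (R : Type*) [CommRing R] [IsDomain R] (h : StableRing R) :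
    FiniteCharacterRing R := by
  classical
  intro x hx
  by_contra hinf
  let K := FractionRing R
  let ι := {m : Ideal R | m.IsMaximal ∧ x ∈ m}
  have hι : Infinite ι := Set.infinite_coe_iff.2 hinf
  have hpr : ∀ i : ι, i.1.IsPrime := fun i => i.2.1.isPrime
  let M : ι → Submodule R K := fun i => IsLocalization.coeSubmodule K i.1
  let J' : ι → Submodule R K := fun i => M i / (M i * M i)
  have hM1 : ∀ i, M i ≤ 1 := by
    intro i
    rintro _ ⟨a, -, rfl⟩
    exact Submodule.mem_one.2 ⟨a, rfl⟩
  have hQ : ∀ i, (1 : K) ∈ M i * J' i := by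
    intro i
    have hne : i.1 ≠ ⊥ := fun h0 => hx (by simpa [h0] using i.2.2)
    exact (stable_iff K _ hne).1 (h _ hne)
  have hone : ∀ i, (1 : Submodule R K) ≤ J' i := by
    intro i
    rw [Submodule.le_div_iff_mul_le, one_mul]
    calc M i * M i ≤ 1 * M i := mulMono (hM1 i) le_rfl
      _ = M i := one_mul _
  set J : Submodule R K := ⨆ i, J' i with hJdef
  have hinj : Function.Injective (algebraMap R K) := IsFractionRing.injective R K
  let d : K := algebraMap R K x * algebraMap R K x
  have hxK : algebraMap R K x ≠ 0 := fun h0 => hx (hinj (by rw [h0, map_zero]))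
  have hd : d ≠ 0 := mul_ne_zero hxK hxK
  have hDJ : span R {d} * J ≤ 1 := by
    rw [mul_comm, hJdef, Submodule.iSup_mul, iSup_le_iff]
    intro i
    have hDi : span R {d} ≤ M i * M i := by
      rw [Submodule.span_singleton_le_iff_mem]
      exact Submodule.mul_mem_mul ⟨x, i.2.2, rfl⟩ ⟨x, i.2.2, rfl⟩
    exact ((mulMono le_rfl hDi).trans (div_mul_le _ _)).trans (hM1 i)
  -- the corresponding ideal
  let I : Ideal R := (span R {d} * J).comap (Algebra.linearMap R K)
  have hI : IsLocalization.coeSubmodule K I = span R {d} * J := by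
    apply le_antisymm
    · rintro _ ⟨a, ha, rfl⟩
      exact ha
    · intro y hy
      obtain ⟨a, rfl⟩ := Submodule.mem_one.1 (hDJ hy)
      exact ⟨a, hy, rfl⟩
  have hne : I ≠ ⊥ := by
    intro h0
    obtain ⟨i⟩ : Nonempty ι := inferInstance
    have h1 : d * 1 ∈ span R {d} * J :=
      Submodule.mul_mem_mul (Submodule.mem_span_singleton_self d)
        ((hone i).trans (le_iSup J' i) (Submodule.one_le.1 le_rfl))
    rw [mul_one] at h1
    have h2 : x * x ∈ I := by
      show algebraMap R K (x * x) ∈ span R {d} * J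
      rw [map_mul]; exact h1
    rw [h0] at h2
    exact hx (by simpa using h2)
  have hQJ : Q J := Q_of_smul d hd J (hI ▸ (stable_iff K I hne).1 (h I hne))
  unfold Q at hQJ
  set W := J / (J * J) with hW
  rw [hJdef, Submodule.iSup_mul, Submodule.mem_iSup_iff_exists_finset] at hQJ
  obtain ⟨F, hF⟩ := hQJ
  obtain ⟨i, hi⟩ := Infinite.exists_notMem_finset F
  have hother : ∀ j, j ≠ i → J' j ≤ sat i.1 1 := by
    intro j hj y hy
    have : ¬ (j.1 ≤ i.1) := fun hle =>
      hj (Subtype.ext (j.2.1.eq_of_le i.2.1.ne_top hle))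
    obtain ⟨t, htj, hti⟩ := SetLike.not_le_iff_exists.1 this
    refine ⟨t * t, fun h => hti ((hpr i).mem_or_mem h |>.elim id id), hM1 j ?_⟩
    have hmm : algebraMap R K t * algebraMap R K t ∈ M j * M j :=
      Submodule.mul_mem_mul ⟨t, htj, rfl⟩ ⟨t, htj, rfl⟩
    have := div_mul_le _ _ (Submodule.mul_mem_mul hy hmm)
    rwa [Algebra.smul_def, map_mul, mul_comm]
  have hsatW : (1 : K) ∈ sat i.1 W := by
    have hle : (⨆ j ∈ F, J' j * W) ≤ sat i.1 W := by
      refine iSup₂_le fun j hj => ?_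
      calc J' j * W ≤ sat i.1 1 * sat i.1 W :=
            mulMono (hother j (fun h => hi (h ▸ hj))) (le_sat _ _)
        _ ≤ sat i.1 (1 * W) := sat_mul _ _ _
        _ = sat i.1 W := by rw [one_mul]
    exact hle hF
  have hJsat : J ≤ sat i.1 (J' i) := by
    refine iSup_le fun j => ?_
    by_cases hj : j = i
    · subst hj; exact le_sat _ _
    · exact (hother j hj).trans (sat_mono _ (hone i))
  obtain ⟨t, ht, htW⟩ := hsatW
  have hJJ : J' i * J' i ≤ sat i.1 (J' i) := by
    intro y hy
    refine sat_sat _ _ ⟨t, ht, hJsat ?_⟩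
    have hy' : y ∈ J * J := mulMono (le_iSup J' i) (le_iSup J' i) hy
    have := div_mul_le _ _ (Submodule.mul_mem_mul htW hy')
    rwa [smul_mul_assoc, one_mul] at this
  have hfin : (1 : K) ∈ sat i.1 (M i) := by
    have h1 : (1 : K) * 1 ∈ (M i * J' i) * (M i * J' i) := Submodule.mul_mem_mul (hQ i) (hQ i)
    rw [one_mul] at h1
    have hle : (M i * J' i) * (M i * J' i) ≤ sat i.1 (M i) := by
      calc (M i * J' i) * (M i * J' i) = (J' i * J' i) * (M i * M i) := by ring
        _ ≤ sat i.1 (J' i) * sat i.1 (M i * M i) := mulMono hJJ (le_sat _ _)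
        _ ≤ sat i.1 (J' i * (M i * M i)) := sat_mul _ _ _
        _ ≤ sat i.1 (M i) := sat_mono _ (div_mul_le _ _)
    exact hle h1
  obtain ⟨s, hs, a, ha, hsa⟩ := hfin
  have : a = s := hinj (by rw [← mul_one (algebraMap R K s), ← Algebra.smul_def]; exact hsa)
  exact hs (this ▸ ha)

open StableAux in
theorem StableAux.global (R : Type*) [CommRing R] [IsDomain R] (hfc : FiniteCharacterRing R)
    (I : Ideal R) (hI : I ≠ ⊥)
    (h : ∀ (m : Ideal R) (hm : m.IsMaximal), Q (@sat R (FractionRing R) _ _ _ m hm.isPrime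
      (IsLocalization.coeSubmodule (FractionRing R) I))) : I.IsStableIdeal := by
  classical
  let K := FractionRing R
  rw [stable_iff K I hI]
  set S := IsLocalization.coeSubmodule K I with hS
  refine mem_of_forall_sat _ _ fun m hm => ?_
  have hmp := hm.isPrime
  suffices hsuf : sat m S / (sat m S * sat m S) ≤ sat m (S / (S * S)) from
    ((mulMono le_rfl hsuf).trans (sat_mul _ _ _)) (h m hm)
  intro z hz
  have hz' : ∀ w ∈ S * S, z * w ∈ sat m S := fun w hw =>
    Submodule.mem_div_iff_forall_mul_mem.1 hz w
      (mulMono (le_sat _ _) (le_sat _ _) hw)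
  obtain ⟨a, ⟨b, hb⟩, hab⟩ := IsLocalization.exists_mk'_eq R⁰ z
  obtain ⟨c, hcI, hc0⟩ := Submodule.exists_mem_ne_zero_of_ne_bot hI
  have hb0 : b ≠ 0 := nonZeroDivisors.ne_zero hb
  have hbz : b • z = algebraMap R K a := by
    rw [Algebra.smul_def, ← hab, mul_comm]
    exact IsLocalization.mk'_spec K a ⟨b, hb⟩
  have hS1 : S ≤ 1 := by
    rintro _ ⟨a, -, rfl⟩
    exact Submodule.mem_one.2 ⟨a, rfl⟩
  have hfin := hfc (b * c) (mul_ne_zero hb0 hc0)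
  have hk : ∀ n : Ideal R, ∃ s : R, s ∉ m ∧ ∀ hn : n.IsMaximal, ∀ w ∈ S * S,
      s • (z * w) ∈ @sat R K _ _ _ n hn.isPrime S := by
    intro n
    by_cases hn : n.IsMaximal
    · have := hn.isPrime
      obtain ⟨s, hs, hh⟩ := key m n S (h n hn) z hz'
      exact ⟨s, hs, fun _ => hh⟩
    · exact ⟨1, fun h => hmp.ne_top ((Ideal.eq_top_iff_one m).2 h), fun h => absurd h hn⟩
  choose s hs hsw using hk
  refine ⟨∏ n ∈ hfin.toFinset, s n, ?_, ?_⟩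
  · intro hp
    obtain ⟨n, _, hn⟩ := (Ideal.IsPrime.prod_mem_iff (p := m)).1 hp
    exact hs n hn
  · rw [Submodule.mem_div_iff_forall_mul_mem]
    intro w hw
    refine mem_of_forall_sat _ _ fun n hn => ?_
    have hnp := hn.isPrime
    rw [smul_mul_assoc]
    by_cases hbc : b * c ∈ n
    · have hmem : n ∈ hfin.toFinset := by simpa using ⟨hn, by simpa using hbc⟩
      rw [← Finset.prod_erase_mul _ _ hmem, mul_smul]
      exact Submodule.smul_mem _ _ (hsw n hn w hw)
    · refine Submodule.smul_mem _ _ ⟨b * c, hbc, ?_⟩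
      have hw1 : w ∈ (1 : Submodule R K) := by
        have := mulMono hS1 hS1 hw
        rwa [one_mul] at this
      obtain ⟨r, rfl⟩ := Submodule.mem_one.1 hw1
      refine ⟨c * (a * r), I.mul_mem_right _ hcI, ?_⟩
      rw [mul_comm b c, mul_smul, ← smul_mul_assoc, hbz, Algebra.smul_def]
      simp

open StableAux in
theorem stable_iff_finite_character_and_locally_stable (R : Type*) [CommRing R] [IsDomain R] :
    StableRing R ↔
      (FiniteCharacterRing R ∧
        ∀ (m : Ideal R) (hm : m.IsMaximal), StableLocalizationAt R m hm.isPrime) := by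
  constructor
  · intro h
    refine ⟨StableAux.finite_char R h, fun m hm => ?_⟩
    have hmp := hm.isPrime
    intro I' hI'
    have hmap := IsLocalization.map_under m.primeCompl (Localization.AtPrime m) I'
    have hne : I'.under R ≠ ⊥ := by
      intro h0
      rw [h0, Ideal.map_bot] at hmap
      exact hI' hmap.symm
    rw [← hmap]
    rw [stable_loc_iff m (Localization.AtPrime m) (FractionRing R) _ hne]
    exact Q_sat _ _ ((stable_iff (FractionRing R) _ hne).1 (h _ hne))
  · rintro ⟨hfc, hloc⟩ I hI
    refine StableAux.global R hfc I hI fun m hm => ?_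
    have hmp := hm.isPrime
    rw [← stable_loc_iff m (Localization.AtPrime m) (FractionRing R) I hI]
    refine hloc m hm _ fun h0 => hI ?_
    exact (Ideal.map_eq_bot_iff_of_injective
      (IsLocalization.injective _ m.primeCompl_le_nonZeroDivisors)).1 h0
end
end

section
/- Let R be a commutative integral domain. Every ideal of R is 2-generated if and only if R is a divisorial stable Mori domain. Moreover, if R is a stable Mori domain whose conductor (R : R̄) = {x ∈ K | x·R̄ ⊆ R} is nonzero, then R is divisorial and every ideal of R is 2-generated. -/
noncomputable section

open scoped nonZeroDivisors Pointwise

set_option synthInstance.maxHeartbeats 1000000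
set_option maxHeartbeats 1000000

/-- An ideal `I` is *divisorial* if `I_v = (I⁻¹)⁻¹ = I`; in terms of fractional ideals,
`1 / (1 / I) = I`. -/
def Ideal.IsDivisorial {R : Type*} [CommRing R] [IsDomain R] (I : Ideal R) : Prop :=
  1 / (1 / (I : FractionalIdeal R⁰ (FractionRing R))) = (I : FractionalIdeal R⁰ (FractionRing R))

/-- A domain is a *Mori domain* if it satisfies the ascending chain condition on
divisorial ideals. -/
def MoriRing (R : Type*) [CommRing R] [IsDomain R] : Prop :=
  ∀ f : ℕ →o Ideal R, (∀ n, (f n).IsDivisorial) → ∃ n, ∀ m, n ≤ m → f m = f n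

/-- A domain is *divisorial* if every nonzero ideal is divisorial. -/
def DivisorialRing (R : Type*) [CommRing R] [IsDomain R] : Prop :=
  ∀ I : Ideal R, I ≠ ⊥ → I.IsDivisorial

/-- An ideal is *2-generated* if it is generated by (at most) two elements. -/
def Ideal.TwoGenerated {R : Type*} [CommRing R] (I : Ideal R) : Prop :=
  ∃ a b : R, I = Ideal.span {a, b}

set_option linter.unusedSectionVars false
set_option linter.unusedVariables false

section translation
variable {R : Type*} [CommRing R] {K : Type*} [Field K] [Algebra R K]

/-- A submodule of the field is fractional. -/
def FracK (J : Submodule R K) : Prop := ∃ a : K, a ≠ 0 ∧ ∀ x ∈ J, a * x ∈ (1 : Submodule R K)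

variable (R K) in
/-- Stability in terms of submodules of the field. -/
def StabK : Prop :=
  ∀ J : Submodule R K, J ≠ ⊥ → FracK J → (1 : K) ∈ J * ((J / J) / J)

variable (R K) in
/-- Divisoriality in terms of submodules of the field. -/
def DivK : Prop :=
  ∀ J : Submodule R K, J ≠ ⊥ → FracK J → 1 / (1 / J) ≤ J

variable (R K) in
/-- The Mori property in terms of submodules of the field. -/
def MoriK : Prop :=
  ∀ (a : K), a ≠ 0 → ∀ S : Set (Submodule R K), S.Nonempty →
    (∀ J ∈ S, J ≠ ⊥ ∧ 1 / (1 / J) ≤ J ∧ ∀ x ∈ J, a * x ∈ (1 : Submodule R K)) →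
    ∃ J ∈ S, ∀ J' ∈ S, J ≤ J' → J' = J

theorem mem_divK {I J : Submodule R K} {x : K} : x ∈ I / J ↔ ∀ y ∈ J, x * y ∈ I :=
  Submodule.mem_div_iff_forall_mul_mem

theorem div_antiK {I J J' : Submodule R K} (h : J ≤ J') : I / J' ≤ I / J := fun x hx =>
  mem_divK.2 fun y hy => mem_divK.1 hx y (h hy)

theorem div_monoK {I I' J : Submodule R K} (h : I ≤ I') : I / J ≤ I' / J := fun x hx =>
  mem_divK.2 fun y hy => h (mem_divK.1 hx y hy)

theorem mem_scale {a : K} {J : Submodule R K} {x : K} :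
    x ∈ Submodule.span R {a} * J ↔ ∃ z ∈ J, a * z = x := Submodule.mem_span_singleton_mul

theorem mem_scale' {a : K} (ha : a ≠ 0) {J : Submodule R K} {x : K} :
    x ∈ Submodule.span R {a} * J ↔ a⁻¹ * x ∈ J := by
  rw [mem_scale]
  constructor
  · rintro ⟨z, hz, rfl⟩
    rwa [inv_mul_cancel_left₀ ha]
  · intro h
    exact ⟨_, h, mul_inv_cancel_left₀ ha x⟩

theorem scale_div_scale {a : K} (ha : a ≠ 0) (I J : Submodule R K) :
    (Submodule.span R {a} * I) / (Submodule.span R {a} * J) = I / J := by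
  ext x
  simp only [mem_divK, mem_scale' ha]
  constructor
  · intro h y hy
    have := h (a * y) (by rwa [inv_mul_cancel_left₀ ha])
    convert this using 1
    field_simp
  · intro h y hy
    have := h _ hy
    convert this using 1
    field_simp

theorem div_scale {a : K} (ha : a ≠ 0) (I J : Submodule R K) :
    I / (Submodule.span R {a} * J) = Submodule.span R {a⁻¹} * (I / J) := by
  ext x
  simp only [mem_divK, mem_scale' ha, mem_scale' (inv_ne_zero ha), inv_inv]
  constructor
  · intro h y hy
    have := h (a * y) (by rwa [inv_mul_cancel_left₀ ha])
    convert this using 1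
    ring
  · intro h y hy
    have := h _ hy
    convert this using 1
    field_simp

theorem scale_scale {a b : K} (J : Submodule R K) :
    Submodule.span R {a} * (Submodule.span R {b} * J) = Submodule.span R {a * b} * J := by
  rw [← mul_assoc, Submodule.span_mul_span, Set.singleton_mul_singleton]

theorem scale_one_K (J : Submodule R K) : Submodule.span R {(1 : K)} * J = J := by
  rw [← Submodule.one_eq_span, one_mul]

end translation

section translation2
variable {R : Type*} [CommRing R] [IsDomain R]

theorem exists_ideal_of_le_one (J : Submodule R (FractionRing R)) (h : J ≤ 1) :
    ∃ I : Ideal R, ((I : FractionalIdeal R⁰ (FractionRing R)) :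
      Submodule R (FractionRing R)) = J := by
  refine ⟨J.comap (Algebra.linearMap R (FractionRing R)), ?_⟩
  rw [FractionalIdeal.coe_coeIdeal, IsLocalization.coeSubmodule, Submodule.map_comap_eq]
  apply inf_eq_right.2
  rwa [← Submodule.one_eq_range]

theorem coeIdeal_ne_zero_of {I : Ideal R} {J : Submodule R (FractionRing R)} (hJ : J ≠ ⊥)
    (hI : ((I : FractionalIdeal R⁰ (FractionRing R)) : Submodule R (FractionRing R)) = J) :
    (I : FractionalIdeal R⁰ (FractionRing R)) ≠ 0 := by
  intro h
  rw [h] at hI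
  exact hJ (by rw [← hI]; simp)

theorem frac_scale {J : Submodule R (FractionRing R)} {a : FractionRing R}
    (h : ∀ x ∈ J, a * x ∈ (1 : Submodule R (FractionRing R))) :
    Submodule.span R {a} * J ≤ 1 := by
  intro x hx
  obtain ⟨z, hz, rfl⟩ := mem_scale.1 hx
  exact h z hz

theorem scale_ne_bot {J : Submodule R (FractionRing R)} {a : FractionRing R} (ha : a ≠ 0)
    (h : J ≠ ⊥) : Submodule.span R {a} * J ≠ ⊥ := by
  intro h2
  apply h
  have : Submodule.span R {a⁻¹} * (Submodule.span R {a} * J) = ⊥ := by rw [h2]; simp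
  rwa [scale_scale, inv_mul_cancel₀ ha, scale_one_K] at this

/-- Stability of an ideal, in submodules. -/
theorem isStableIdeal_iff {I : Ideal R} (hI : I ≠ ⊥) {J : Submodule R (FractionRing R)}
    (hJ : ((I : FractionalIdeal R⁰ (FractionRing R)) : Submodule R (FractionRing R)) = J) :
    I.IsStableIdeal ↔ (1 : FractionRing R) ∈ J * ((J / J) / J) := by
  have h0 : (I : FractionalIdeal R⁰ (FractionRing R)) ≠ 0 := by
    rwa [Ne, FractionalIdeal.coeIdeal_eq_zero]
  unfold Ideal.IsStableIdeal
  rw [← FractionalIdeal.coeToSubmodule_inj, FractionalIdeal.coe_mul, FractionalIdeal.coe_div h0,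
    FractionalIdeal.coe_div h0, hJ]
  constructor
  · intro h
    rw [h]
    exact mem_divK.2 fun y hy => by rwa [one_mul]
  · intro h
    apply le_antisymm
    · refine Submodule.mul_le.2 fun x hx y hy => ?_
      rw [mul_comm]
      exact mem_divK.1 hy x hx
    · intro x hx
      have : ∀ u ∈ J * ((J / J) / J), x * u ∈ J * ((J / J) / J) := by
        intro u hu
        refine Submodule.mul_induction_on hu ?_ ?_
        · intro m hm n hn
          rw [← mul_assoc]
          exact Submodule.mul_mem_mul (mem_divK.1 hx m hm) hn
        · intro u v hu hv
          rw [mul_add]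
          exact add_mem hu hv
      simpa using this 1 h

theorem StabK_of_stable (h : StableRing R) : StabK R (FractionRing R) := by
  rintro J hJ ⟨a, ha, haJ⟩
  obtain ⟨I, hI⟩ := exists_ideal_of_le_one _ (frac_scale haJ)
  have hne := coeIdeal_ne_zero_of (scale_ne_bot ha hJ) hI
  rw [Ne, FractionalIdeal.coeIdeal_eq_zero] at hne
  have := (isStableIdeal_iff hne hI).1 (h I hne)
  rw [scale_div_scale ha, div_scale ha] at this
  rwa [mul_mul_mul_comm, Submodule.span_mul_span, Set.singleton_mul_singleton,
    mul_inv_cancel₀ ha, scale_one_K] at this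

theorem isDivisorial_iff {I : Ideal R} (hI : I ≠ ⊥) {J : Submodule R (FractionRing R)}
    (hJ : ((I : FractionalIdeal R⁰ (FractionRing R)) : Submodule R (FractionRing R)) = J) :
    I.IsDivisorial ↔ 1 / (1 / J) ≤ J := by
  have h0 : (I : FractionalIdeal R⁰ (FractionRing R)) ≠ 0 := by
    rwa [Ne, FractionalIdeal.coeIdeal_eq_zero]
  have h1 : (1 : FractionalIdeal R⁰ (FractionRing R)) / I ≠ 0 := by
    intro h
    have : (1 : FractionRing R) ∈ (1 : FractionalIdeal R⁰ (FractionRing R)) / I := by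
      rw [FractionalIdeal.mem_div_iff_of_ne_zero h0]
      intro y hy
      rw [one_mul]
      exact FractionalIdeal.coeIdeal_le_one hy
    rw [h] at this
    exact one_ne_zero (FractionalIdeal.mem_zero_iff _ |>.1 this)
  unfold Ideal.IsDivisorial
  rw [← FractionalIdeal.coeToSubmodule_inj, FractionalIdeal.coe_div h1,
    FractionalIdeal.coe_div h0, hJ, FractionalIdeal.coe_one]
  constructor
  · intro h
    exact h.le
  · intro h
    refine le_antisymm h fun x hx => mem_divK.2 fun y hy => ?_
    rw [mul_comm]
    exact mem_divK.1 hy x hx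

theorem scale_divisorial {K : Type*} [Field K] [Algebra R K] {J : Submodule R K} {a : K}
    (ha : a ≠ 0) :
    1 / (1 / (Submodule.span R {a} * J)) = Submodule.span R {a} * (1 / (1 / J)) := by
  rw [div_scale ha, div_scale (inv_ne_zero ha), inv_inv]

theorem scale_le_iff {K : Type*} [Field K] [Algebra R K] {I J : Submodule R K} {a : K}
    (ha : a ≠ 0) : Submodule.span R {a} * I ≤ Submodule.span R {a} * J ↔ I ≤ J := by
  constructor
  · intro h
    have : Submodule.span R {a⁻¹} * (Submodule.span R {a} * I) ≤
      Submodule.span R {a⁻¹} * (Submodule.span R {a} * J) := mul_le_mul_right h _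
    simpa only [scale_scale, inv_mul_cancel₀ ha, scale_one_K] using this
  · intro h
    exact mul_le_mul_right h _

theorem DivK_of_divisorial (h : DivisorialRing R) : DivK R (FractionRing R) := by
  rintro J hJ ⟨a, ha, haJ⟩
  obtain ⟨I, hI⟩ := exists_ideal_of_le_one _ (frac_scale haJ)
  have hne := coeIdeal_ne_zero_of (scale_ne_bot ha hJ) hI
  rw [Ne, FractionalIdeal.coeIdeal_eq_zero] at hne
  have := (isDivisorial_iff hne hI).1 (h I hne)
  rwa [scale_divisorial ha, scale_le_iff ha] at this

theorem MoriK_of_mori (h : MoriRing R) : MoriK R (FractionRing R) := by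
  intro a ha S hS hSp
  have : ∀ J : S, ∃ I : Ideal R, I.IsDivisorial ∧
    ((I : FractionalIdeal R⁰ (FractionRing R)) : Submodule R (FractionRing R)) =
      Submodule.span R {a} * (J : Submodule R (FractionRing R)) := by
    rintro ⟨J, hJ⟩
    obtain ⟨h1, h2, h3⟩ := hSp J hJ
    obtain ⟨I, hI⟩ := exists_ideal_of_le_one _ (frac_scale h3)
    have hne := coeIdeal_ne_zero_of (scale_ne_bot ha h1) hI
    rw [Ne, FractionalIdeal.coeIdeal_eq_zero] at hne
    refine ⟨I, (isDivisorial_iff hne hI).2 ?_, hI⟩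
    rwa [scale_divisorial ha, scale_le_iff ha]
  choose φ h1 h2 using this
  have hle : ∀ J J' : S, φ J ≤ φ J' ↔ J ≤ J' := by
    intro J J'
    rw [← FractionalIdeal.coeIdeal_le_coeIdeal (FractionRing R), ← FractionalIdeal.coe_le_coe,
      h2, h2, scale_le_iff ha]
    rfl
  have wf : WellFoundedGT S := by
    rw [wellFoundedGT_iff_monotone_chain_condition]
    intro f
    obtain ⟨n, hn⟩ := h ⟨fun n => φ (f n), fun i j hij => (hle _ _).2 (f.2 hij)⟩
      (fun n => h1 _)
    refine ⟨n, fun m hm => ?_⟩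
    have h3 : φ (f m) = φ (f n) := hn m hm
    exact le_antisymm ((hle _ _).1 h3.ge) ((hle _ _).1 h3.le)
  obtain ⟨J, -, hJ⟩ := wf.wf.has_min (Set.univ : Set S) ⟨⟨_, hS.some_mem⟩, trivial⟩
  refine ⟨J, J.2, fun J' hJ' hle => ?_⟩
  by_contra hne
  exact hJ ⟨J', hJ'⟩ trivial (lt_of_le_of_ne hle (fun h => hne (by rw [h])))

end translation2

section len
variable {R : Type*} [CommRing R] {V : Type*} [AddCommGroup V] [Module R V]

/-- Length of `B / (A ∩ B)`. -/
def relLen (A B : Submodule R V) : ℕ∞ := Module.length R (B ⧸ A.submoduleOf B)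

theorem relLen_add {A B C : Submodule R V} (hAB : A ≤ B) (hBC : B ≤ C) :
    relLen A C = relLen A B + relLen B C := by
  unfold relLen
  have h1 : A.submoduleOf B ≤ (A.submoduleOf C).comap (Submodule.inclusion hBC) := by
    intro x hx
    exact hx
  have h2 : A.submoduleOf C ≤ B.submoduleOf C := fun x hx => hAB hx
  refine Module.length_eq_add_of_exact (Submodule.mapQ _ _ (Submodule.inclusion hBC) h1)
    (Submodule.factor h2) ?_ ?_ ?_
  · rw [← LinearMap.ker_eq_bot, LinearMap.ker_eq_bot']
    intro x
    obtain ⟨x, rfl⟩ := Submodule.Quotient.mk_surjective _ x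
    intro h
    rw [Submodule.mapQ_apply, Submodule.Quotient.mk_eq_zero] at h
    rw [Submodule.Quotient.mk_eq_zero]
    exact h
  · exact Submodule.factor_surjective h2
  · intro x
    obtain ⟨x, rfl⟩ := Submodule.Quotient.mk_surjective _ x
    constructor
    · intro h
      have h3 : (Submodule.Quotient.mk x : C ⧸ B.submoduleOf C) = 0 := h
      rw [Submodule.Quotient.mk_eq_zero] at h3
      exact ⟨Submodule.Quotient.mk ⟨x.1, h3⟩, rfl⟩
    · rintro ⟨y, hy⟩
      obtain ⟨y, rfl⟩ := Submodule.Quotient.mk_surjective _ y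
      rw [← hy]
      change (Submodule.Quotient.mk (Submodule.inclusion hBC y) : C ⧸ B.submoduleOf C) = 0
      rw [Submodule.Quotient.mk_eq_zero]
      exact y.2

theorem relLen_mono_right {A A' B B' : Submodule R V} (hB : B ≤ B') (h : A' ⊓ B ≤ A) (h' : A ≤ A') :
    relLen A B ≤ relLen A' B' := by
  unfold relLen
  have h1 : A.submoduleOf B ≤ (A'.submoduleOf B').comap (Submodule.inclusion hB) := by
    intro x hx
    exact h' hx
  refine Module.length_le_of_injective (Submodule.mapQ _ _ (Submodule.inclusion hB) h1) ?_
  rw [← LinearMap.ker_eq_bot, LinearMap.ker_eq_bot']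
  intro x
  obtain ⟨x, rfl⟩ := Submodule.Quotient.mk_surjective _ x
  intro h2
  rw [Submodule.mapQ_apply, Submodule.Quotient.mk_eq_zero] at h2
  rw [Submodule.Quotient.mk_eq_zero]
  exact h ⟨h2, x.2⟩

theorem relLen_le_one {A B : Submodule R V} (m : Ideal R) [m.IsMaximal] (u : V)
    (h : B ≤ Submodule.span R {u} ⊔ A) (hm : ∀ r ∈ m, r • u ∈ A) : relLen A B ≤ 1 := by
  have key : relLen A (Submodule.span R {u} ⊔ A) ≤ 1 := by
    unfold relLen
    have hu : u ∈ Submodule.span R {u} ⊔ A :=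
      Submodule.mem_sup_left (Submodule.mem_span_singleton_self u)
    let f : (R ⧸ m) →ₗ[R] ((Submodule.span R {u} ⊔ A : Submodule R V) ⧸
        A.submoduleOf (Submodule.span R {u} ⊔ A)) :=
      Submodule.liftQ m (LinearMap.toSpanSingleton R _ (Submodule.Quotient.mk ⟨u, hu⟩)) (by
        intro r hr
        rw [LinearMap.mem_ker, LinearMap.toSpanSingleton_apply, ← Submodule.Quotient.mk_smul,
          Submodule.Quotient.mk_eq_zero]
        exact hm r hr)
    have : IsSimpleModule R (R ⧸ m) := isSimpleModule_iff_isCoatom.2 (Ideal.isMaximal_def.1 ‹_›)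
    rw [← Module.length_eq_one R (R ⧸ m)]
    refine Module.length_le_of_surjective f ?_
    intro y
    obtain ⟨⟨y, hy⟩, rfl⟩ := Submodule.Quotient.mk_surjective _ y
    obtain ⟨v, hv, a, ha, rfl⟩ := Submodule.mem_sup.1 hy
    obtain ⟨r, rfl⟩ := Submodule.mem_span_singleton.1 hv
    refine ⟨Submodule.Quotient.mk r, ?_⟩
    change LinearMap.toSpanSingleton R ((Submodule.span R {u} ⊔ A : Submodule R V) ⧸
        A.submoduleOf (Submodule.span R {u} ⊔ A)) (Submodule.Quotient.mk ⟨u, hu⟩) r = _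
    rw [LinearMap.toSpanSingleton_apply, ← Submodule.Quotient.mk_smul, Submodule.Quotient.eq]
    change r • u - (r • u + a) ∈ A
    simpa using ha
  refine le_trans ?_ key
  refine relLen_mono_right h inf_le_left le_rfl

theorem one_le_relLen {A B : Submodule R V} (h : ¬ B ≤ A) : 1 ≤ relLen A B := by
  unfold relLen
  rw [Order.one_le_iff_pos, Module.length_pos_iff, Submodule.Quotient.nontrivial_iff]
  intro h2
  exact h (fun x hx => by
    have : (⟨x, hx⟩ : B) ∈ A.submoduleOf B := by rw [h2]; trivial
    exact this)

theorem relLen_le_map {A A' B : Submodule R V} (f : V →ₗ[R] V) (h : ∀ x ∈ B, f x ∈ A → x ∈ A')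
   (hA' : A' ≤ B) :
    relLen A' B ≤ relLen A (A ⊔ B.map f) := by
  unfold relLen
  -- surjective from B ⧸ comap, injective into the target
  let g : B →ₗ[R] (A ⊔ B.map f : Submodule R V) :=
    LinearMap.codRestrict _ (f ∘ₗ B.subtype) (fun x =>
      Submodule.mem_sup_right (Submodule.mem_map_of_mem x.2))
  let S : Submodule R B := (A.submoduleOf (A ⊔ B.map f)).comap g
  have hS : S ≤ A'.submoduleOf B := fun x hx => h x x.2 hx
  calc _ ≤ Module.length R (B ⧸ S) :=
        Module.length_le_of_surjective (Submodule.factor hS) (Submodule.factor_surjective hS)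
    _ ≤ _ := by
        refine Module.length_le_of_injective (Submodule.mapQ _ _ g le_rfl) ?_
        rw [← LinearMap.ker_eq_bot, Submodule.ker_mapQ]
        simp [S]

end len

section U
variable {R : Type*} [CommRing R] [IsDomain R] {K : Type*} [Field K] [Algebra R K]
  [IsFractionRing R K]

/-- The local condition at a maximal ideal. -/
def GoodAt (K : Type*) [Field K] [Algebra R K] (m : Ideal R) : Prop :=
  ∃ T : Submodule R K, (1 : K) ∈ T ∧ T * T ≤ T ∧ T.FG ∧
    (∃ w ∈ T, T ≤ Submodule.span R {1, w} ⊔ m • T) ∧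
    ∃ d ∈ m, d ≠ 0 ∧ ∃ s, s ∉ m ∧ ∀ x ∈ m • T, ∃ t ∈ T, s • x = d • t

theorem exists_inv_mod (m : Ideal R) [hm : m.IsMaximal] {s : R} (hs : s ∉ m) (n k : ℕ) :
    ∃ a, ∃ b ∈ m ^ k, a * s ^ n + b = 1 := by
  have h1 : Ideal.span {s} ⊔ m = ⊤ := by
    rw [sup_comm]
    by_contra h
    have := hm.eq_of_le h le_sup_left
    exact hs (by rw [this]; exact Submodule.mem_sup_right (Ideal.mem_span_singleton_self s))
  have h2 : Ideal.span {s} ^ n ⊔ m ^ k = ⊤ := Ideal.pow_sup_pow_eq_top h1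
  have h3 : (1 : R) ∈ Ideal.span {s} ^ n ⊔ m ^ k := by rw [h2]; trivial
  rw [Ideal.span_singleton_pow] at h3
  obtain ⟨x, hx, y, hy, hxy⟩ := Submodule.mem_sup.1 h3
  obtain ⟨a, rfl⟩ := Ideal.mem_span_singleton'.1 hx
  exact ⟨a, y, hy, hxy⟩

theorem smul_cancelK {r : R} (hr : r ≠ 0) {x y : K} (h : r • x = r • y) : x = y := by
  rw [Algebra.smul_def, Algebra.smul_def] at h
  refine mul_left_cancel₀ ?_ h
  simpa using hr

theorem good_pow {m : Ideal R} {T : Submodule R K} {s d : R}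
    (h : ∀ x ∈ m • T, ∃ t ∈ T, s • x = d • t) (n : ℕ) :
    ∀ x ∈ m ^ n • T, ∃ t ∈ T, s ^ n • x = d ^ n • t := by
  induction n with
  | zero => intro x hx; exact ⟨x, by simpa using hx, by simp⟩
  | succ n ih =>
    intro x hx
    rw [pow_succ', mul_smul] at hx
    refine Submodule.smul_induction_on hx ?_ ?_
    · intro r hr y hy
      obtain ⟨t, ht, h1⟩ := ih y hy
      obtain ⟨t', ht', h2⟩ := h (r • t) (Submodule.smul_mem_smul hr ht)
      refine ⟨t', ht', ?_⟩
      calc s ^ (n + 1) • r • y = s • r • s ^ n • y := by simp only [smul_smul]; congr 1; ring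
        _ = d ^ n • (s • r • t) := by rw [h1]; simp only [smul_smul]; congr 1; ring
        _ = _ := by rw [h2]; simp only [smul_smul]; congr 1; ring
    · rintro x y ⟨t, ht, h1⟩ ⟨t', ht', h2⟩
      exact ⟨t + t', add_mem ht ht', by rw [smul_add, smul_add, h1, h2]⟩

theorem mem_of_smul_mem {m : Ideal R} [hm : m.IsMaximal] {T : Submodule R K} {s : R} (hs : s ∉ m)
    (n k : ℕ) {x : K} (hx : x ∈ T) {B : Submodule R K} (h : s ^ n • x ∈ B) (hB : m ^ k • T ≤ B) :
    x ∈ B := by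
  obtain ⟨a, b, hb, hab⟩ := exists_inv_mod m hs n k
  have : x = a • s ^ n • x + b • x := by rw [smul_smul, ← add_smul, hab, one_smul]
  rw [this]
  exact add_mem (B.smul_mem _ h) (hB (Submodule.smul_mem_smul hb hx))

theorem relLen_pow_step {m : Ideal R} [hm : m.IsMaximal] {T : Submodule R K} (h1T : (1 : K) ∈ T)
    {w : K} (hwT : w ∈ T) (hw : T ≤ Submodule.span R {1, w} ⊔ m • T) {d s : R} (hd : d ∈ m)
    (hs : s ∉ m) (h : ∀ x ∈ m • T, ∃ t ∈ T, s • x = d • t) (j : ℕ) :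
    relLen (m ^ (j + 1) • T) (m ^ j • T) ≤ 2 := by
  set A := m ^ (j + 1) • T with hA
  have hdA : ∀ t ∈ T, ∀ r ∈ m, r • (d ^ j • t) ∈ A := by
    intro t ht r hr
    rw [smul_smul, hA, pow_succ']
    exact Submodule.smul_mem_smul (Ideal.mul_mem_mul hr (Ideal.pow_mem_pow hd j)) ht
  have hAB : A ≤ m ^ j • T := Submodule.smul_mono (Ideal.pow_le_pow_right (Nat.le_succ j)) le_rfl
  have hdB : ∀ t ∈ T, d ^ j • t ∈ m ^ j • T := fun t ht =>
    Submodule.smul_mem_smul (Ideal.pow_mem_pow hd j) ht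
  set B := Submodule.span R {d ^ j • (1 : K)} ⊔ A with hB
  have hBC : B ≤ m ^ j • T := by
    refine sup_le ?_ hAB
    rw [Submodule.span_singleton_le_iff_mem]
    exact hdB 1 h1T
  have hC : m ^ j • T ≤ Submodule.span R {d ^ j • w} ⊔ B := by
    intro x hx
    obtain ⟨t, ht, hxt⟩ := good_pow h j x hx
    refine mem_of_smul_mem hs j 1 (T := m ^ j • T) hx ?_ ?_
    · rw [hxt]
      obtain ⟨u, hu, v, hv, rfl⟩ := Submodule.mem_sup.1 (hw ht)
      obtain ⟨p, q, rfl⟩ := Submodule.mem_span_pair.1 hu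
      rw [smul_add, smul_add]
      refine add_mem (add_mem ?_ ?_) ?_
      · rw [smul_comm]
        exact Submodule.mem_sup_right (Submodule.mem_sup_left
          (Submodule.smul_mem _ _ (Submodule.mem_span_singleton_self _)))
      · rw [smul_comm]
        exact Submodule.mem_sup_left
          (Submodule.smul_mem _ _ (Submodule.mem_span_singleton_self _))
      · refine Submodule.mem_sup_right (Submodule.mem_sup_right ?_)
        rw [hA, pow_succ, mul_smul]
        exact Submodule.smul_mem_smul (Ideal.pow_mem_pow hd j) hv
    · rw [pow_one, ← mul_smul, ← pow_succ']
      exact le_sup_of_le_right le_sup_right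
  rw [relLen_add le_sup_right hBC]
  have e1 := relLen_le_one m (d ^ j • (1 : K)) (le_refl B) (hdA 1 h1T)
  have e2 := relLen_le_one m (d ^ j • w) hC
    (fun r hr => Submodule.mem_sup_right (hdA w hwT r hr))
  calc _ ≤ (1 : ℕ∞) + 1 := add_le_add e1 e2
    _ = 2 := by norm_num

theorem relLen_pow {m : Ideal R} [hm : m.IsMaximal] {T : Submodule R K} (h1T : (1 : K) ∈ T)
    {w : K} (hwT : w ∈ T) (hw : T ≤ Submodule.span R {1, w} ⊔ m • T) {d s : R} (hd : d ∈ m)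
    (hs : s ∉ m) (h : ∀ x ∈ m • T, ∃ t ∈ T, s • x = d • t) (j : ℕ) :
    relLen (m ^ j • T) T ≤ 2 * j := by
  induction j with
  | zero =>
    have : relLen (m ^ 0 • T) T = 0 := by
      unfold relLen
      rw [Module.length_eq_zero_iff, Submodule.Quotient.subsingleton_iff]
      ext x
      simp [Submodule.submoduleOf]
    rw [this]
    exact zero_le
  | succ n ih =>
    rw [relLen_add (Submodule.smul_mono (Ideal.pow_le_pow_right (Nat.le_succ n)) le_rfl)
      Submodule.smul_le_right]
    refine (add_le_add (relLen_pow_step h1T hwT hw hd hs h n) ih).trans ?_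
    push_cast
    rw [mul_add, add_comm]
    rfl

theorem artin_rees_K [IsNoetherianRing R] (m : Ideal R) {T N : Submodule R K} (hT : T.FG)
    (hN : N ≤ T) : ∃ c, ∀ n, m ^ (n + c) • T ⊓ N ≤ m ^ n • N := by
  have : Module.Finite R T := Module.Finite.iff_fg.2 hT
  obtain ⟨k, hk⟩ := Ideal.exists_pow_inf_eq_pow_smul m (N.submoduleOf T)
  refine ⟨k, fun n => ?_⟩
  have h := congrArg (Submodule.map T.subtype) (hk (n + k) (Nat.le_add_left _ _))
  rw [Submodule.map_inf _ T.injective_subtype, Submodule.map_smul'', Submodule.map_smul'',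
    Submodule.map_inf _ T.injective_subtype, Submodule.map_smul'', Submodule.map_top,
    Submodule.range_subtype, Nat.add_sub_cancel] at h
  have h2 : Submodule.map T.subtype (N.submoduleOf T) = N := by
    rw [Submodule.submoduleOf, Submodule.map_comap_subtype]
    exact inf_eq_right.2 hN
  rw [h2] at h
  rw [h]
  exact Submodule.smul_mono le_rfl inf_le_right

/-- Main local lemma. -/
theorem local_two_gen [IsNoetherianRing R] {m : Ideal R} [hm : m.IsMaximal] (hg : GoodAt K m)
    {N : Submodule R K} (hN1 : N ≤ 1) {x : K} (hx : x ∈ N) (hxm : x ∉ m • N) :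
    ∃ y ∈ N, N ≤ Submodule.span R {x, y} ⊔ m • N := by
  obtain ⟨T, h1T, hTT, hTfg, ⟨w, hwT, hw⟩, d, hd, hd0, s, hs, h⟩ := hg
  have hNT : N ≤ T := hN1.trans (Submodule.one_le.2 h1T)
  obtain ⟨c, hc⟩ := artin_rees_K m hTfg hNT
  by_contra hcon
  push Not at hcon
  have hmN : m • N ≤ N := Submodule.smul_le_right
  have h3 : 3 ≤ relLen (m • N) N := by
    obtain ⟨y, hyN, hy⟩ := SetLike.not_le_iff_exists.1 (hcon x hx)
    obtain ⟨z, hzN, hz⟩ := SetLike.not_le_iff_exists.1 (hcon y hyN)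
    set A1 := Submodule.span R {x} ⊔ m • N with hA1
    set A2 := Submodule.span R {x, y} ⊔ m • N with hA2
    have h01 : m • N ≤ A1 := le_sup_right
    have h12 : A1 ≤ A2 := sup_le_sup_right (Submodule.span_mono (by simp)) _
    have h2N : A2 ≤ N := by
      refine sup_le (Submodule.span_le.2 ?_) hmN
      rintro _ (rfl | rfl)
      · exact hx
      · exact hyN
    rw [relLen_add h01 (h12.trans h2N), relLen_add h12 h2N]
    have e1 : 1 ≤ relLen (m • N) A1 := one_le_relLen fun hle =>
      hxm (hle (Submodule.mem_sup_left (Submodule.mem_span_singleton_self x)))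
    have e2 : 1 ≤ relLen A1 A2 := one_le_relLen fun hle => hy (by
      have := hle (Submodule.mem_sup_left (Submodule.subset_span (by simp : y ∈ ({x, y} : Set K))))
      simpa using this)
    have e3 : 1 ≤ relLen A2 N := one_le_relLen fun hle => hz (hle hzN)
    calc (3 : ℕ∞) = 1 + (1 + 1) := by norm_num
      _ ≤ _ := add_le_add e1 (add_le_add e2 e3)
  -- the chain
  set n := 5 * c + 1 with hn
  let X : ℕ → Submodule R K := fun j => N.map (LinearMap.lsmul R K (d ^ j)) ⊔ m ^ n • N
  have hXm : ∀ j, X (j + 1) ≤ X j := by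
    intro j
    refine sup_le_sup_right ?_ _
    rintro _ ⟨u, hu, rfl⟩
    refine ⟨d • u, N.smul_mem _ hu, ?_⟩
    simp only [LinearMap.lsmul_apply, pow_succ, mul_smul]
  have hX0 : X 0 = N := by
    simp only [X, pow_zero]
    have : N.map (LinearMap.lsmul R K 1) = N := by
      ext u; simp
    rw [this]
    exact sup_eq_left.2 Submodule.smul_le_right
  have hXN : ∀ j, X j ≤ N := by
    intro j
    induction j with
    | zero => exact hX0.le
    | succ j ih => exact (hXm j).trans ih
  have hstep : ∀ j, j + c < n → 3 ≤ relLen (X (j + 1)) (X j) := by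
    intro j hj
    refine h3.trans ?_
    have e := relLen_le_map (A := X (j + 1)) (A' := m • N) (B := N)
      (LinearMap.lsmul R K (d ^ j)) ?_ hmN
    · refine e.trans (le_of_eq ?_)
      congr 1
      apply le_antisymm
      · exact sup_le (hXm j) le_sup_left
      · exact sup_le le_sup_right (le_sup_of_le_left le_sup_right)
    · intro u hu huX
      obtain ⟨_, ⟨i, hi, rfl⟩, v, hv, huv⟩ := Submodule.mem_sup.1 huX
      simp only [LinearMap.lsmul_apply] at huv
      have hv' : d ^ j • (u - d • i) ∈ m ^ n • T := by
        have : d ^ j • (u - d • i) = v := by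
          rw [smul_sub, ← huv, smul_smul, ← pow_succ]
          simp
        rw [this]
        exact Submodule.smul_mono le_rfl hNT hv
      obtain ⟨t, ht, htt⟩ := good_pow h n _ hv'
      have e4 : s ^ n • (u - d • i) = d ^ (n - j) • t := by
        apply smul_cancelK (pow_ne_zero j hd0)
        rw [smul_comm, htt, smul_smul, ← pow_add]
        congr 2
        omega
      have e5 : u - d • i ∈ N := sub_mem hu (N.smul_mem _ hi)
      have e6 : u - d • i ∈ m ^ (n - j) • T := by
        refine mem_of_smul_mem hs n (n - j) (hNT e5) ?_ le_rfl
        rw [e4]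
        exact Submodule.smul_mem_smul (Ideal.pow_mem_pow hd _) ht
      have e7 : u - d • i ∈ m ^ (1 + c) • T :=
        Submodule.smul_mono (Ideal.pow_le_pow_right (by omega)) le_rfl e6
      have e8 := hc 1 ⟨e7, e5⟩
      rw [pow_one] at e8
      have : u = (u - d • i) + d • i := by simp
      rw [this]
      exact add_mem e8 (Submodule.smul_mem_smul hd hi)
  have hchain : ∀ j, j + c ≤ n → (3 * j : ℕ∞) ≤ relLen (X j) N := by
    intro j
    induction j with
    | zero => intro _; simp
    | succ j ih =>
      intro hj
      rw [relLen_add (hXm j) (hXN j)]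
      have := add_le_add (hstep j (by omega)) (ih (by omega))
      refine le_trans (le_of_eq ?_) this
      push_cast
      ring
  have f1 := hchain (4 * c + 1) (by omega)
  have f2 : relLen (X (4 * c + 1)) N ≤ relLen (m ^ n • N) N := by
    rw [relLen_add (le_sup_right : m ^ n • N ≤ X (4 * c + 1)) (hXN _)]
    exact le_add_self
  have f3 : relLen (m ^ n • N) N ≤ relLen (m ^ (n + c) • T ⊓ N) N := by
    rw [relLen_add (hc n) (Submodule.smul_le_right)]
    exact le_add_self
  have f4 : relLen (m ^ (n + c) • T ⊓ N) N ≤ relLen (m ^ (n + c) • T) T :=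
    relLen_mono_right hNT le_rfl inf_le_left
  have f5 := relLen_pow h1T hwT hw hd hs h (n + c)
  have f6 := ((f1.trans f2).trans f3).trans (f4.trans f5)
  have f7 : ((3 * (4 * c + 1) : ℕ) : ℕ∞) ≤ ((2 * (n + c) : ℕ) : ℕ∞) := by
    push_cast
    push_cast at f6
    exact f6
  rw [Nat.cast_le] at f7
  omega
end U

section LG
variable {R : Type*} [CommRing R] [IsDomain R] {K : Type*} [Field K] [Algebra R K]
  [IsFractionRing R K]

theorem nakK {N G : Submodule R K} (hN : N.FG) {m : Ideal R} (h : N ≤ G ⊔ m • N) :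
    ∃ r, r - 1 ∈ m ∧ ∀ n ∈ N, r • n ∈ G := by
  obtain ⟨r, hr, h2⟩ := Submodule.exists_sub_one_mem_and_smul_le_of_fg_of_le_sup hN le_rfl h
  exact ⟨r, hr, fun n hn => h2 (Submodule.smul_mem_pointwise_smul n r N hn)⟩

theorem not_mem_of_sub_one_mem {m : Ideal R} (hm : m ≠ ⊤) {r : R} (h : r - 1 ∈ m) : r ∉ m := by
  intro h2
  apply hm
  rw [Ideal.eq_top_iff_one]
  have := sub_mem h2 h
  simpa using this

theorem nak_global {N G : Submodule R K} (hN : N.FG)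
    (h : ∀ m : Ideal R, m.IsMaximal → N ≤ G ⊔ m • N) : N ≤ G := by
  let A : Ideal R :=
    { carrier := {r | ∀ n ∈ N, r • n ∈ G}
      add_mem' := fun {a b} ha hb n hn => by
        rw [add_smul]; exact add_mem (ha n hn) (hb n hn)
      zero_mem' := fun n hn => by simp
      smul_mem' := fun c x hx n hn => by
        rw [smul_eq_mul, mul_smul]; exact G.smul_mem _ (hx n hn) }
  by_cases hA : A = ⊤
  · intro n hn
    have : (1 : R) ∈ A := by rw [hA]; trivial
    simpa using this n hn
  · obtain ⟨m, hm, hAm⟩ := Ideal.exists_le_maximal A hA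
    obtain ⟨r, hr, h2⟩ := nakK hN (h m hm)
    exact absurd (hAm h2) (not_mem_of_sub_one_mem hm.ne_top hr)

theorem nak_not_le {N : Submodule R K} (hN : N.FG) (h0 : N ≠ ⊥) {m : Ideal R} (hm : m ≠ ⊤) :
    ¬ N ≤ m • N := by
  intro h
  obtain ⟨r, hr, h2⟩ := nakK hN (G := ⊥) (by simpa using h)
  obtain ⟨x, hx, hx0⟩ := Submodule.exists_mem_ne_zero_of_ne_bot h0
  have h3 := h2 x hx
  rw [Submodule.mem_bot, Algebra.smul_def, mul_eq_zero] at h3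
  rcases h3 with h3 | h3
  · have : r = 0 := by simpa using h3
    subst this
    exact not_mem_of_sub_one_mem hm hr (zero_mem _)
  · exact hx0 h3

theorem integral_of_ring_fg {T : Submodule R K} (h1 : (1 : K) ∈ T) (hTT : T * T ≤ T) (hfg : T.FG)
    {t : K} (ht : t ∈ T) : IsIntegral R t := by
  refine IsIntegral.of_mem_of_fg
    (T.toSubalgebra h1 (fun x y hx hy => hTT (Submodule.mul_mem_mul hx hy))) ?_ t ?_
  · simpa using hfg
  · exact ht

theorem good_minimal {m : Ideal R} [hm : m.IsMaximal] (hg : GoodAt K m) :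
    ∃ d, m ∈ (Ideal.span {d} : Ideal R).minimalPrimes := by
  obtain ⟨T, h1T, hTT, hTfg, ⟨w, hwT, hw⟩, d, hd, hd0, s, hs, h⟩ := hg
  refine ⟨d, ⟨hm.isPrime, by rwa [Ideal.span_singleton_le_iff_mem]⟩, ?_⟩
  rintro Q ⟨hQ, hdQ⟩ hQm μ hμ
  rw [Ideal.span_singleton_le_iff_mem] at hdQ
  obtain ⟨t, ht, e⟩ := h (μ • 1) (Submodule.smul_mem_smul hμ h1T)
  obtain ⟨p, hp, hpt⟩ := integral_of_ring_fg h1T hTT hTfg ht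
  have h1 : Polynomial.aeval t p = 0 := hpt
  have h2 := Polynomial.scaleRoots_aeval_eq_zero (r := d) h1
  have h3 : algebraMap R K d * t = algebraMap R K (s * μ) := by
    rw [← Algebra.smul_def, ← e, smul_smul, Algebra.smul_def, mul_one]
  rw [h3, Polynomial.aeval_algebraMap_apply] at h2
  have h4 : (p.scaleRoots d).IsRoot (s * μ) := by
    have := (IsFractionRing.injective R K) (h2.trans (map_zero _).symm)
    simpa [Polynomial.IsRoot, Polynomial.aeval_def] using this
  have h5 := (Polynomial.scaleRoots.isWeaklyEisensteinAt p hdQ).pow_natDegree_le_of_root_of_monic_mem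
    h4 ((Polynomial.monic_scaleRoots_iff d).2 hp) _ le_rfl
  rcases hQ.mem_or_mem (hQ.mem_of_pow_mem _ h5) with h6 | h6
  · exact absurd (hQm h6) hs
  · exact h6

theorem minimal_of_height [IsNoetherianRing R] {m : Ideal R} [hm : m.IsPrime] (hh : m.height ≤ 1)
    {Q : Ideal R} [hQ : Q.IsPrime] (hQ0 : Q ≠ ⊥) (hQm : Q ≤ m) : Q = m := by
  by_contra hne
  have h1 : Q < m := lt_of_le_of_ne hQm hne
  have h2 : (⊥ : Ideal R) < Q := bot_lt_iff_ne_bot.2 hQ0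
  have h3 := Ideal.height_strict_mono_of_isPrime h1
  have : (⊥ : Ideal R).IsPrime := Ideal.isPrime_bot
  have h4 := Ideal.height_strict_mono_of_isPrime h2
  have h5 : Q.height < 1 := lt_of_lt_of_le h3 hh
  rw [Order.lt_one_iff] at h5
  rw [h5] at h4
  exact not_lt_bot h4

theorem finite_max [IsNoetherianRing R] (hg : ∀ m : Ideal R, m.IsMaximal → GoodAt K m)
    {a : R} (ha : a ≠ 0) : {m : Ideal R | m.IsMaximal ∧ a ∈ m}.Finite := by
  refine (Ideal.finite_minimalPrimes_of_isNoetherianRing R (Ideal.span {a})).subset ?_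
  rintro m ⟨hm, ham⟩
  refine ⟨⟨hm.isPrime, by rwa [Ideal.span_singleton_le_iff_mem]⟩, ?_⟩
  rintro Q ⟨hQ, haQ⟩ hQm
  rw [Ideal.span_singleton_le_iff_mem] at haQ
  obtain ⟨d, hd⟩ := good_minimal (hg m hm)
  have := Ideal.height_le_one_of_isPrincipal_of_mem_minimalPrimes _ _ hd
  have hQ' := hQ
  refine (minimal_of_height this ?_ hQm).ge
  rintro rfl
  exact ha haQ

theorem crtK {S : Set (Ideal R)} (hS : S.Finite) (hmax : ∀ m ∈ S, m.IsMaximal) {N : Submodule R K}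
    (y : Ideal R → K) (hy : ∀ m ∈ S, y m ∈ N) : ∃ b ∈ N, ∀ m ∈ S, b - y m ∈ m • N := by
  classical
  have : Fintype S := hS.fintype
  have hpair : Pairwise (Function.onFun IsCoprime (fun i : S => (i : Ideal R))) := by
    intro i j hij
    have := hmax i i.2
    have := hmax j j.2
    exact Ideal.isCoprime_of_isMaximal (fun h => hij (Subtype.ext h))
  choose e he using fun i : S => Ideal.exists_forall_sub_mem_ideal hpair (Pi.single i (1 : R))
  refine ⟨∑ i : S, e i • y i, Submodule.sum_mem _ fun i _ => N.smul_mem _ (hy i i.2), ?_⟩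
  intro m hm
  have h1 : y m = ∑ i : S, (Pi.single i (1 : R) : S → R) ⟨m, hm⟩ • y i := by
    rw [Finset.sum_eq_single ⟨m, hm⟩]
    · simp
    · intro b _ hb
      rw [Pi.single_eq_of_ne hb.symm, zero_smul]
    · simp
  rw [h1, ← Finset.sum_sub_distrib]
  refine Submodule.sum_mem _ fun i _ => ?_
  rw [← sub_smul]
  exact Submodule.smul_mem_smul (he i ⟨m, hm⟩) (hy i i.2)

theorem le_of_notMem {N : Submodule R K} (hN1 : N ≤ 1) {m : Ideal R} [m.IsMaximal] {r : R}
    (hr : r ∉ m) {G : Submodule R K} (hG : algebraMap R K r ∈ G) (hmG : m • N ≤ G) : N ≤ G := by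
  intro n hn
  obtain ⟨ν, rfl⟩ := Submodule.mem_one.1 (hN1 hn)
  refine mem_of_smul_mem hr 1 1 hn (B := G) ?_ (by simpa using hmG)
  rw [pow_one, Algebra.smul_def, mul_comm, ← Algebra.smul_def]
  exact G.smul_mem _ hG

theorem two_gen_K [IsNoetherianRing R] (hg : ∀ m : Ideal R, m.IsMaximal → GoodAt K m)
    {N : Submodule R K} (hN1 : N ≤ 1) (hNfg : N.FG) : ∃ a ∈ N, ∃ b ∈ N, N ≤ Submodule.span R {a, b} := by
  classical
  by_cases hN0 : N = ⊥
  · subst hN0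
    exact ⟨0, zero_mem _, 0, zero_mem _, bot_le⟩
  obtain ⟨a0, ha0, ha00⟩ := Submodule.exists_mem_ne_zero_of_ne_bot hN0
  obtain ⟨r0, rfl⟩ := Submodule.mem_one.1 (hN1 ha0)
  have hr0 : r0 ≠ 0 := fun h => ha00 (by rw [h, map_zero])
  obtain ⟨a1, ha1, ha10, ha1m⟩ : ∃ a1 ∈ N, a1 ≠ 0 ∧
      ∀ m ∈ {m : Ideal R | m.IsMaximal ∧ r0 ∈ m}, a1 ∉ m • N := by
    by_cases hS : {m : Ideal R | m.IsMaximal ∧ r0 ∈ m}.Nonempty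
    · have : ∀ m : Ideal R, ∃ y ∈ N, m.IsMaximal → y ∉ m • N := by
        intro m
        by_cases hm : m.IsMaximal
        · obtain ⟨y, hy, hy2⟩ := SetLike.not_le_iff_exists.1 (nak_not_le hNfg hN0 hm.ne_top)
          exact ⟨y, hy, fun _ => hy2⟩
        · exact ⟨0, zero_mem _, fun h => absurd h hm⟩
      choose y hyN hy using this
      obtain ⟨b, hbN, hb⟩ := crtK (finite_max hg hr0) (fun m hm => hm.1) y (fun m _ => hyN m)
      have hb2 : ∀ m ∈ {m : Ideal R | m.IsMaximal ∧ r0 ∈ m}, b ∉ m • N := by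
        intro m hm hbm
        apply hy m hm.1
        have := sub_mem hbm (hb m hm)
        simpa using this
      refine ⟨b, hbN, ?_, hb2⟩
      rintro rfl
      obtain ⟨m, hm⟩ := hS
      exact hb2 m hm (zero_mem _)
    · exact ⟨_, ha0, ha00, fun m hm => absurd ⟨m, hm⟩ hS⟩
  obtain ⟨r1, rfl⟩ := Submodule.mem_one.1 (hN1 ha1)
  have hr1 : r1 ≠ 0 := fun h => ha10 (by rw [h, map_zero])
  have : ∀ m : Ideal R, ∃ y ∈ N, (m.IsMaximal → r0 ∈ m →
      N ≤ Submodule.span R {algebraMap R K r1, y} ⊔ m • N) ∧ (r0 ∉ m → y = algebraMap R K r0) := by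
    intro m
    by_cases h : m.IsMaximal ∧ r0 ∈ m
    · have := h.1
      obtain ⟨y, hy, hy2⟩ := local_two_gen (hg m h.1) hN1 ha1 (ha1m m h)
      exact ⟨y, hy, fun _ _ => hy2, fun h3 => absurd h.2 h3⟩
    · exact ⟨_, ha0, fun h1 h2 => absurd ⟨h1, h2⟩ h, fun _ => rfl⟩
  choose y hyN hy1 hy2 using this
  obtain ⟨b, hbN, hb⟩ := crtK (finite_max hg hr1) (fun m hm => hm.1) y (fun m _ => hyN m)
  refine ⟨_, ha1, b, hbN, nak_global hNfg ?_⟩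
  intro m hm
  have ea1 : algebraMap R K r1 ∈ Submodule.span R {algebraMap R K r1, b} ⊔ m • N :=
    Submodule.mem_sup_left (Submodule.subset_span (by simp))
  have eb : b ∈ Submodule.span R {algebraMap R K r1, b} ⊔ m • N :=
    Submodule.mem_sup_left (Submodule.subset_span (by simp))
  by_cases h1 : r1 ∈ m
  · have h2 := hb m ⟨hm, h1⟩
    have ey : y m ∈ Submodule.span R {algebraMap R K r1, b} ⊔ m • N := by
      have := sub_mem eb (Submodule.mem_sup_right h2 :
        _ ∈ Submodule.span R {algebraMap R K r1, b} ⊔ m • N)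
      simpa using this
    by_cases h0 : r0 ∈ m
    · refine (hy1 m hm h0).trans (sup_le (Submodule.span_le.2 ?_) le_sup_right)
      rintro _ (rfl | rfl)
      · exact ea1
      · exact ey
    · rw [hy2 m h0] at ey
      exact le_of_notMem hN1 h0 ey le_sup_right
  · exact le_of_notMem hN1 h1 ea1 le_sup_right

/-- Global conclusion. -/
theorem two_gen_of_good [IsNoetherianRing R]
    (hg : ∀ m : Ideal R, m.IsMaximal → m ≠ ⊥ → GoodAt K m) (I : Ideal R) : I.TwoGenerated := by
  by_cases hf : IsField R
  · by_cases hI : I = ⊥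
    · exact ⟨0, 0, by simp [hI]⟩
    · obtain ⟨x, hx, hx0⟩ := Submodule.exists_mem_ne_zero_of_ne_bot hI
      obtain ⟨y, hy⟩ := hf.mul_inv_cancel hx0
      have h1 : (1 : R) ∈ I := hy ▸ I.mul_mem_right y hx
      refine ⟨1, 1, ?_⟩
      rw [(Ideal.eq_top_iff_one I).2 h1]
      simp
  · have hg' : ∀ m : Ideal R, m.IsMaximal → GoodAt K m := fun m hm =>
      hg m hm (Ring.ne_bot_of_isMaximal_of_not_isField hm hf)
    have hN1 : Submodule.map (Algebra.linearMap R K) I ≤ 1 := by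
      rw [Submodule.one_eq_range]
      exact LinearMap.map_le_range
    have hfg : (Submodule.map (Algebra.linearMap R K) I).FG :=
      Submodule.FG.map _ (IsNoetherian.noetherian I)
    obtain ⟨_, ⟨a, ha, rfl⟩, _, ⟨b, hb, rfl⟩, h⟩ := two_gen_K hg' hN1 hfg
    refine ⟨a, b, le_antisymm ?_ ?_⟩
    · intro x hx
      obtain ⟨p, q, hpq⟩ := Submodule.mem_span_pair.1 (h ⟨x, hx, rfl⟩)
      rw [Ideal.mem_span_pair]
      refine ⟨p, q, IsFractionRing.injective R K ?_⟩
      simpa [Algebra.smul_def] using hpq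
    · rw [Ideal.span_le]
      rintro _ (rfl | rfl)
      · exact ha
      · exact hb
end LG

section DD
variable {R : Type*} [CommRing R] [IsDomain R] {K : Type*} [Field K] [Algebra R K]
  [IsFractionRing R K]

theorem smul_mul_le {m : Ideal R} {T Q : Submodule R K} (h : T * Q ≤ Q) {t x : K} (ht : t ∈ T)
    (hx : x ∈ m • Q) : t * x ∈ m • Q := by
  refine Submodule.smul_induction_on hx ?_ ?_
  · intro r hr q hq
    rw [mul_smul_comm]
    exact Submodule.smul_mem_smul hr (h (Submodule.mul_mem_mul ht hq))
  · intro x y hx hy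
    rw [mul_add]
    exact add_mem hx hy

theorem D_claim {m : Ideal R} [hm : m.IsMaximal] {T : Submodule R K} (h1T : (1 : K) ∈ T)
    {w : K} (hwT : w ∈ T) (hw : T ≤ Submodule.span R {1, w} ⊔ m • T)
    {N : Submodule R K} (hPN : m • T ≤ N) (hNT : N ≤ T) (h1 : (1 : K) ∉ N) {v : K} (hv : v ∈ N)
    (hvP : v ∉ m • T) : N ≤ Submodule.span R {v} ⊔ m • T := by
  have key : ∀ c : R, c • (1 : K) ∈ N → c ∈ m := by
    intro c hc
    by_contra hcm
    exact h1 (mem_of_smul_mem hcm 1 1 h1T (by simpa using hc) (by simpa using hPN))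
  intro u hu
  obtain ⟨_, h1', p, hp, rfl⟩ := Submodule.mem_sup.1 (hw (hNT hu))
  obtain ⟨a, b, rfl⟩ := Submodule.mem_span_pair.1 h1'
  obtain ⟨_, h2', p', hp', rfl⟩ := Submodule.mem_sup.1 (hw (hNT hv))
  obtain ⟨a', b', rfl⟩ := Submodule.mem_span_pair.1 h2'
  have hb' : b' ∉ m := by
    intro hb'
    have e1 : b' • w ∈ m • T := Submodule.smul_mem_smul hb' hwT
    have e2 : a' • (1 : K) ∈ N := by
      have := sub_mem hv (hPN (add_mem e1 hp'))
      convert this using 1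
      abel
    exact hvP (add_mem (add_mem (Submodule.smul_mem_smul (key a' e2) h1T) e1) hp')
  refine mem_of_smul_mem hb' 1 1 (hNT hu) ?_ (by simp)
  rw [pow_one]
  have e3 : (b' * a - b * a') • (1 : K) ∈ N := by
    have : (b' * a - b * a') • (1 : K) = b' • (a • 1 + b • w + p) - b • (a' • 1 + b' • w + p')
        - (b' • p - b • p') := by
      simp only [smul_add, sub_smul, mul_smul, smul_comm b b' w]
      abel
    rw [this]
    exact sub_mem (sub_mem (N.smul_mem _ hu) (N.smul_mem _ hv))
      (hPN (sub_mem (Submodule.smul_mem _ _ hp) (Submodule.smul_mem _ _ hp')))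
  have e4 : b' • (a • (1 : K) + b • w + p) = b • (a' • 1 + b' • w + p') +
      ((b' * a - b * a') • (1 : K) + (b' • p - b • p')) := by
    simp only [smul_add, sub_smul, mul_smul, smul_comm b b' w]
    abel
  rw [e4]
  refine add_mem (Submodule.mem_sup_left (Submodule.smul_mem _ _
    (Submodule.mem_span_singleton_self _))) (Submodule.mem_sup_right (add_mem ?_ ?_))
  · exact Submodule.smul_mem_smul (key _ e3) h1T
  · exact sub_mem (Submodule.smul_mem _ _ hp) (Submodule.smul_mem _ _ hp')

theorem D_exists {m : Ideal R} [hm : m.IsMaximal] {T : Submodule R K} (h1T : (1 : K) ∈ T)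
    (hTT : T * T ≤ T)
    {w : K} (hwT : w ∈ T) (hw : T ≤ Submodule.span R {1, w} ⊔ m • T) (h1P : (1 : K) ∉ m • T)
    {Q : Submodule R K} (hTQ : T * Q ≤ Q) (h1Q : (1 : K) ∈ m • Q) (hQT : m • Q ≤ T) :
    ∃ d ∈ m, (1 : K) ∈ Q.map (LinearMap.lsmul R K d) ⊔ m • T := by
  by_contra hcon
  push Not at hcon
  let N : R → Submodule R K := fun d => Q.map (LinearMap.lsmul R K d) ⊔ m • T
  have hPN : ∀ d, m • T ≤ N d := fun d => le_sup_right
  have hmTT : m • T ≤ T := Submodule.smul_le_right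
  have hNT : ∀ d ∈ m, N d ≤ T := by
    intro d hd
    refine sup_le ?_ hmTT
    rintro _ ⟨q, hq, rfl⟩
    exact hQT (Submodule.smul_mem_smul hd hq)
  have hdN : ∀ d, ∀ q ∈ Q, d • q ∈ N d := fun d q hq => Submodule.mem_sup_left ⟨q, hq, rfl⟩
  have hTN : ∀ d, ∀ t ∈ T, ∀ x ∈ N d, t * x ∈ N d := by
    intro d t ht x hx
    obtain ⟨_, ⟨q, hq, rfl⟩, p, hp, rfl⟩ := Submodule.mem_sup.1 hx
    rw [mul_add, LinearMap.lsmul_apply, mul_smul_comm]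
    exact add_mem (hdN d _ (hTQ (Submodule.mul_mem_mul ht hq))) (hPN d (smul_mul_le hTT ht hp))
  have claim := fun d (hd : d ∈ m) v hv hvP =>
    D_claim (v := v) h1T hwT hw (hPN d) (hNT d hd) (hcon d hd) hv hvP
  obtain ⟨d1, hd1, q0, hq0, hv1⟩ : ∃ d1 ∈ m, ∃ q0 ∈ Q, d1 • q0 ∉ m • T := by
    by_contra h
    push Not at h
    exact h1P ((Submodule.smul_le.2 h) h1Q)
  obtain ⟨d2, hd2, h21⟩ : ∃ d2 ∈ m, ¬ N d2 ≤ N d1 := by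
    by_contra h
    push Not at h
    exact hcon d1 hd1 ((Submodule.smul_le.2 fun r hr q hq => h r hr (hdN r q hq)) h1Q)
  obtain ⟨v2, hv2, hv21⟩ := SetLike.not_le_iff_exists.1 h21
  have h1sum : (1 : K) ∈ N d1 ⊔ N d2 := by
    by_contra h
    have := D_claim h1T hwT hw (le_sup_of_le_left (hPN d1)) (sup_le (hNT d1 hd1) (hNT d2 hd2)) h
      (Submodule.mem_sup_left (hdN d1 q0 hq0)) hv1
    apply hv21
    have h3 := this (Submodule.mem_sup_right hv2)
    refine (sup_le ?_ (hPN d1) : Submodule.span R {d1 • q0} ⊔ m • T ≤ N d1) h3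
    rw [Submodule.span_singleton_le_iff_mem]
    exact hdN d1 q0 hq0
  have hinter : ∀ u, u ∈ N d1 → u ∈ N d2 → u ∈ m • T := by
    intro u hu1 hu2
    by_contra huP
    have := claim d2 hd2 u hu2 huP
    apply hv21
    refine (sup_le ?_ (hPN d1) : Submodule.span R {u} ⊔ m • T ≤ N d1) (this hv2)
    rwa [Submodule.span_singleton_le_iff_mem]
  obtain ⟨n1, hn1, n2, hn2, hn⟩ := Submodule.mem_sup.1 h1sum
  obtain ⟨_, ⟨q1, hq1, rfl⟩, p1, hp1, e1⟩ := Submodule.mem_sup.1 hn1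
  obtain ⟨_, ⟨q2, hq2, rfl⟩, p2, hp2, e2⟩ := Submodule.mem_sup.1 hn2
  simp only [LinearMap.lsmul_apply] at e1 e2
  have hn1T := hNT d1 hd1 hn1
  have hn2T := hNT d2 hd2 hn2
  apply hcon (d1 + d2) (add_mem hd1 hd2)
  have hq : n1 * q1 + n2 * q2 ∈ Q :=
    add_mem (hTQ (Submodule.mul_mem_mul hn1T hq1)) (hTQ (Submodule.mul_mem_mul hn2T hq2))
  have hd12 : n1 * (d2 • q1) ∈ m • T := by
    apply hinter
    · rw [mul_comm]
      exact hTN d1 _ (hQT (Submodule.smul_mem_smul hd2 hq1)) _ hn1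
    · exact hTN d2 _ hn1T _ (hdN d2 q1 hq1)
  have hd21 : n2 * (d1 • q2) ∈ m • T := by
    apply hinter
    · exact hTN d1 _ hn2T _ (hdN d1 q2 hq2)
    · rw [mul_comm]
      exact hTN d2 _ (hQT (Submodule.smul_mem_smul hd1 hq2)) _ hn2
  have hn12 : n1 * n2 ∈ m • T := by
    apply hinter
    · rw [mul_comm]
      exact hTN d1 _ hn2T _ hn1
    · exact hTN d2 _ hn1T _ hn2
  have hfin : (1 : K) = (d1 + d2) • (n1 * q1 + n2 * q2) + (n1 * p1 + n2 * p2 +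
      (n1 * n2 + n1 * n2) - n1 * (d2 • q1) - n2 * (d1 • q2)) := by
    have e1' : d1 • q1 = n1 - p1 := by rw [← e1]; simp
    have e2' : d2 • q2 = n2 - p2 := by rw [← e2]; simp
    have : (d1 + d2) • (n1 * q1 + n2 * q2) = n1 * (d1 • q1) + n2 * (d1 • q2) + n1 * (d2 • q1)
        + n2 * (d2 • q2) := by
      simp only [smul_add, add_smul, mul_smul_comm]
      abel
    rw [this, e1', e2']
    have hn2' : n2 = 1 - n1 := by rw [← hn]; ring
    rw [hn2']
    ring
  rw [hfin]
  refine add_mem (Submodule.mem_sup_left ⟨_, hq, rfl⟩) (Submodule.mem_sup_right ?_)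
  exact sub_mem (sub_mem (add_mem (add_mem (smul_mul_le hTT hn1T hp1) (smul_mul_le hTT hn2T hp2))
    (add_mem hn12 hn12)) hd12) hd21

theorem goodAt_of_D {m : Ideal R} [hm : m.IsMaximal] (hm0 : m ≠ ⊥) {T : Submodule R K}
    (h1T : (1 : K) ∈ T) (hTT : T * T ≤ T) (hfg : T.FG)
    {w : K} (hwT : w ∈ T) (hw : T ≤ Submodule.span R {1, w} ⊔ m • T)
    {Q : Submodule R K} (hTQ : T * Q ≤ Q) (h1Q : (1 : K) ∈ m • Q) (hQT : m • Q ≤ T) :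
    GoodAt K m := by
  have h1P : (1 : K) ∉ m • T := by
    intro h
    refine nak_not_le hfg ?_ hm.ne_top (fun t ht => ?_)
    · intro h0
      rw [h0, Submodule.mem_bot] at h1T
      exact one_ne_zero h1T
    · have := smul_mul_le hTT ht h
      rwa [mul_one] at this
  obtain ⟨d, hd, h1d⟩ := D_exists h1T hTT hwT hw h1P hTQ h1Q hQT
  have hT : T ≤ Q.map (LinearMap.lsmul R K d) ⊔ m • T := by
    intro t ht
    obtain ⟨_, ⟨q, hq, rfl⟩, p, hp, e⟩ := Submodule.mem_sup.1 h1d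
    rw [← mul_one t, ← e, mul_add, LinearMap.lsmul_apply, mul_smul_comm]
    exact add_mem (Submodule.mem_sup_left ⟨_, hTQ (Submodule.mul_mem_mul ht hq), rfl⟩)
      (Submodule.mem_sup_right (smul_mul_le hTT ht hp))
  obtain ⟨s, hs, hsT⟩ := nakK hfg hT
  have hs' := not_mem_of_sub_one_mem hm.ne_top hs
  have hmain : ∀ x ∈ m • T, ∃ t ∈ T, s • x = d • t := by
    intro x hx
    refine Submodule.smul_induction_on hx ?_ ?_
    · intro r hr t ht
      obtain ⟨q, hq, e⟩ := hsT t ht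
      refine ⟨r • q, hQT (Submodule.smul_mem_smul hr hq), ?_⟩
      rw [smul_comm, ← e, LinearMap.lsmul_apply, smul_comm]
    · rintro x y ⟨t, ht, h1⟩ ⟨t', ht', h2⟩
      exact ⟨t + t', add_mem ht ht', by rw [smul_add, smul_add, h1, h2]⟩
  refine ⟨T, h1T, hTT, hfg, ⟨w, hwT, hw⟩, d, hd, ?_, s, hs', hmain⟩
  rintro rfl
  obtain ⟨μ, hμ, hμ0⟩ := Submodule.exists_mem_ne_zero_of_ne_bot hm0
  obtain ⟨t, ht, e⟩ := hmain (μ • 1) (Submodule.smul_mem_smul hμ h1T)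
  rw [zero_smul, smul_smul, Algebra.smul_def, mul_one] at e
  have : s * μ = 0 := by simpa using e
  rcases mul_eq_zero.1 this with h | h
  · exact hs' (h ▸ zero_mem _)
  · exact hμ0 h
end DD

section BB
variable {R : Type*} [CommRing R] [IsDomain R] {K : Type*} [Field K] [Algebra R K]
  [IsFractionRing R K]

theorem one_memK : (1 : K) ∈ (1 : Submodule R K) := Submodule.one_le.1 le_rfl

theorem idl_mul (m : Ideal R) (X : Submodule R K) : (m • (1 : Submodule R K)) * X = m • X := by
  apply le_antisymm
  · refine Submodule.mul_le.2 fun a ha b hb => ?_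
    rw [mul_comm]
    refine Submodule.smul_induction_on ha ?_ ?_
    · intro r hr n hn
      obtain ⟨ν, rfl⟩ := Submodule.mem_one.1 hn
      rw [mul_smul_comm, mul_comm, ← Algebra.smul_def]
      exact Submodule.smul_mem_smul hr (X.smul_mem _ hb)
    · intro x y hx hy
      rw [mul_add]
      exact add_mem hx hy
  · refine Submodule.smul_le.2 fun r hr x hx => ?_
    have : r • x = (r • (1 : K)) * x := by rw [smul_mul_assoc, one_mul]
    rw [this]
    exact Submodule.mul_mem_mul (Submodule.smul_mem_smul hr one_memK) hx

theorem idl_le_one (m : Ideal R) : m • (1 : Submodule R K) ≤ 1 := Submodule.smul_le_right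

theorem idl_ne_bot {m : Ideal R} (hm0 : m ≠ ⊥) : m • (1 : Submodule R K) ≠ ⊥ := by
  obtain ⟨μ, hμ, hμ0⟩ := Submodule.exists_mem_ne_zero_of_ne_bot hm0
  intro h
  have : μ • (1 : K) ∈ m • (1 : Submodule R K) := Submodule.smul_mem_smul hμ one_memK
  rw [h, Submodule.mem_bot, Algebra.smul_def, mul_one] at this
  exact hμ0 (by simpa using this)

theorem maxI_le {m : Ideal R} [hm : m.IsMaximal] {N : Submodule R K} (hN : N ≤ 1)
    (hMN : m • (1 : Submodule R K) ≤ N) (h1 : (1 : K) ∉ N) : N ≤ m • 1 := by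
  intro n hn
  obtain ⟨ν, rfl⟩ := Submodule.mem_one.1 (hN hn)
  by_cases hν : ν ∈ m
  · have : algebraMap R K ν = ν • (1 : K) := by rw [Algebra.smul_def, mul_one]
    rw [this]
    exact Submodule.smul_mem_smul hν one_memK
  · exact absurd (le_of_notMem le_rfl hν hn hMN one_memK) h1

theorem fg_of_frac [IsNoetherianRing R] {J : Submodule R K} (h : FracK J) : J.FG := by
  obtain ⟨a, ha, h⟩ := h
  have h1 : J ≤ Submodule.span R {a⁻¹} * 1 := by
    intro x hx
    rw [mem_scale' (inv_ne_zero ha), inv_inv]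
    exact h x hx
  rw [mul_one] at h1
  exact Submodule.FG.of_le (Submodule.fg_span_singleton _) h1

theorem frac_mono {J J' : Submodule R K} (h : J ≤ J') (h' : FracK J') : FracK J := by
  obtain ⟨a, ha, h2⟩ := h'
  exact ⟨a, ha, fun x hx => h2 x (h hx)⟩

theorem frac_of_le_one {J : Submodule R K} (h : J ≤ 1) : FracK J :=
  ⟨1, one_ne_zero, fun x hx => by rw [one_mul]; exact h hx⟩

theorem one_mem_div_self (J : Submodule R K) : (1 : K) ∈ J / J :=
  mem_divK.2 fun y hy => by rwa [one_mul]

theorem div_self_mul_le (J : Submodule R K) : (J / J) * (J / J) ≤ J / J :=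
  Submodule.mul_le.2 fun a ha b hb => mem_divK.2 fun y hy => by
    rw [mul_assoc]
    exact mem_divK.1 ha _ (mem_divK.1 hb y hy)

theorem frac_div {I J : Submodule R K} (hI : FracK I) (hJ : J ≠ ⊥) : FracK (I / J) := by
  obtain ⟨a, ha, h⟩ := hI
  obtain ⟨y, hy, hy0⟩ := Submodule.exists_mem_ne_zero_of_ne_bot hJ
  refine ⟨a * y, mul_ne_zero ha hy0, fun x hx => ?_⟩
  have := h _ (mem_divK.1 hx y hy)
  convert this using 1
  ring

theorem mul_div_le (I J : Submodule R K) : J * (I / J) ≤ I :=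
  Submodule.mul_le.2 fun a ha b hb => by
    rw [mul_comm]
    exact mem_divK.1 hb a ha

theorem good_B [IsNoetherianRing R] (hS : StabK R K) (hD : DivK R K) (m : Ideal R)
    [hm : m.IsMaximal] (hm0 : m ≠ ⊥) : GoodAt K m := by
  set M := m • (1 : Submodule R K) with hM
  have hM1 : M ≤ 1 := idl_le_one m
  have hM0 : M ≠ ⊥ := idl_ne_bot hm0
  by_cases hc : (1 : K) ∈ m • (1 / M)
  · refine goodAt_of_D hm0 (T := 1) (w := 1) one_memK (by rw [mul_one])
      (fg_of_frac (frac_of_le_one le_rfl)) one_memK ?_ (Q := 1 / M)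
      (by rw [one_mul]) hc ?_
    · refine le_sup_of_le_left ?_
      rw [Submodule.one_eq_span]
      exact Submodule.span_mono (by simp)
    · rw [← idl_mul]
      exact mul_div_le 1 M
  · set T := M / M with hT
    have h1 : M * (1 / M) ≤ M := by
      refine maxI_le (mul_div_le 1 M) ?_ (by rwa [idl_mul])
      intro x hx
      rw [← mul_one x]
      exact Submodule.mul_mem_mul hx (mem_divK.2 fun y hy => by rw [one_mul]; exact hM1 hy)
    have h2 : 1 / M ≤ T := by
      intro x hx
      refine mem_divK.2 fun y hy => h1 ?_
      rw [mul_comm x y]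
      exact Submodule.mul_mem_mul hy hx
    have h3 : T ≤ 1 / M := div_monoK hM1
    have h1T : (1 : K) ∈ T := one_mem_div_self M
    have hTT : T * T ≤ T := div_self_mul_le M
    have hTfr : FracK T := frac_div (frac_of_le_one hM1) hM0
    have hstab := hS M hM0 (frac_of_le_one hM1)
    rw [idl_mul] at hstab
    obtain ⟨w, hwT, hw⟩ : ∃ w ∈ T, T ≤ Submodule.span R {1, w} := by
      by_cases hT1 : T ≤ 1
      · refine ⟨1, h1T, hT1.trans ?_⟩
        rw [Submodule.one_eq_span]
        exact Submodule.span_mono (by simp)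
      · obtain ⟨z, hzT, hz⟩ := SetLike.not_le_iff_exists.1 hT1
        refine ⟨z, hzT, ?_⟩
        set X := Submodule.span R {1, z} with hX
        have h1X : (1 : K) ∈ X := Submodule.subset_span (by simp)
        have hzX : z ∈ X := Submodule.subset_span (by simp)
        have hXT : X ≤ T := by
          refine Submodule.span_le.2 ?_
          rintro _ (rfl | rfl)
          · exact h1T
          · exact hzT
        have hX0 : X ≠ ⊥ := fun h => one_ne_zero ((Submodule.mem_bot R).1 (h ▸ h1X))
        have e1 : 1 / X ≤ M := by
          refine maxI_le ?_ ?_ ?_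
          · intro x hx
            have := mem_divK.1 hx 1 h1X
            rwa [mul_one] at this
          · intro x hx
            refine mem_divK.2 fun y hy => hM1 ?_
            rw [mul_comm]
            exact mem_divK.1 (hXT hy) x hx
          · intro h
            have := mem_divK.1 h z hzX
            rw [one_mul] at this
            exact hz this
        exact h3.trans ((div_antiK e1).trans (hD X hX0 (frac_mono hXT hTfr)))
    refine goodAt_of_D hm0 h1T hTT (fg_of_frac hTfr) hwT (hw.trans le_sup_left) (Q := T / M) ?_
      hstab ?_
    · refine Submodule.mul_le.2 fun a ha b hb => mem_divK.2 fun y hy => ?_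
      rw [mul_assoc]
      exact hTT (Submodule.mul_mem_mul ha (mem_divK.1 hb y hy))
    · rw [← idl_mul]
      exact mul_div_le T M

theorem noeth_of_div_mori (h1 : DivisorialRing R) (h2 : MoriRing R) : IsNoetherianRing R := by
  rw [isNoetherianRing_iff, ← monotone_stabilizes_iff_noetherian]
  intro f
  obtain ⟨n, hn⟩ := h2 f (fun n => by
    by_cases h : f n = ⊥
    · rw [h]
      unfold Ideal.IsDivisorial
      simp
    · exact h1 _ h)
  exact ⟨n, fun m hm => (hn m hm).symm⟩

theorem part_B (h1 : DivisorialRing R) (h2 : StableRing R) (h3 : MoriRing R) (I : Ideal R) :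
    I.TwoGenerated := by
  have := noeth_of_div_mori h1 h3
  exact two_gen_of_good (K := FractionRing R) (fun m hm hm0 =>
    good_B (StabK_of_stable h2) (DivK_of_divisorial h1) m hm0) I
end BB

section AA
variable {R : Type*} [CommRing R] [IsDomain R]

theorem field_dep {k : Type*} [Field k] (p q : Fin 3 → k) :
    ∃ c : Fin 3 → k, c ≠ 0 ∧ ∑ i, c i * p i = 0 ∧ ∑ i, c i * q i = 0 := by
  let f : (Fin 3 → k) →ₗ[k] (Fin 2 → k) :=
    Matrix.mulVecLin (Matrix.of ![p, q])
  have h : LinearMap.ker f ≠ ⊥ := by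
    apply LinearMap.ker_ne_bot_of_finrank_lt
    simp
  obtain ⟨c, hc, hc0⟩ := Submodule.exists_mem_ne_zero_of_ne_bot h
  refine ⟨c, hc0, ?_, ?_⟩
  · have := congrFun (LinearMap.mem_ker.1 hc) 0
    simpa [f, Matrix.mulVec, dotProduct, mul_comm] using this
  · have := congrFun (LinearMap.mem_ker.1 hc) 1
    simpa [f, Matrix.mulVec, dotProduct, mul_comm] using this

theorem exact_rel (h2 : ∀ I : Ideal R, I.TwoGenerated) (a b : R) (m : Ideal R)
    [hm : m.IsMaximal] : ∃ α β γ : R, α * a ^ 2 + β * (a * b) + γ * b ^ 2 = 0 ∧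
      ¬ (α ∈ m ∧ β ∈ m ∧ γ ∈ m) := by
  obtain ⟨u, v, huv⟩ := h2 (Ideal.span {a ^ 2, a * b, b ^ 2})
  have ha : a ^ 2 ∈ Ideal.span {u, v} := huv ▸ Ideal.subset_span (by simp)
  have hab : a * b ∈ Ideal.span {u, v} := huv ▸ Ideal.subset_span (by simp)
  have hb : b ^ 2 ∈ Ideal.span {u, v} := huv ▸ Ideal.subset_span (by simp)
  have hu : u ∈ Ideal.span {a ^ 2, a * b, b ^ 2} := huv ▸ Ideal.subset_span (by simp)
  have hv : v ∈ Ideal.span {a ^ 2, a * b, b ^ 2} := huv ▸ Ideal.subset_span (by simp)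
  rw [Ideal.mem_span_pair] at ha hab hb
  obtain ⟨p1, q1, e1⟩ := ha
  obtain ⟨p2, q2, e2⟩ := hab
  obtain ⟨p3, q3, e3⟩ := hb
  have tri : ∀ w ∈ Ideal.span {a ^ 2, a * b, b ^ 2}, ∃ x y z : R,
      w = x * a ^ 2 + y * (a * b) + z * b ^ 2 := by
    intro w hw
    obtain ⟨x, w', hw', e⟩ := Ideal.mem_span_insert.1 hw
    obtain ⟨y, z, e'⟩ := Ideal.mem_span_pair.1 hw'
    exact ⟨x, y, z, by rw [e, ← e']; ring⟩
  obtain ⟨x1, y1, z1, f1⟩ := tri u hu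
  obtain ⟨x2, y2, z2, f2⟩ := tri v hv
  letI : Field (R ⧸ m) := Ideal.Quotient.field m
  obtain ⟨c, hc0, hc1, hc2⟩ := field_dep (k := R ⧸ m)
    (fun i => Ideal.Quotient.mk m (![p1, p2, p3] i)) (fun i => Ideal.Quotient.mk m (![q1, q2, q3] i))
  obtain ⟨α, hα⟩ := Ideal.Quotient.mk_surjective (c 0)
  obtain ⟨β, hβ⟩ := Ideal.Quotient.mk_surjective (c 1)
  obtain ⟨γ, hγ⟩ := Ideal.Quotient.mk_surjective (c 2)
  have g1 : α * p1 + β * p2 + γ * p3 ∈ m := by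
    rw [← Ideal.Quotient.eq_zero_iff_mem]
    simp only [map_add, map_mul, hα, hβ, hγ]
    rw [Fin.sum_univ_three] at hc1
    simpa using hc1
  have g2 : α * q1 + β * q2 + γ * q3 ∈ m := by
    rw [← Ideal.Quotient.eq_zero_iff_mem]
    simp only [map_add, map_mul, hα, hβ, hγ]
    rw [Fin.sum_univ_three] at hc2
    simpa using hc2
  set P := α * p1 + β * p2 + γ * p3 with hP
  set Q := α * q1 + β * q2 + γ * q3 with hQ
  refine ⟨α - (P * x1 + Q * x2), β - (P * y1 + Q * y2), γ - (P * z1 + Q * z2), ?_, ?_⟩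
  · have : α * a ^ 2 + β * (a * b) + γ * b ^ 2 = P * u + Q * v := by
      rw [← e1, ← e2, ← e3, hP, hQ]; ring
    have h5 : P * u + Q * v = P * (x1 * a ^ 2 + y1 * (a * b) + z1 * b ^ 2) +
      Q * (x2 * a ^ 2 + y2 * (a * b) + z2 * b ^ 2) := by rw [← f1, ← f2]
    linear_combination this + h5
  · rintro ⟨k1, k2, k3⟩
    have hPQ : ∀ x y, P * x + Q * y ∈ m := fun x y =>
      add_mem (m.mul_mem_right _ g1) (m.mul_mem_right _ g2)
    have l1 : α ∈ m := by simpa using add_mem k1 (hPQ x1 x2)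
    have l2 : β ∈ m := by simpa using add_mem k2 (hPQ y1 y2)
    have l3 : γ ∈ m := by simpa using add_mem k3 (hPQ z1 z2)
    rw [← Ideal.Quotient.eq_zero_iff_mem] at l1 l2 l3
    apply hc0
    funext i
    fin_cases i
    · exact hα.symm.trans l1
    · exact hβ.symm.trans l2
    · exact hγ.symm.trans l3

theorem loc_stable (h2 : ∀ I : Ideal R, I.TwoGenerated) (I : Ideal R) (m : Ideal R)
    [hm : m.IsMaximal] : ∃ c ∈ I, ∃ s, s ∉ m ∧ ∀ x ∈ I, ∀ y ∈ I, ∃ z ∈ I, s * (x * y) = c * z := by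
  obtain ⟨a, b, rfl⟩ := h2 I
  obtain ⟨α, β, γ, hrel, hnot⟩ := exact_rel h2 a b m
  have ha : a ∈ Ideal.span {a, b} := Ideal.subset_span (by simp)
  have hb : b ∈ Ideal.span {a, b} := Ideal.subset_span (by simp)
  suffices h : ∃ c ∈ Ideal.span {a, b}, ∃ s, s ∉ m ∧ (∃ z ∈ Ideal.span {a, b}, s * a ^ 2 = c * z) ∧
      (∃ z ∈ Ideal.span {a, b}, s * (a * b) = c * z) ∧
      (∃ z ∈ Ideal.span {a, b}, s * b ^ 2 = c * z) by
    obtain ⟨c, hc, s, hs, ⟨z1, hz1, e1⟩, ⟨z2, hz2, e2⟩, ⟨z3, hz3, e3⟩⟩ := h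
    refine ⟨c, hc, s, hs, fun x hx y hy => ?_⟩
    obtain ⟨x1, x2, rfl⟩ := Ideal.mem_span_pair.1 hx
    obtain ⟨y1, y2, rfl⟩ := Ideal.mem_span_pair.1 hy
    refine ⟨x1 * y1 * z1 + (x1 * y2 + x2 * y1) * z2 + x2 * y2 * z3, ?_, ?_⟩
    · exact add_mem (add_mem (Ideal.mul_mem_left _ _ hz1) (Ideal.mul_mem_left _ _ hz2))
        (Ideal.mul_mem_left _ _ hz3)
    · linear_combination x1 * y1 * e1 + (x1 * y2 + x2 * y1) * e2 + x2 * y2 * e3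
  by_cases hα : α ∈ m
  · by_cases hγ : γ ∈ m
    · have hβ : β ∉ m := fun h => hnot ⟨hα, h, hγ⟩
      have hD : β * (β - α - γ) ∉ m := by
        intro h
        rcases hm.isPrime.mem_or_mem h with h | h
        · exact hβ h
        · apply hβ
          have := add_mem (add_mem h hα) hγ
          convert this using 1
          ring
      refine ⟨a + b, add_mem ha hb, β * (β - α - γ), hD,
        ⟨(β - γ) * β * a + γ * β * b, ?_, ?_⟩,
        ⟨β * (β - α - γ) * a - ((β - γ) * β * a + γ * β * b), ?_, ?_⟩,
        ⟨(β - α) * β * b + α * β * a, ?_, ?_⟩⟩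
      · exact add_mem (Ideal.mul_mem_left _ _ ha) (Ideal.mul_mem_left _ _ hb)
      · linear_combination (-β) * hrel
      · exact sub_mem (Ideal.mul_mem_left _ _ ha)
          (add_mem (Ideal.mul_mem_left _ _ ha) (Ideal.mul_mem_left _ _ hb))
      · linear_combination β * hrel
      · exact add_mem (Ideal.mul_mem_left _ _ hb) (Ideal.mul_mem_left _ _ ha)
      · linear_combination (-β) * hrel
    · refine ⟨a, ha, γ, hγ, ⟨γ * a, Ideal.mul_mem_left _ _ ha, by ring⟩,
        ⟨γ * b, Ideal.mul_mem_left _ _ hb, by ring⟩, ⟨-(α * a) - β * b, ?_, ?_⟩⟩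
      · exact sub_mem (neg_mem (Ideal.mul_mem_left _ _ ha)) (Ideal.mul_mem_left _ _ hb)
      · linear_combination hrel
  · refine ⟨b, hb, α, hα, ⟨-(β * a) - γ * b, ?_, ?_⟩,
      ⟨α * a, Ideal.mul_mem_left _ _ ha, by ring⟩, ⟨α * b, Ideal.mul_mem_left _ _ hb, by ring⟩⟩
    · exact sub_mem (neg_mem (Ideal.mul_mem_left _ _ ha)) (Ideal.mul_mem_left _ _ hb)
    · linear_combination hrel

theorem noeth_A (h2 : ∀ I : Ideal R, I.TwoGenerated) : IsNoetherianRing R := by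
  rw [isNoetherianRing_iff_ideal_fg]
  intro I
  obtain ⟨a, b, rfl⟩ := h2 I
  exact Submodule.fg_span (Set.toFinite _)

theorem mori_A (h2 : ∀ I : Ideal R, I.TwoGenerated) : MoriRing R := by
  intro f _
  have := noeth_A h2
  obtain ⟨n, hn⟩ := monotone_stabilizes_iff_noetherian.2 this f
  exact ⟨n, fun m hm => (hn m hm).symm⟩

theorem height_A (h2 : ∀ I : Ideal R, I.TwoGenerated) (m : Ideal R) [hm : m.IsMaximal] :
    m.height ≤ 1 := by
  have := noeth_A h2
  obtain ⟨c, hc, s, hs, h⟩ := loc_stable h2 m m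
  refine Ideal.height_le_one_of_isPrincipal_of_mem_minimalPrimes (Ideal.span {c}) m ?_
  refine ⟨⟨hm.isPrime, by rwa [Ideal.span_singleton_le_iff_mem]⟩, ?_⟩
  rintro Q ⟨hQ, hcQ⟩ hQm x hx
  rw [Ideal.span_singleton_le_iff_mem] at hcQ
  obtain ⟨z, hz, e⟩ := h x hx x hx
  have h3 : s * (x * x) ∈ Q := e ▸ Q.mul_mem_right _ hcQ
  rcases hQ.mem_or_mem h3 with h4 | h4
  · exact absurd (hQm h4) hs
  · exact (hQ.mem_or_mem h4).elim id id

theorem pow_mem_A (h2 : ∀ I : Ideal R, I.TwoGenerated) (m : Ideal R) [hm : m.IsMaximal]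
    {D : Ideal R} (hD : D ≠ ⊥) {t : R} (ht : t ∈ m) : ∃ s, s ∉ m ∧ ∃ n : ℕ, s * t ^ n ∈ D := by
  have := noeth_A h2
  by_contra hcon
  push Not at hcon
  have hdis : Disjoint (D : Set R) (m.primeCompl ⊔ Submonoid.powers t : Submonoid R) := by
    rw [Set.disjoint_left]
    intro x hxD hx
    obtain ⟨s, hs, _, ⟨n, rfl⟩, rfl⟩ := Submonoid.mem_sup.1 hx
    exact hcon s hs n hxD
  obtain ⟨Q, hQ, hDQ, hQd⟩ := Ideal.exists_le_prime_disjoint D _ hdis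
  rw [Set.disjoint_left] at hQd
  have hQm : Q ≤ m := by
    intro x hx
    by_contra hxm
    exact hQd hx ((le_sup_left : m.primeCompl ≤ m.primeCompl ⊔ Submonoid.powers t) hxm)
  have hQ0 : Q ≠ ⊥ := fun h => hD (le_bot_iff.1 (h ▸ hDQ))
  have := minimal_of_height (height_A h2 m) hQ0 hQm
  rw [← this] at ht
  exact hQd ht ((le_sup_right : Submonoid.powers t ≤ m.primeCompl ⊔ Submonoid.powers t)
    (Submonoid.mem_powers t))

variable {K : Type*} [Field K] [Algebra R K] [IsFractionRing R K]

/-- If each maximal ideal misses a multiplier into `E`, then the element is in `E`. -/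
theorem mem_of_local {E : Submodule R K} {y : K}
    (h : ∀ m : Ideal R, m.IsMaximal → ∃ s, s ∉ m ∧ s • y ∈ E) : y ∈ E := by
  let A : Ideal R := Submodule.comap (LinearMap.toSpanSingleton R K y) E
  by_cases hA : A = ⊤
  · have : (1 : R) ∈ A := by rw [hA]; trivial
    simpa [A] using this
  · obtain ⟨m, hm, hAm⟩ := Ideal.exists_le_maximal A hA
    obtain ⟨s, hs, hs2⟩ := h m hm
    exact absurd (hAm (show s ∈ A by simpa [A] using hs2)) hs

theorem stabK_A (h2 : ∀ I : Ideal R, I.TwoGenerated) (I : Ideal R) (hI : I ≠ ⊥)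
    {J : Submodule R K} (hJ : J = IsLocalization.coeSubmodule K I) :
    (1 : K) ∈ J * ((J / J) / J) := by
  apply mem_of_local
  intro m hm
  obtain ⟨c, hc, s, hs, h⟩ := loc_stable h2 I m
  have hs0 : s ≠ 0 := fun h => hs (h ▸ zero_mem _)
  have hc0 : c ≠ 0 := by
    rintro rfl
    obtain ⟨x, hx, hx0⟩ := Submodule.exists_mem_ne_zero_of_ne_bot hI
    obtain ⟨z, hz, e⟩ := h x hx x hx
    rw [zero_mul] at e
    simp [hs0, hx0] at e
  have hc0' : algebraMap R K c ≠ 0 := by simpa using hc0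
  refine ⟨s, hs, ?_⟩
  have e : s • (1 : K) = algebraMap R K c * (algebraMap R K s / algebraMap R K c) := by
    rw [Algebra.smul_def, mul_one]
    field_simp
  rw [e]
  refine Submodule.mul_mem_mul ?_ ?_
  · rw [hJ, IsLocalization.mem_coeSubmodule]
    exact ⟨c, hc, rfl⟩
  · refine mem_divK.2 fun x hx => mem_divK.2 fun y hy => ?_
    rw [hJ, IsLocalization.mem_coeSubmodule] at hx hy ⊢
    obtain ⟨x, hx, rfl⟩ := hx
    obtain ⟨y, hy, rfl⟩ := hy
    obtain ⟨z, hz, e⟩ := h x hx y hy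
    refine ⟨z, hz, ?_⟩
    have e' := congrArg (algebraMap R K) e
    simp only [map_mul] at e'
    field_simp
    linear_combination -e'

theorem stable_A (h2 : ∀ I : Ideal R, I.TwoGenerated) : StableRing R := by
  intro I hI
  rw [isStableIdeal_iff hI rfl]
  exact stabK_A h2 I hI (FractionalIdeal.coe_coeIdeal _)

theorem gen2K (h2 : ∀ I : Ideal R, I.TwoGenerated) {T : Submodule R K} (hT : FracK T) :
    ∃ g h, T = Submodule.span R {g, h} := by
  obtain ⟨a, ha, haT⟩ := hT
  let I : Ideal R := Submodule.comap ((LinearMap.mul R K a⁻¹) ∘ₗ (Algebra.linearMap R K)) T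
  have hI : ∀ r, r ∈ I ↔ a⁻¹ * algebraMap R K r ∈ T := fun r => by simp [I]
  obtain ⟨u, v, huv⟩ := h2 I
  refine ⟨a⁻¹ * algebraMap R K u, a⁻¹ * algebraMap R K v, le_antisymm ?_ ?_⟩
  · intro x hx
    obtain ⟨r, hr⟩ := Submodule.mem_one.1 (haT x hx)
    have hx' : x = a⁻¹ * algebraMap R K r := by rw [hr, inv_mul_cancel_left₀ ha]
    have hrI : r ∈ I := by rw [hI, ← hx']; exact hx
    rw [huv, Ideal.mem_span_pair] at hrI
    obtain ⟨p, q, e⟩ := hrI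
    rw [Submodule.mem_span_pair]
    refine ⟨p, q, ?_⟩
    rw [hx', ← e, map_add, map_mul, map_mul, Algebra.smul_def, Algebra.smul_def]
    ring
  · rw [Submodule.span_le]
    rintro _ (rfl | rfl)
    · exact (hI u).1 (huv ▸ Ideal.subset_span (by simp))
    · exact (hI v).1 (huv ▸ Ideal.subset_span (by simp))

theorem ring_gen_A (h2 : ∀ I : Ideal R, I.TwoGenerated) {T : Submodule R K} (hT : FracK T)
    (h1T : (1 : K) ∈ T) (hTT : T * T ≤ T) (m : Ideal R) [hm : m.IsMaximal] :
    ∃ z ∈ T, ∃ s, s ∉ m ∧ ∀ y ∈ T, s • y ∈ Submodule.span R {1, z} := by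
  have := noeth_A h2
  have h1P : (1 : K) ∉ m • T := by
    intro h
    refine nak_not_le (fg_of_frac hT) ?_ hm.ne_top (fun t ht => ?_)
    · intro h0
      rw [h0, Submodule.mem_bot] at h1T
      exact one_ne_zero h1T
    · have := smul_mul_le hTT ht h
      rwa [mul_one] at this
  have key : ∀ g h : K, T = Submodule.span R {g, h} → ∀ α β : R, α • g + β • h = 1 → α ∉ m →
      ∃ z ∈ T, ∃ s, s ∉ m ∧ ∀ y ∈ T, s • y ∈ Submodule.span R {1, z} := by
    intro g h e α β hαβ hα
    refine ⟨h, e ▸ Submodule.subset_span (by simp), α, hα, fun y hy => ?_⟩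
    rw [e] at hy
    obtain ⟨p, q, rfl⟩ := Submodule.mem_span_pair.1 hy
    rw [Submodule.mem_span_pair]
    refine ⟨p, α * q - p * β, ?_⟩
    rw [← hαβ]
    simp only [smul_add, sub_smul, mul_smul, smul_comm p α g]
    abel
  obtain ⟨g, h, e⟩ := gen2K h2 hT
  have h1 := h1T
  rw [e] at h1
  obtain ⟨α, β, hαβ⟩ := Submodule.mem_span_pair.1 h1
  by_cases hα : α ∈ m
  · by_cases hβ : β ∈ m
    · exfalso
      apply h1P
      rw [← hαβ]
      exact add_mem (Submodule.smul_mem_smul hα (e ▸ Submodule.subset_span (by simp)))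
        (Submodule.smul_mem_smul hβ (e ▸ Submodule.subset_span (by simp)))
    · exact key h g (by rw [e, Set.pair_comm]) β α (by rw [add_comm]; exact hαβ) hβ
  · exact key g h e α β hαβ hα

theorem ring_div_A (h2 : ∀ I : Ideal R, I.TwoGenerated) {E : Submodule R K} (hE : FracK E)
    (h1E : (1 : K) ∈ E) (hEE : E * E ≤ E) : 1 / (1 / E) ≤ E := by
  set D := 1 / E with hD
  set T := 1 / D with hT
  have hD1 : D ≤ 1 := fun x hx => by
    have := mem_divK.1 hx 1 h1E
    rwa [mul_one] at this
  have hDE : ∀ x ∈ D, ∀ e ∈ E, x * e ∈ D := fun x hx e he => mem_divK.2 fun y hy => by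
    rw [mul_assoc]
    exact mem_divK.1 hx _ (hEE (Submodule.mul_mem_mul he hy))
  have hD0 : D ≠ ⊥ := by
    obtain ⟨a, ha, h⟩ := hE
    intro h0
    have : a ∈ D := mem_divK.2 h
    rw [h0, Submodule.mem_bot] at this
    exact ha this
  have hTD : ∀ t ∈ T, ∀ x ∈ D, t * x ∈ D := fun t ht x hx => mem_divK.2 fun e he => by
    rw [mul_assoc]
    exact mem_divK.1 ht _ (hDE x hx e he)
  have hET : E ≤ T := fun e he => mem_divK.2 fun x hx => by
    rw [mul_comm]
    exact mem_divK.1 hx e he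
  have hTT : T * T ≤ T := Submodule.mul_le.2 fun a ha b hb => mem_divK.2 fun x hx => by
    rw [mul_assoc]
    exact mem_divK.1 ha _ (hTD b hb x hx)
  have hTf : FracK T := frac_div (frac_of_le_one le_rfl) hD0
  have h1le : (1 : Submodule R K) ≤ E := Submodule.one_le.2 h1E
  intro y hy
  apply mem_of_local
  intro m hm
  obtain ⟨z, hz, s', hs', hzs⟩ := ring_gen_A h2 hE h1E hEE m
  obtain ⟨z', hz', α, hα, hzα⟩ := ring_gen_A h2 hTf (hET h1E) hTT m
  obtain ⟨r, t, e⟩ := Submodule.mem_span_pair.1 (hzα z (hET hz))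
  by_cases ht : t ∈ m
  · let D0 : Ideal R := Submodule.comap (Algebra.linearMap R K) D
    have hD00 : D0 ≠ ⊥ := by
      obtain ⟨x, hx, hx0⟩ := Submodule.exists_mem_ne_zero_of_ne_bot hD0
      obtain ⟨ξ, rfl⟩ := Submodule.mem_one.1 (hD1 hx)
      intro h
      have : ξ ∈ D0 := hx
      rw [h, Ideal.mem_bot] at this
      exact hx0 (by rw [this, map_zero])
    obtain ⟨s2, hs2, n, hn⟩ := pow_mem_A h2 m hD00 ht
    have claim : ∀ u : R, t * u ∈ D0 → (α * s') * u ∈ D0 := by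
      intro u hu
      refine mem_divK.2 fun x hx => ?_
      obtain ⟨p, q, e2⟩ := Submodule.mem_span_pair.1 (hzs x hx)
      have h3 : algebraMap R K (t * u) * z' ∈ (1 : Submodule R K) := by
        rw [mul_comm]
        exact mem_divK.1 hz' _ hu
      have h4 : Algebra.linearMap R K ((α * s') * u) * x = algebraMap R K (u * α * p + u * q * r) +
          q • (algebraMap R K (t * u) * z') := by
        simp only [Algebra.smul_def] at e e2 ⊢
        simp only [Algebra.linearMap_apply, map_mul, map_add]
        linear_combination (-(algebraMap R K α) * algebraMap R K u) * e2 -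
          algebraMap R K u * algebraMap R K q * e
      rw [h4]
      exact add_mem (Submodule.mem_one.2 ⟨_, rfl⟩) (Submodule.smul_mem _ _ h3)
    have claim2 : ∀ (k : ℕ) (v : R), t ^ k * v ∈ D0 → (α * s') ^ k * v ∈ D0 := by
      intro k
      induction k with
      | zero => intro v hv; simpa using hv
      | succ k ih =>
        intro v hv
        have h5 := claim (t ^ k * v) (by convert hv using 1; ring)
        have h6 := ih (α * s' * v) (by convert h5 using 1; ring)
        convert h6 using 1
        ring
    have h7 := claim2 n s2 (by rw [mul_comm]; exact hn)
    refine ⟨(α * s') ^ n * s2, ?_, ?_⟩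
    · intro h
      rcases hm.isPrime.mem_or_mem h with h | h
      · rcases hm.isPrime.mem_or_mem (hm.isPrime.mem_of_pow_mem _ h) with h | h
        · exact hα h
        · exact hs' h
      · exact hs2 h
    · apply h1le
      rw [Algebra.smul_def, mul_comm]
      exact mem_divK.1 hy _ h7
  · refine ⟨t * α, fun h => (hm.isPrime.mem_or_mem h).elim ht hα, ?_⟩
    obtain ⟨p, q, e2⟩ := Submodule.mem_span_pair.1 (hzα y hy)
    rw [mul_smul, ← e2, smul_add, smul_comm t q]
    have h1 : t • z' ∈ E := by
      have : t • z' = α • z - r • 1 := by rw [← e]; simp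
      rw [this]
      exact sub_mem (E.smul_mem _ hz) (E.smul_mem _ h1E)
    exact add_mem (E.smul_mem _ (E.smul_mem _ h1E)) (E.smul_mem _ h1)

theorem divisorial_A (h2 : ∀ I : Ideal R, I.TwoGenerated) : DivisorialRing R := by
  intro I hI
  rw [isDivisorial_iff hI rfl]
  set J : Submodule R (FractionRing R) :=
    ((I : FractionalIdeal R⁰ (FractionRing R)) : Submodule R (FractionRing R)) with hJ
  have hst : (1 : FractionRing R) ∈ J * (J / J / J) :=
    stabK_A h2 I hI (FractionalIdeal.coe_coeIdeal _)
  have hJ1 : J ≤ 1 := by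
    rw [hJ, ← FractionalIdeal.coe_one (S := R⁰), FractionalIdeal.coe_le_coe]
    exact FractionalIdeal.coeIdeal_le_one
  have hJ0 : J ≠ ⊥ := by
    intro h
    rw [h] at hst
    simp at hst
  have hEv := ring_div_A h2 (frac_div (frac_of_le_one hJ1) hJ0) (one_mem_div_self J)
    (div_self_mul_le J)
  intro z hz
  have key : ∀ u ∈ J * (J / J / J), z * u ∈ J := by
    intro u hu
    refine Submodule.mul_induction_on hu ?_ ?_
    · intro j hj q hq
      have : z * q ∈ J / J := by
        apply hEv
        refine mem_divK.2 fun w hw => ?_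
        rw [mul_assoc]
        refine mem_divK.1 hz _ (mem_divK.2 fun x hx => ?_)
        rw [mul_comm q w, mul_assoc]
        exact mem_divK.1 hw _ (mem_divK.1 hq x hx)
      rw [mul_left_comm, mul_comm]
      exact mem_divK.1 this j hj
    · intro u v hu hv
      rw [mul_add]
      exact add_mem hu hv
  simpa using key 1 hst
end AA

section C1
variable {R : Type*} [CommRing R] [IsDomain R] {K : Type*} [Field K] [Algebra R K]
  [IsFractionRing R K]

theorem mulLK {A B C : Submodule R K} (h : A ≤ B) : C * A ≤ C * B :=
  Submodule.mul_le.2 fun a ha b hb => Submodule.mul_mem_mul ha (h hb)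

theorem mulRK {A B C : Submodule R K} (h : A ≤ B) : A * C ≤ B * C :=
  Submodule.mul_le.2 fun a ha b hb => Submodule.mul_mem_mul (h ha) hb

variable (R K) in
/-- The integral closure as a submodule. -/
def RbK : Submodule R K := Subalgebra.toSubmodule (integralClosure R K)

theorem mem_RbK {x : K} : x ∈ RbK R K ↔ IsIntegral R x := Iff.rfl

theorem one_mem_RbK : (1 : K) ∈ RbK R K := (integralClosure R K).one_mem

theorem RbK_mul_le : RbK R K * RbK R K ≤ RbK R K :=
  Submodule.mul_le.2 fun a ha b hb => (integralClosure R K).mul_mem ha hb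

/-- `M` is a maximal ideal of the ring `S`. -/
def MaxK (S M : Submodule R K) : Prop :=
  S * M ≤ M ∧ M ≤ S ∧ (1 : K) ∉ M ∧ ∀ a ∈ S, a ∉ M → ∃ b ∈ S, 1 - a * b ∈ M

theorem exists_maxK {S I : Submodule R K} (h1 : (1 : K) ∈ S) (hSS : S * S ≤ S) (hSI : S * I ≤ I)
    (hIS : I ≤ S) (hI1 : (1 : K) ∉ I) : ∃ M, MaxK S M ∧ I ≤ M := by
  obtain ⟨M, hIM, hM⟩ := zorn_le_nonempty₀
    {M : Submodule R K | S * M ≤ M ∧ M ≤ S ∧ (1 : K) ∉ M} (by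
      intro c hc hchain y hy
      have hdir : DirectedOn (· ≤ ·) c := hchain.directedOn
      have hne : c.Nonempty := ⟨y, hy⟩
      refine ⟨sSup c, ⟨?_, ?_, ?_⟩, fun z hz => le_sSup hz⟩
      · refine Submodule.mul_le.2 fun a ha b hb => ?_
        obtain ⟨N, hN, hbN⟩ := (Submodule.mem_sSup_of_directed hne hdir).1 hb
        exact (Submodule.mem_sSup_of_directed hne hdir).2
          ⟨N, hN, (hc hN).1 (Submodule.mul_mem_mul ha hbN)⟩
      · exact sSup_le fun N hN => (hc hN).2.1
      · intro h
        obtain ⟨N, hN, hbN⟩ := (Submodule.mem_sSup_of_directed hne hdir).1 h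
        exact (hc hN).2.2 hbN) I ⟨hSI, hIS, hI1⟩
  obtain ⟨⟨hM1, hM2, hM3⟩, hmax⟩ := hM
  refine ⟨M, ⟨hM1, hM2, hM3, fun a ha haM => ?_⟩, hIM⟩
  by_contra hcon
  push Not at hcon
  apply haM
  have h1M : (1 : K) ∉ M ⊔ Submodule.span R {a} * S := by
    intro h
    obtain ⟨u, hu, v, hv, huv⟩ := Submodule.mem_sup.1 h
    obtain ⟨b, hb, rfl⟩ := mem_scale.1 hv
    apply hcon b hb
    have : 1 - a * b = u := by rw [← huv]; ring
    rwa [this]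
  refine hmax (y := M ⊔ Submodule.span R {a} * S) ⟨?_, ?_, h1M⟩ le_sup_left
    (Submodule.mem_sup_right (mem_scale.2 ⟨1, h1, mul_one a⟩))
  · rw [Submodule.mul_sup]
    refine sup_le_sup hM1 ?_
    calc S * (Submodule.span R {a} * S) = Submodule.span R {a} * (S * S) := by
          rw [← mul_assoc, mul_comm S, mul_assoc]
      _ ≤ _ := mulLK hSS
  · refine sup_le hM2 ?_
    intro x hx
    obtain ⟨b, hb, rfl⟩ := mem_scale.1 hx
    exact hSS (Submodule.mul_mem_mul ha hb)

theorem MaxK.le_of {S M N : Submodule R K} (h : MaxK S M) (hSN : S * N ≤ N)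
    (hMN : M ≤ N) (hNS : N ≤ S) (h1 : (1 : K) ∉ N) : N ≤ M := by
  intro n hn
  by_contra hnM
  obtain ⟨b, hb, hab⟩ := h.2.2.2 n (hNS hn) hnM
  apply h1
  have := N.add_mem (hMN hab) (hSN (Submodule.mul_mem_mul hb hn))
  convert this using 1
  ring

theorem integral_quad {z s t : K} (hs : IsIntegral R s) (ht : IsIntegral R t)
    (h : z * z = s + t * z) : IsIntegral R z := by
  have : IsIntegral (integralClosure R K) z := by
    refine ⟨Polynomial.X ^ 2 - (Polynomial.C (⟨t, ht⟩ : integralClosure R K) * Polynomial.X +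
      Polynomial.C (⟨s, hs⟩ : integralClosure R K)), ?_, ?_⟩
    · apply Polynomial.monic_X_pow_sub
      exact lt_of_le_of_lt Polynomial.degree_linear_le (by norm_num)
    · simp only [Polynomial.eval₂_sub, Polynomial.eval₂_pow, Polynomial.eval₂_X,
        Polynomial.eval₂_add, Polynomial.eval₂_mul, Polynomial.eval₂_C]
      change z ^ 2 - (t * z + s) = 0
      linear_combination h
  exact isIntegral_trans z this

theorem key_int (hStab : StabK R K) {S M : Submodule R K} (h1 : (1 : K) ∈ S) (hSS : S * S ≤ S)
    (hSR : S ≤ RbK R K) (hfr : FracK S) (hM : MaxK S M) (hM0 : M ≠ ⊥) {z : K} (hz : z ∈ M / M) :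
    z ∈ RbK R K := by
  obtain ⟨hSM, hMS, h1M, hinv⟩ := hM
  have hzM : ∀ y ∈ M, z * y ∈ M := mem_divK.1 hz
  have mulS : ∀ a ∈ S, ∀ b ∈ S, a * b ∈ S := fun a ha b hb => hSS (Submodule.mul_mem_mul ha hb)
  set F := S ⊔ Submodule.span R {z} * S with hF
  have memF : ∀ x, x ∈ F ↔ ∃ s ∈ S, ∃ t ∈ S, x = s + z * t := by
    intro x
    constructor
    · intro h
      obtain ⟨s, hs, v, hv, rfl⟩ := Submodule.mem_sup.1 h
      obtain ⟨t, ht, rfl⟩ := mem_scale.1 hv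
      exact ⟨s, hs, t, ht, rfl⟩
    · rintro ⟨s, hs, t, ht, rfl⟩
      exact Submodule.add_mem_sup hs (mem_scale.2 ⟨t, ht, rfl⟩)
  have h1F : (1 : K) ∈ F := Submodule.mem_sup_left h1
  have hzF : z ∈ F := (memF z).2 ⟨0, zero_mem _, 1, h1, by ring⟩
  have hSE : S ≤ F / F := by
    intro a ha
    refine mem_divK.2 fun y hy => ?_
    obtain ⟨s, hs, t, ht, rfl⟩ := (memF y).1 hy
    exact (memF _).2 ⟨a * s, mulS _ ha _ hs, a * t, mulS _ ha _ ht, by ring⟩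
  have hFfr : FracK F := by
    obtain ⟨y, hy, hy0⟩ := Submodule.exists_mem_ne_zero_of_ne_bot hM0
    obtain ⟨a, ha, hfr⟩ := hfr
    refine ⟨a * y, mul_ne_zero ha hy0, fun x hx => ?_⟩
    obtain ⟨s, hs, t, ht, rfl⟩ := (memF x).1 hx
    rw [mul_assoc]
    apply hfr
    have e : y * (s + z * t) = y * s + z * y * t := by ring
    rw [e]
    exact add_mem (mulS _ (hMS hy) _ hs) (mulS _ (hMS (hzM y hy)) _ ht)
  have hF0 : F ≠ ⊥ := by
    intro h
    rw [h, Submodule.mem_bot] at h1F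
    exact one_ne_zero h1F
  have hst := hStab F hF0 hFfr
  by_cases hE : F / F ≤ S
  · -- then z is in S
    apply hSR
    set Q := F / F / F with hQ
    have hSQ : ∀ a ∈ S, ∀ q ∈ Q, a * q ∈ Q := by
      intro a ha q hq
      refine mem_divK.2 fun y hy => ?_
      rw [mul_assoc]
      exact div_self_mul_le F (Submodule.mul_mem_mul (hSE ha) (mem_divK.1 hq y hy))
    have hle : F * Q ≤ Q ⊔ Submodule.span R {z} * Q := by
      refine Submodule.mul_le.2 fun f hf q hq => ?_
      obtain ⟨s, hs, t, ht, rfl⟩ := (memF f).1 hf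
      have e : (s + z * t) * q = s * q + z * (t * q) := by ring
      rw [e]
      exact Submodule.add_mem_sup (hSQ _ hs _ hq) (mem_scale.2 ⟨_, hSQ _ ht _ hq, rfl⟩)
    obtain ⟨a, ha, v, hv, hav⟩ := Submodule.mem_sup.1 (hle hst)
    obtain ⟨b, hb, rfl⟩ := mem_scale.1 hv
    have fin : ∀ a ∈ Q, a ∉ M → z ∈ S := by
      intro a ha haM
      have ha1 : a ∈ S := by simpa using hE (mem_divK.1 ha 1 h1F)
      have haz : a * z ∈ S := hE (mem_divK.1 ha z hzF)
      obtain ⟨a', ha', h⟩ := hinv a ha1 haM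
      have e : z = a' * (a * z) + z * (1 - a * a') := by ring
      rw [e]
      exact add_mem (mulS _ ha' _ haz) (hMS (hzM _ h))
    by_cases haM : a ∈ M
    · apply fin b hb
      intro hbM
      apply h1M
      rw [← hav]
      exact add_mem haM (hzM _ hbM)
    · exact fin a ha haM
  · obtain ⟨e, he, heS⟩ := Set.not_subset.1 hE
    have heF : e ∈ F := by simpa using mem_divK.1 he 1 h1F
    obtain ⟨s, hs, t, ht, hst⟩ := (memF e).1 heF
    have htM : t ∉ M := by
      intro h
      apply heS
      rw [hst]
      exact add_mem hs (hMS (hzM t h))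
    obtain ⟨t', ht', h⟩ := hinv t ht htM
    have hzE : z ∈ F / F := by
      have e' : z = t' * e - t' * s + z * (1 - t * t') := by rw [hst]; ring
      rw [e']
      exact add_mem (sub_mem (div_self_mul_le F (Submodule.mul_mem_mul (hSE ht') he))
        (hSE (mulS _ ht' _ hs))) (hSE (hMS (hzM _ h)))
    obtain ⟨s, hs, t, ht, hst⟩ := (memF _).1 (mem_divK.1 hzE z hzF)
    exact integral_quad (R := R) (hSR hs) (hSR ht) (by rw [hst]; ring)

theorem div_divisorial {S Y : Submodule R K} (hS : 1 / (1 / S) ≤ S) :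
    1 / (1 / (S / Y)) ≤ S / Y := by
  intro x hx
  refine mem_divK.2 fun y hy => hS (mem_divK.2 fun g hg => ?_)
  have : y * g ∈ 1 / (S / Y) := mem_divK.2 fun u hu => by
    have := mem_divK.1 hg _ (mem_divK.1 hu y hy)
    convert this using 1
    ring
  have := mem_divK.1 hx _ this
  convert this using 1
  ring

theorem inv_eq_div {S X Y : Submodule R K} (hSX : S * X ≤ X) (h1 : (1 : K) ∈ S)
    (hXY : X * Y = S) : X = S / Y := by
  apply le_antisymm
  · intro x hx
    refine mem_divK.2 fun y hy => ?_
    rw [← hXY]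
    exact Submodule.mul_mem_mul hx hy
  · intro x hx
    have : Submodule.span R {x} * S ≤ X := by
      rw [← hXY, mul_comm X, ← mul_assoc]
      refine le_trans (mulRK ?_) hSX
      intro v hv
      obtain ⟨y, hy, rfl⟩ := mem_scale.1 hv
      exact mem_divK.1 hx y hy
    exact this (mem_scale.2 ⟨1, h1, mul_one x⟩)

theorem ring_mul_self {S : Submodule R K} (h1 : (1 : K) ∈ S) (hSS : S * S ≤ S) : S * S = S := by
  refine le_antisymm hSS fun x hx => ?_
  rw [← mul_one x]
  exact Submodule.mul_mem_mul hx h1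

theorem ring_mul_mod {S M : Submodule R K} (h1 : (1 : K) ∈ S) (hSM : S * M ≤ M) : S * M = M := by
  refine le_antisymm hSM fun x hx => ?_
  rw [← one_mul x]
  exact Submodule.mul_mem_mul h1 hx

theorem eq_ring_of_one {S X : Submodule R K} (hSX : S * X ≤ X) (hX : X ≤ S)
    (h1X : (1 : K) ∈ X) : X = S := by
  refine le_antisymm hX fun x hx => hSX ?_
  rw [← mul_one x]
  exact Submodule.mul_mem_mul hx h1X

theorem step3 (hStab : StabK R K) {S M : Submodule R K} (h1 : (1 : K) ∈ S) (hSS : S * S ≤ S)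
    (hSR : S ≤ RbK R K) (hfr : FracK S) (hSd : 1 / (1 / S) ≤ S)
    (hmax : ∀ E : Submodule R K, (1 : K) ∈ E → E * E ≤ E → E ≤ RbK R K → 1 / (1 / E) ≤ E →
      S ≤ E → E = S)
    (hM : MaxK S M) (hM0 : M ≠ ⊥) : (1 : K) ∈ M * (S / M) := by
  by_contra hcon
  obtain ⟨hSM, hMS, h1M, hinv⟩ := id hM
  have h1d : (1 : K) ∈ S / M := mem_divK.2 fun y hy => by rw [one_mul]; exact hMS hy
  have hle : M * (S / M) ≤ M := by
    apply hM.le_of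
    · rw [← mul_assoc]
      exact mulRK hSM
    · intro x hx
      rw [← mul_one x]
      exact Submodule.mul_mem_mul hx h1d
    · exact mul_div_le S M
    · exact hcon
  have hEq : S / M = M / M := by
    apply le_antisymm
    · intro x hx
      refine mem_divK.2 fun y hy => hle ?_
      rw [mul_comm x y]
      exact Submodule.mul_mem_mul hy hx
    · exact div_monoK hMS
  have hES : M / M = S := by
    apply hmax
    · exact one_mem_div_self M
    · exact div_self_mul_le M
    · intro z hz
      exact key_int hStab h1 hSS hSR hfr hM hM0 hz
    · rw [← hEq]
      exact div_divisorial hSd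
    · intro s hs
      exact mem_divK.2 fun y hy => hSM (Submodule.mul_mem_mul hs hy)
  have := hStab M hM0 (frac_mono hMS hfr)
  rw [hES] at this
  exact hcon this

theorem step4 (hMori : MoriK R K) {S : Submodule R K} (h1 : (1 : K) ∈ S) (hSS : S * S ≤ S)
    (hfr : FracK S) (hSd : 1 / (1 / S) ≤ S)
    (hM : ∀ M, MaxK S M → M ≠ ⊥ → (1 : K) ∈ M * (S / M))
    {I : Submodule R K} (hSI : S * I ≤ I) (hIS : I ≤ S) (hI0 : I ≠ ⊥) :
    (1 : K) ∈ I * (S / I) := by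
  obtain ⟨a, ha, hfr⟩ := hfr
  obtain ⟨i, hi, hi0⟩ := Submodule.exists_mem_ne_zero_of_ne_bot hI0
  obtain ⟨X, ⟨hSX, hX1, hXI, Y, hXY⟩, hmax⟩ := hMori (a * i) (mul_ne_zero ha hi0)
    {X | S * X ≤ X ∧ S ≤ X ∧ X * I ≤ S ∧ ∃ Y, X * Y = S}
    ⟨S, hSS, le_rfl, hSI.trans hIS, S, ring_mul_self h1 hSS⟩ (by
      rintro X ⟨hSX, hX1, hXI, Y, hXY⟩
      refine ⟨?_, ?_, ?_⟩
      · rintro rfl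
        have := hX1 h1
        rw [Submodule.mem_bot] at this
        exact one_ne_zero this
      · rw [inv_eq_div hSX h1 hXY]
        exact div_divisorial hSd
      · intro x hx
        rw [mul_assoc]
        apply hfr
        apply hXI
        rw [mul_comm i x]
        exact Submodule.mul_mem_mul hx hi)
  have hSXI : S * (X * I) ≤ X * I := by
    rw [← mul_assoc]
    exact mulRK hSX
  by_cases h : (1 : K) ∈ X * I
  · have : X ≤ S / I := fun x hx => mem_divK.2 fun y hy => hXI (Submodule.mul_mem_mul hx hy)
    rw [mul_comm] at h
    exact mulLK this h
  · exfalso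
    obtain ⟨M, hMm, hXIM⟩ := exists_maxK h1 hSS hSXI hXI h
    obtain ⟨hSM, hMS, h1M, hinv⟩ := id hMm
    have hIM : I ≤ M := fun x hx => hXIM (by
      rw [← one_mul x]; exact Submodule.mul_mem_mul (hX1 h1) hx)
    have hM0 : M ≠ ⊥ := by
      rintro rfl
      exact hI0 (le_bot_iff.1 hIM)
    have hMM : M * (S / M) = S := by
      apply eq_ring_of_one
      · rw [← mul_assoc]
        exact mulRK hSM
      · exact mul_div_le S M
      · exact hM M hMm hM0
    have h1d : (1 : K) ∈ S / M := mem_divK.2 fun y hy => by rw [one_mul]; exact hMS hy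
    have hXX : X ≤ (S / M) * X := fun x hx => by
      rw [← one_mul x]; exact Submodule.mul_mem_mul h1d hx
    have hX' := hmax ((S / M) * X) ⟨?_, hX1.trans hXX, ?_, M * Y, ?_⟩ hXX
    · apply h1M
      have e1 : X = M * X := by
        calc X = S * X := (ring_mul_mod h1 hSX).symm
          _ = M * (S / M * X) := by rw [← mul_assoc, hMM]
          _ = M * X := by rw [hX']
      have e2 : S = M * S := by
        calc S = X * Y := hXY.symm
          _ = M * X * Y := by rw [← e1]
          _ = M * S := by rw [mul_assoc, hXY]
      rw [mul_comm, ring_mul_mod h1 hSM] at e2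
      rwa [← e2]
    · calc S * (S / M * X) = S / M * (S * X) := by rw [← mul_assoc, mul_comm S, mul_assoc]
        _ ≤ _ := mulLK hSX
    · calc (S / M) * X * I = (S / M) * (X * I) := by rw [mul_assoc]
        _ ≤ (S / M) * M := mulLK hXIM
        _ = S := by rw [mul_comm, hMM]
    · calc (S / M) * X * (M * Y) = (M * (S / M)) * (X * Y) := by ac_rfl
        _ = S := by rw [hMM, hXY, ring_mul_self h1 hSS]

theorem steps14 (hStab : StabK R K) (hMori : MoriK R K) (hfr : FracK (RbK R K)) :
    1 / (1 / RbK R K) ≤ RbK R K ∧ ∀ I : Submodule R K, RbK R K * I ≤ I → I ≤ RbK R K → I ≠ ⊥ →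
      (1 : K) ∈ I * (RbK R K / I) := by
  obtain ⟨x, hx0, hx⟩ := id hfr
  have h1ne : ∀ E : Submodule R K, (1 : K) ∈ E → E ≠ ⊥ := by
    rintro E h rfl
    rw [Submodule.mem_bot] at h
    exact one_ne_zero h
  obtain ⟨S, ⟨h1, hSS, hSR, hSd⟩, hmax⟩ := hMori x hx0
    {S | (1 : K) ∈ S ∧ S * S ≤ S ∧ S ≤ RbK R K ∧ 1 / (1 / S) ≤ S}
    ⟨1, one_memK, by rw [mul_one], Submodule.one_le.2 one_mem_RbK, by
      intro y hy
      have : (1 : K) ∈ (1 : Submodule R K) / 1 := one_mem_div_self 1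
      simpa using mem_divK.1 hy 1 this⟩ (by
    rintro S ⟨h1, hSS, hSR, hSd⟩
    exact ⟨h1ne S h1, hSd, fun y hy => hx y (hSR hy)⟩)
  have hfS : FracK S := frac_mono hSR hfr
  have hM : ∀ M, MaxK S M → M ≠ ⊥ → (1 : K) ∈ M * (S / M) := fun M hM hM0 =>
    step3 hStab h1 hSS hSR hfS hSd (fun E a b c d e => hmax E ⟨a, b, c, d⟩ e) hM hM0
  have h4 := fun (I : Submodule R K) => step4 (I := I) hMori h1 hSS hfS hSd hM
  have hRS : RbK R K ≤ S := by
    have hI := h4 (Submodule.span R {x} * RbK R K) (by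
      calc S * (Submodule.span R {x} * RbK R K) = Submodule.span R {x} * (S * RbK R K) := by
            rw [← mul_assoc, mul_comm S, mul_assoc]
        _ ≤ _ := mulLK
          ((mulRK hSR).trans RbK_mul_le)) (by
      intro v hv
      obtain ⟨y, hy, rfl⟩ := mem_scale.1 hv
      exact (Submodule.one_le.2 h1) (hx y hy)) (by
      intro h
      have : x * 1 ∈ Submodule.span R {x} * RbK R K := mem_scale.2 ⟨1, one_mem_RbK, rfl⟩
      rw [h, Submodule.mem_bot, mul_one] at this
      exact hx0 this)
    set I := Submodule.span R {x} * RbK R K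
    have hRI : RbK R K * I ≤ I := by
      calc RbK R K * (Submodule.span R {x} * RbK R K)
          = Submodule.span R {x} * (RbK R K * RbK R K) := by
            rw [← mul_assoc, mul_comm (RbK R K), mul_assoc]
        _ ≤ _ := mulLK RbK_mul_le
    intro r hr
    have h2 : r * 1 ∈ RbK R K * (I * (S / I)) := Submodule.mul_mem_mul hr hI
    rw [mul_one, ← mul_assoc] at h2
    exact mul_div_le S I (mulRK hRI h2)
  have : S = RbK R K := le_antisymm hSR hRS
  subst this
  exact ⟨hSd, h4⟩
end C1

section C2
section abs
variable {R : Type*} [CommRing R] {m : Ideal R} {B : Type*} [CommRing B]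

/-- Linear independence of `1, x, y` modulo `m`. -/
def LI3 (m : Ideal R) (φ : R →+* B) (x y : B) : Prop :=
  ∀ a b c : R, φ a + φ b * x + φ c * y = 0 → a ∈ m ∧ b ∈ m ∧ c ∈ m

theorem absA (hmax : m.IsMaximal) (φ : R →+* B) (hm : ∀ r ∈ m, φ r = 0)
    (h : ∀ x y : B, ∃ a b c : R, x * y = φ a + φ b * x + φ c * y)
    {x y : B} (hli : LI3 m φ x y) :
    ∃ X Y : B, LI3 m φ X Y ∧ X * Y = 0 ∧ ((X * X = 0 ∧ Y * Y = 0) ∨ (X * X = X ∧ Y * Y = Y)) := by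
  obtain ⟨p, q, r, hpqr⟩ := h x y
  obtain ⟨X, hX⟩ : ∃ X, X = x - φ r := ⟨_, rfl⟩
  obtain ⟨Y, hY⟩ : ∃ Y, Y = y - φ q := ⟨_, rfl⟩
  have hXY : X * Y = φ (p + r * q) := by
    rw [hX, hY, map_add, map_mul]; linear_combination hpqr
  have hLI : LI3 m φ X Y := by
    intro a b c habc
    obtain ⟨h1, h2, h3⟩ := hli (a - b * r - c * q) b c (by
      rw [hX, hY] at habc
      simp only [map_sub, map_mul]
      linear_combination habc)
    refine ⟨?_, h2, h3⟩
    have : a = (a - b * r - c * q) + r * b + q * c := by ring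
    rw [this]
    exact add_mem (add_mem h1 (Ideal.mul_mem_left _ _ h2)) (Ideal.mul_mem_left _ _ h3)
  set P := p + r * q
  obtain ⟨a, b, b', hb⟩ := h X X
  obtain ⟨c, d, d', hd⟩ := h Y Y
  obtain ⟨u, v, v', hv⟩ := h (X + Y) (X + Y)
  obtain ⟨-, hPm, ham⟩ := hLI (-((b + b') * P)) P (-a) (by
    simp only [map_neg, map_mul, map_add]
    linear_combination (φ b + φ b' - X) * hXY + Y * hb)
  obtain ⟨-, hcm, -⟩ := hLI (-((d + d') * P)) (-c) P (by
    simp only [map_neg, map_mul, map_add]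
    linear_combination (φ d + φ d' - Y) * hXY + X * hd)
  have hP0 := hm _ hPm
  have ha0 : φ a = 0 := by simpa using hm _ ham
  have hc0 : φ c = 0 := by simpa using hm _ hcm
  rw [hP0] at hXY
  rw [ha0] at hb
  rw [hc0] at hd
  obtain ⟨-, h1, h2⟩ := hLI (-u) (b + b' - (v + v')) (d + d' - (v + v')) (by
    simp only [map_neg, map_sub, map_add]
    linear_combination hv - hb - hd - 2 * hXY)
  have h1 := hm _ h1
  have h2 := hm _ h2
  set g := v + v' with hg
  have hXX : X * X = φ g * X := by
    rw [map_sub, map_add] at h1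
    linear_combination hb + X * h1
  have hYY : Y * Y = φ g * Y := by
    rw [map_sub, map_add] at h2
    linear_combination hd + Y * h2
  by_cases hgm : g ∈ m
  · refine ⟨X, Y, hLI, hXY, Or.inl ⟨?_, ?_⟩⟩
    · rw [hXX, hm _ hgm, zero_mul]
    · rw [hYY, hm _ hgm, zero_mul]
  · obtain ⟨e, he⟩ := hmax.exists_inv hgm
    obtain ⟨i, hi, hei⟩ := he
    have hei' : φ e * φ g = 1 := by
      have := congrArg φ hei
      rw [map_add, map_mul, hm _ hi, map_one, add_zero] at this
      exact this
    refine ⟨φ e * X, φ e * Y, ?_, ?_, Or.inr ⟨?_, ?_⟩⟩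
    · intro a b c habc
      obtain ⟨h1, h2, h3⟩ := hLI a (b * e) (c * e) (by
        simp only [map_mul]
        linear_combination habc)
      have key : ∀ b, b * e ∈ m → b ∈ m := by
        intro b hb
        have : b = g * (b * e) + b * i := by linear_combination -b * hei
        rw [this]
        exact add_mem (Ideal.mul_mem_left _ _ hb) (Ideal.mul_mem_left _ _ hi)
      exact ⟨h1, key _ h2, key _ h3⟩
    · linear_combination φ e * φ e * hXY
    · linear_combination φ e * φ e * hXX + φ e * X * hei'
    · linear_combination φ e * φ e * hYY + φ e * Y * hei'

theorem absB (hmax : m.IsMaximal) (φ : R →+* B) (hm : ∀ r ∈ m, φ r = 0)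
    (h : ∀ x y : B, ∃ a b c : R, x * y = φ a + φ b * x + φ c * y)
    {X : B} (hli : ∀ a b : R, φ a + φ b * X = 0 → a ∈ m ∧ b ∈ m) (hXX : X * X = 0) (z : B) :
    ∃ g, z * X = φ g * X := by
  obtain ⟨a, b, c, habc⟩ := h z X
  by_cases hb : b ∈ m
  · have hb0 := hm _ hb
    have : a ∈ m := (hli 0 a (by
      rw [map_zero]
      linear_combination z * hXX - X * habc - φ c * hXX - X * z * hb0)).2
    refine ⟨c, ?_⟩
    linear_combination habc + hm _ this + z * hb0
  · obtain ⟨e, i, hi, hei⟩ := hmax.exists_inv hb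
    have hei' : φ e * φ b = 1 := by
      have := congrArg φ hei
      rw [map_add, map_mul, hm _ hi, map_one, add_zero] at this
      exact this
    refine ⟨-(e * a), ?_⟩
    rw [map_neg, map_mul]
    linear_combination -(z * X * hei') + φ e * (z - φ c) * hXX - φ e * X * habc

theorem absC (hmax : m.IsMaximal) (φ : R →+* B) (hm : ∀ r ∈ m, φ r = 0)
    (h : ∀ x y : B, ∃ a b c : R, x * y = φ a + φ b * x + φ c * y)
    {X Y : B} (hli : LI3 m φ X Y) (hXX : X * X = 0) (hYY : Y * Y = 0) (hXY : X * Y = 0) (z : B) :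
    ∃ g, (z - φ g) * X = 0 ∧ (z - φ g) * Y = 0 := by
  obtain ⟨g1, h1⟩ := absB hmax φ hm h (X := X) (fun a b hab => by
    obtain ⟨a1, a2, a3⟩ := hli a b 0 (by rw [map_zero]; linear_combination hab)
    exact ⟨a1, a2⟩) hXX z
  obtain ⟨g2, h2⟩ := absB hmax φ hm h (X := Y) (fun a b hab => by
    obtain ⟨a1, a2, a3⟩ := hli a 0 b (by rw [map_zero]; linear_combination hab)
    exact ⟨a1, a3⟩) hYY z
  obtain ⟨g3, h3⟩ := absB hmax φ hm h (X := X + Y) (fun a b hab => by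
    obtain ⟨a1, a2, a3⟩ := hli a b b (by linear_combination hab)
    exact ⟨a1, a3⟩) (by linear_combination hXX + hYY + 2 * hXY) z
  obtain ⟨-, a2, a3⟩ := hli 0 (g1 - g3) (g2 - g3) (by
    rw [map_zero, map_sub, map_sub]
    linear_combination h3 - h1 - h2)
  have a2 := hm _ a2
  have a3 := hm _ a3
  rw [map_sub] at a2 a3
  exact ⟨g3, by linear_combination h1 + X * a2, by linear_combination h2 + Y * a3⟩
end abs

variable {R : Type*} [CommRing R] [IsDomain R] {K : Type*} [Field K] [Algebra R K]
  [IsFractionRing R K]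

theorem lying_over {E Q : Submodule R K} (h1 : (1 : K) ∈ E) (hEE : E * E ≤ E) (hEQ : E * Q ≤ Q)
    (hQE : Q ≤ E) (h : (1 : K) ∈ RbK R K * Q) : (1 : K) ∈ Q := by
  by_contra hcon
  let A : Subalgebra R K := E.toSubalgebra h1 (fun a b ha hb => hEE (Submodule.mul_mem_mul ha hb))
  let I : Ideal A :=
    { carrier := {a | (a : K) ∈ Q}
      add_mem' := fun ha hb => Q.add_mem ha hb
      zero_mem' := Q.zero_mem
      smul_mem' := fun c x hx => hEQ (Submodule.mul_mem_mul c.2 hx) }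
  have hI : I ≠ ⊤ := by
    intro h
    exact hcon ((Ideal.eq_top_iff_one I).1 h)
  obtain ⟨P, hP, hIP⟩ := Ideal.exists_le_maximal I hI
  obtain ⟨P', hP', hPP⟩ := Ideal.exists_ideal_over_maximal_of_isIntegral
    (S := integralClosure A K) P (by
      intro a ha
      rw [RingHom.mem_ker] at ha
      have : (a : K) = 0 := congrArg Subtype.val ha
      have : a = 0 := Subtype.ext this
      rw [this]
      exact zero_mem _)
  have key : ∀ x ∈ RbK R K * Q, ∃ p ∈ P', (p : K) = x := by
    intro x hx
    refine Submodule.mul_induction_on hx ?_ ?_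
    · intro r hr q hq
      have hr' : IsIntegral A r := IsIntegral.tower_top (R := R) (A := A) (B := K) hr
      have hq' : (⟨q, hQE hq⟩ : A) ∈ P := hIP hq
      rw [← hPP, Ideal.mem_comap] at hq'
      exact ⟨_, Ideal.mul_mem_left P' ⟨r, hr'⟩ hq', rfl⟩
    · rintro x y ⟨p, hp, rfl⟩ ⟨q, hq, rfl⟩
      exact ⟨_, P'.add_mem hp hq, rfl⟩
  obtain ⟨p, hp, hp1⟩ := key 1 h
  have : p = 1 := Subtype.ext hp1
  rw [this] at hp
  exact hP'.ne_top ((Ideal.eq_top_iff_one _).2 hp)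

theorem ne_bot_of_one {E : Submodule R K} (h : (1 : K) ∈ E) : E ≠ ⊥ := by
  rintro rfl
  rw [Submodule.mem_bot] at h
  exact one_ne_zero h

theorem step5 (hStab : StabK R K) (hfr : FracK (RbK R K)) {J : Submodule R K} (h1 : (1 : K) ∈ J)
    (hJ : J ≤ RbK R K) : J * J ≤ J := by
  have hst := hStab J (ne_bot_of_one h1) (frac_mono hJ hfr)
  have hE1 : (1 : K) ∈ J / J := one_mem_div_self J
  have h := lying_over (E := J / J) (Q := J / J / J) hE1 (div_self_mul_le J) (by
      refine Submodule.mul_le.2 fun a ha b hb => mem_divK.2 fun y hy => ?_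
      rw [mul_assoc]
      exact div_self_mul_le J (Submodule.mul_mem_mul ha (mem_divK.1 hb y hy))) (by
      intro q hq
      simpa using mem_divK.1 hq 1 h1) (mulRK hJ hst)
  refine Submodule.mul_le.2 fun a ha b hb => ?_
  have := mem_divK.1 h a ha
  rw [one_mul] at this
  exact mem_divK.1 this b hb

theorem one_notMem_mRb {m : Ideal R} (hm : m.IsMaximal) : (1 : K) ∉ m • RbK R K := by
  intro h
  have := lying_over (R := R) (K := K) (E := 1) (Q := m • 1) one_memK (by rw [mul_one])
    (by rw [one_mul]) (idl_le_one m) (by rw [mul_comm, idl_mul]; exact h)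
  have h2 : ∀ x ∈ m • (1 : Submodule R K), ∃ r ∈ m, algebraMap R K r = x := by
    intro x hx
    refine Submodule.smul_induction_on hx ?_ ?_
    · intro r hr n hn
      obtain ⟨s, rfl⟩ := Submodule.mem_one.1 hn
      exact ⟨r * s, Ideal.mul_mem_right _ _ hr, by rw [map_mul, Algebra.smul_def]⟩
    · rintro x y ⟨r, hr, rfl⟩ ⟨s, hs, rfl⟩
      exact ⟨r + s, add_mem hr hs, map_add _ _ _⟩
  obtain ⟨r, hr, hr1⟩ := h2 1 this
  have : r = 1 := IsFractionRing.injective R K (by rw [hr1, map_one])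
  rw [this] at hr
  exact hm.ne_top ((Ideal.eq_top_iff_one _).2 hr)

end C2

section C3
variable {R : Type*} [CommRing R] [IsDomain R] {K : Type*} [Field K] [Algebra R K]
  [IsFractionRing R K]

theorem mRb_le (m : Ideal R) : m • RbK R K ≤ RbK R K := Submodule.smul_le_right

theorem mulRb {a b : K} (ha : a ∈ RbK R K) (hb : b ∈ RbK R K) : a * b ∈ RbK R K :=
  RbK_mul_le (Submodule.mul_mem_mul ha hb)

theorem mulb {m : Ideal R} {a b : K} (ha : a ∈ RbK R K) (hb : b ∈ m • RbK R K) :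
    a * b ∈ m • RbK R K := smul_mul_le RbK_mul_le ha hb

theorem mulbm {m : Ideal R} {r : R} {b : K} (hr : r ∈ m) (hb : b ∈ RbK R K) :
    algebraMap R K r * b ∈ m • RbK R K := by
  rw [← Algebra.smul_def]
  exact Submodule.smul_mem_smul hr hb

theorem algRb (r : R) : algebraMap R K r ∈ RbK R K := isIntegral_algebraMap

theorem algMul {X : Submodule R K} (r : R) {x : K} (hx : x ∈ X) : algebraMap R K r * x ∈ X := by
  rw [← Algebra.smul_def]
  exact X.smul_mem r hx

theorem alg_m {m : Ideal R} {r : R} (hr : r ∈ m) : algebraMap R K r ∈ m • RbK R K := by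
  have := mulbm (K := K) hr one_mem_RbK
  rwa [mul_one] at this

theorem caseb0 {m : Ideal R} (hm : m.IsMaximal)
    (hInv : ∀ I : Submodule R K, RbK R K * I ≤ I → I ≤ RbK R K → I ≠ ⊥ →
      (1 : K) ∈ I * (RbK R K / I)) {x y : K} (hx : x ∈ RbK R K) (hy : y ∈ RbK R K)
    (hxb : x ∉ m • RbK R K) (hyb : y ∉ Submodule.span R {x} ⊔ m • RbK R K)
    (hz : ∀ z ∈ RbK R K, ∃ r : R, (z - algebraMap R K r) * x ∈ m • RbK R K ∧
      (z - algebraMap R K r) * y ∈ m • RbK R K) : False := by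
  set b := m • RbK R K with hb
  set A := Submodule.span R {x} * RbK R K ⊔ b with hA
  set X := Submodule.span R {y} * RbK R K ⊔ A with hX
  have hscale : ∀ u : K, RbK R K * (Submodule.span R {u} * RbK R K) ≤
      Submodule.span R {u} * RbK R K := fun u => by
    rw [← mul_assoc, mul_comm (RbK R K), mul_assoc]
    exact mulLK RbK_mul_le
  have hscale' : ∀ u ∈ RbK R K, (Submodule.span R {u} * RbK R K) ≤ RbK R K := fun u hu v hv => by
    obtain ⟨w, hw, rfl⟩ := mem_scale.1 hv
    exact mulRb hu hw
  have hRb : RbK R K * b ≤ b := Submodule.mul_le.2 fun a ha c hc => mulb ha hc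
  have hRA : RbK R K * A ≤ A := by
    rw [hA, Submodule.mul_sup]
    exact sup_le_sup (hscale x) hRb
  have hRX : RbK R K * X ≤ X := by
    rw [hX, Submodule.mul_sup]
    exact sup_le_sup (hscale y) hRA
  have hA1 : A ≤ RbK R K := sup_le (hscale' x hx) (mRb_le m)
  have hX1 : X ≤ RbK R K := sup_le (hscale' y hy) hA1
  have hxA : x ∈ A := Submodule.mem_sup_left (mem_scale.2 ⟨1, one_mem_RbK, mul_one x⟩)
  have hyX : y ∈ X := Submodule.mem_sup_left (mem_scale.2 ⟨1, one_mem_RbK, mul_one y⟩)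
  have hAX : A ≤ X := le_sup_right
  have hbA : b ≤ A := le_sup_right
  have hX0 : X ≠ ⊥ := by
    intro h
    have := hAX hxA
    rw [h, Submodule.mem_bot] at this
    exact hxb (this ▸ zero_mem _)
  have h1 := hInv X hRX hX1 hX0
  set Y := RbK R K / X
  have hXY : X * Y ≤ RbK R K := mul_div_le _ _
  have hnX : ∀ n ∈ RbK R K, n * x ∈ b → n * y ∈ b → ∀ v ∈ X, n * v ∈ b := by
    intro n hn hnx hny v hv
    obtain ⟨v1, hv1, v', hv', rfl⟩ := Submodule.mem_sup.1 hv
    obtain ⟨v2, hv2, v3, hv3, rfl⟩ := Submodule.mem_sup.1 hv'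
    obtain ⟨p, hp, rfl⟩ := mem_scale.1 hv1
    obtain ⟨q, hq, rfl⟩ := mem_scale.1 hv2
    have e : n * (y * p + (x * q + v3)) = p * (n * y) + (q * (n * x) + n * v3) := by ring
    rw [e]
    exact add_mem (mulb hp hny) (add_mem (mulb hq hnx) (mulb hn hv3))
  have hnA : ∀ n ∈ RbK R K, n * x ∈ b → n * y ∈ b → n ∈ A * Y := by
    intro n hn hnx hny
    have h2 : n * 1 ∈ Submodule.span R {n} * (X * Y) := mem_scale.2 ⟨1, h1, rfl⟩
    rw [mul_one, ← mul_assoc] at h2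
    refine mulRK ?_ h2
    intro v hv
    obtain ⟨w, hw, rfl⟩ := mem_scale.1 hv
    exact hbA (hnX n hn hnx hny w hw)
  have hAY1 : A * Y ≤ RbK R K := (mulRK hAX).trans hXY
  by_cases hc : (1 : K) ∈ A * Y
  · apply hyb
    have h2 : y * 1 ∈ X * (A * Y) := Submodule.mul_mem_mul hyX hc
    rw [mul_one] at h2
    have h3 : X * (A * Y) ≤ A := by
      calc X * (A * Y) = (X * Y) * A := by ac_rfl
        _ ≤ RbK R K * A := mulRK hXY
        _ ≤ A := hRA
    obtain ⟨u, hu, t, ht, hut⟩ := Submodule.mem_sup.1 (h3 h2)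
    obtain ⟨v, hv, rfl⟩ := mem_scale.1 hu
    obtain ⟨r, hr, -⟩ := hz v hv
    have e : y = r • x + ((v - algebraMap R K r) * x + t) := by
      rw [← hut, Algebra.smul_def]; ring
    rw [e]
    exact Submodule.add_mem_sup (Submodule.smul_mem _ _ (Submodule.mem_span_singleton_self x))
      (add_mem hr ht)
  · apply hxb
    have hAYN : ∀ u ∈ A * Y, u * x ∈ b ∧ u * y ∈ b := by
      intro u hu
      obtain ⟨r, hrx, hry⟩ := hz u (hAY1 hu)
      have hn := hnA _ (sub_mem (hAY1 hu) (algRb r)) hrx hry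
      have hr : algebraMap R K r ∈ A * Y := by
        have := sub_mem hu hn
        rwa [sub_sub_cancel] at this
      by_cases hrm : r ∈ m
      · have e : ∀ v, u * v = (u - algebraMap R K r) * v + algebraMap R K r * v := fun v => by ring
        rw [e x, e y]
        exact ⟨add_mem hrx (mulbm hrm hx), add_mem hry (mulbm hrm hy)⟩
      · exfalso
        obtain ⟨e, i, hi, hei⟩ := hm.exists_inv hrm
        apply hc
        have h2 := hnA (algebraMap R K i) (algRb i) (mulbm hi hx) (mulbm hi hy)
        have := add_mem (algMul e hr) h2
        rwa [← map_mul, ← map_add, hei, map_one] at this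
    have h2 : x * 1 ∈ A * (X * Y) := Submodule.mul_mem_mul hxA h1
    rw [mul_one] at h2
    have h3 : A * (X * Y) = (A * Y) * X := by ac_rfl
    rw [h3] at h2
    have h4 : (A * Y) * X ≤ b := Submodule.mul_le.2 fun u hu v hv =>
      hnX u (hAY1 hu) (hAYN u hu).1 (hAYN u hu).2 v hv
    exact h4 h2

theorem caseb1 (hStab : StabK R K) (hfr : FracK (RbK R K)) {m : Ideal R} (hm : m.IsMaximal)
    {x y : K} (hx : x ∈ RbK R K) (hy : y ∈ RbK R K)
    (hxy : x * y ∈ m • RbK R K) (hxx : x * x - x ∈ m • RbK R K) (hyy : y * y - y ∈ m • RbK R K)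
    (hli : ∀ a b c : R, algebraMap R K a + algebraMap R K b * x + algebraMap R K c * y ∈
      m • RbK R K → a ∈ m ∧ b ∈ m ∧ c ∈ m) : False := by
  have h1b := one_notMem_mRb (K := K) hm
  set b := m • RbK R K with hb
  set J := Submodule.span R {1 - x, 1 - y} ⊔ b with hJ
  have hx1 : 1 - x ∈ RbK R K := sub_mem one_mem_RbK hx
  have hy1 : 1 - y ∈ RbK R K := sub_mem one_mem_RbK hy
  have memJ : ∀ v ∈ J, ∃ p q : R, ∃ t ∈ b,
      v = algebraMap R K p * (1 - x) + algebraMap R K q * (1 - y) + t := by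
    intro v hv
    obtain ⟨u, hu, t, ht, rfl⟩ := Submodule.mem_sup.1 hv
    obtain ⟨p, q, rfl⟩ := Submodule.mem_span_pair.1 hu
    exact ⟨p, q, t, ht, by rw [Algebra.smul_def, Algebra.smul_def]⟩
  have hxJ : 1 - x ∈ J := Submodule.mem_sup_left (Submodule.subset_span (by simp))
  have hyJ : 1 - y ∈ J := Submodule.mem_sup_left (Submodule.subset_span (by simp))
  have hbJ : b ≤ J := le_sup_right
  have hJ1 : J ≤ RbK R K := by
    refine sup_le (Submodule.span_le.2 ?_) (mRb_le m)
    rintro v (rfl | rfl)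
    · exact hx1
    · exact hy1
  have hgen : ∀ z : K, (∀ v ∈ J, z * v ∈ RbK R K) → z ∈ RbK R K := by
    intro z hz
    have e : z = z * (1 - x) + x * (z * (1 - y)) + z * (x * y) := by ring
    rw [e]
    exact add_mem (add_mem (hz _ hxJ) (mulRb hx (hz _ hyJ))) (hz _ (hbJ hxy))
  have hJ0 : J ≠ ⊥ := by
    intro h
    have h2 : (1 - x) + x * (1 - y) + x * y = 0 := by
      have e1 := hxJ
      have e2 := hyJ
      have e3 := hbJ hxy
      rw [h, Submodule.mem_bot] at e1 e2 e3
      rw [e1, e2, e3]; ring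
    have : (1 : K) = 0 := by rw [← h2]; ring
    exact one_ne_zero this
  have hst := hStab J hJ0 (frac_mono hJ1 hfr)
  have hE : ∀ z ∈ J / J, ∃ g : R, z - algebraMap R K g ∈ b := by
    intro z hz
    have hzR := hgen z (fun v hv => hJ1 (mem_divK.1 hz v hv))
    obtain ⟨α, β, t1, ht1, h1⟩ := memJ _ (mem_divK.1 hz _ hxJ)
    obtain ⟨γ, δ, t2, ht2, h2⟩ := memJ _ (mem_divK.1 hz _ hyJ)
    have hbr1 : t1 + x * t2 - algebraMap R K γ * (x * x - x) - algebraMap R K δ * (x * y) ∈ b :=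
      sub_mem (sub_mem (add_mem ht1 (mulb hx ht2)) (algMul _ hxx)) (algMul _ hxy)
    have hbr2 : t2 + y * t1 - algebraMap R K α * (x * y) - algebraMap R K β * (y * y - y) ∈ b :=
      sub_mem (sub_mem (add_mem ht2 (mulb hy ht1)) (algMul _ hxy)) (algMul _ hyy)
    obtain ⟨hA, hB, hC⟩ := hli (α + β - γ - δ) (γ + δ - α) (δ - α - β) (by
      have := sub_mem hbr2 hbr1
      convert this using 1
      simp only [map_sub, map_add]
      linear_combination -(1 - y) * h1 - (x - 1) * h2)
    have hβ : β ∈ m := by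
      have := add_mem hA hB
      convert this using 1
      ring
    have hγ : γ ∈ m := by
      have := neg_mem (add_mem hA hC)
      convert this using 1
      ring
    have hδ : δ - α ∈ m := by
      have := sub_mem hB hγ
      convert this using 1
      ring
    refine ⟨α, ?_⟩
    have := add_mem (add_mem (add_mem hbr1 (mulb hzR hxy)) (mulbm hδ hx)) (mulbm hβ hy1)
    convert this using 1
    simp only [map_sub]
    linear_combination h1 + x * h2
  apply h1b
  have : J * (J / J / J) ≤ b := by
    refine Submodule.mul_le.2 fun j hj q hq => ?_
    have hqE : ∀ v ∈ J, q * v ∈ J / J := mem_divK.1 hq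
    have hER : ∀ z ∈ J / J, z ∈ RbK R K := fun z hz =>
      hgen z (fun v hv => hJ1 (mem_divK.1 hz v hv))
    have hqR : q ∈ RbK R K := hgen q (fun v hv => hER _ (hqE v hv))
    have hqx : q * (1 - x) ∈ b := by
      obtain ⟨g, hg⟩ := hE _ (hqE _ hxJ)
      have hgm : g ∈ m := by
        have h3 := sub_mem (neg_mem (mulb hqR hxx)) (mulb hx hg)
        refine (hli 0 g 0 ?_).2.1
        convert h3 using 1
        simp only [map_zero]
        ring
      have := add_mem hg (alg_m hgm)
      rwa [sub_add_cancel] at this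
    have hqy : q * (1 - y) ∈ b := by
      obtain ⟨g, hg⟩ := hE _ (hqE _ hyJ)
      have hgm : g ∈ m := by
        have h3 := sub_mem (neg_mem (mulb hqR hyy)) (mulb hy hg)
        refine (hli 0 0 g ?_).2.2
        convert h3 using 1
        simp only [map_zero]
        ring
      have := add_mem hg (alg_m hgm)
      rwa [sub_add_cancel] at this
    obtain ⟨α, β, t, ht, rfl⟩ := memJ _ hj
    have := add_mem (add_mem (algMul α hqx) (algMul β hqy)) (mulb hqR ht)
    convert this using 1
    ring
  exact this hst

theorem mem_map_iff (m : Ideal R) (z : integralClosure R K) :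
    z ∈ m.map (algebraMap R (integralClosure R K)) ↔ (z : K) ∈ m • RbK R K := by
  have h1 : m • RbK R K = (m • (⊤ : Submodule R (integralClosure R K))).map
      (integralClosure R K).val.toLinearMap := by
    rw [Submodule.map_smul'']
    congr 1
    ext x
    simp [RbK]
  rw [h1, Ideal.smul_top_eq_map]
  constructor
  · intro h
    exact ⟨z, h, rfl⟩
  · rintro ⟨w, hw, hwz⟩
    have : w = z := Subtype.ext hwz
    rw [← this]
    exact hw

theorem step6 (hStab : StabK R K) (hfr : FracK (RbK R K)) {m : Ideal R} (hm : m.IsMaximal)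
    (hInv : ∀ I : Submodule R K, RbK R K * I ≤ I → I ≤ RbK R K → I ≠ ⊥ →
      (1 : K) ∈ I * (RbK R K / I)) :
    ∃ w ∈ RbK R K, RbK R K ≤ Submodule.span R {1, w} ⊔ m • RbK R K := by
  by_contra hcon
  push Not at hcon
  have h1b := one_notMem_mRb (K := K) hm
  obtain ⟨x, hx, hx1⟩ := Set.not_subset.1 (hcon 1 one_mem_RbK)
  obtain ⟨y, hy, hy1⟩ := Set.not_subset.1 (hcon x hx)
  have hinv : ∀ (X : Submodule R K), m • RbK R K ≤ X → ∀ r : R, r ∉ m → ∀ z ∈ RbK R K,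
      algebraMap R K r * z ∈ X → z ∈ X := by
    intro X hX r hr z hz h
    obtain ⟨e, i, hi, hei⟩ := hm.exists_inv hr
    have := add_mem (algMul e h) (hX (mulbm hi hz))
    rwa [← mul_assoc, ← add_mul, ← map_mul, ← map_add, hei, map_one, one_mul] at this
  let I := m.map (algebraMap R (integralClosure R K))
  let π := Ideal.Quotient.mk I
  let φ : R →+* (integralClosure R K ⧸ I) := π.comp (algebraMap R (integralClosure R K))
  have hπ : ∀ z, π z = 0 ↔ (z : K) ∈ m • RbK R K := fun z =>
    Ideal.Quotient.eq_zero_iff_mem.trans (mem_map_iff m z)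
  have hφm : ∀ r ∈ m, φ r = 0 := fun r hr => (hπ _).2 (alg_m hr)
  have hh : ∀ x y : integralClosure R K ⧸ I, ∃ a b c : R, x * y = φ a + φ b * x + φ c * y := by
    intro x y
    obtain ⟨x, rfl⟩ := Ideal.Quotient.mk_surjective x
    obtain ⟨y, rfl⟩ := Ideal.Quotient.mk_surjective y
    have h5 := step5 hStab hfr (J := Submodule.span R {1, (x : K), (y : K)})
      (Submodule.subset_span (by simp)) (by
        refine Submodule.span_le.2 ?_
        rintro v (rfl | rfl | rfl)
        · exact one_mem_RbK
        · exact x.2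
        · exact y.2)
    have h6 := h5 (Submodule.mul_mem_mul (Submodule.subset_span (by simp : (x : K) ∈ _))
      (Submodule.subset_span (by simp : (y : K) ∈ _)))
    obtain ⟨a, b, c, habc⟩ := Submodule.mem_span_triple.1 h6
    refine ⟨a, b, c, ?_⟩
    have : x * y = algebraMap R _ a + algebraMap R _ b * x + algebraMap R _ c * y := by
      apply Subtype.ext
      change (x : K) * y = algebraMap R K a + algebraMap R K b * x + algebraMap R K c * y
      rw [← habc, Algebra.smul_def, Algebra.smul_def, Algebra.smul_def, mul_one]
    have := congrArg π this
    rwa [map_mul, map_add, map_add, map_mul, map_mul] at this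
  have hLI : LI3 m φ (π ⟨x, hx⟩) (π ⟨y, hy⟩) := by
    intro a b c habc
    have h2 : algebraMap R K a + algebraMap R K b * x + algebraMap R K c * y ∈ m • RbK R K :=
      (hπ (algebraMap R _ a + algebraMap R _ b * (⟨x, hx⟩ : integralClosure R K) +
        algebraMap R _ c * (⟨y, hy⟩ : integralClosure R K))).1 (by
        rw [map_add, map_add, map_mul, map_mul]; exact habc)
    have hc : c ∈ m := by
      by_contra hc
      apply hy1
      refine hinv _ le_sup_right c hc y hy ?_
      have e : algebraMap R K c * y = ((-a) • 1 + (-b) • x) +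
          (algebraMap R K a + algebraMap R K b * x + algebraMap R K c * y) := by
        rw [Algebra.smul_def, Algebra.smul_def, map_neg, map_neg]; ring
      rw [e]
      exact Submodule.add_mem_sup (Submodule.mem_span_pair.2 ⟨_, _, rfl⟩) h2
    have h3 := sub_mem h2 (mulbm hc hy)
    rw [add_sub_cancel_right] at h3
    have hb : b ∈ m := by
      by_contra hb
      apply hx1
      refine hinv _ le_sup_right b hb x hx ?_
      have e : algebraMap R K b * x = ((-a) • 1 + (0 : R) • 1) +
          (algebraMap R K a + algebraMap R K b * x) := by
        rw [Algebra.smul_def, map_neg, zero_smul]; ring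
      rw [e]
      exact Submodule.add_mem_sup (Submodule.mem_span_pair.2 ⟨_, _, rfl⟩) h3
    have h4 := sub_mem h3 (mulbm hb hx)
    rw [add_sub_cancel_right] at h4
    refine ⟨?_, hb, hc⟩
    by_contra ha
    exact h1b (hinv _ le_rfl a ha 1 one_mem_RbK (by rwa [mul_one]))
  obtain ⟨X, Y, hli, hXY, hcase⟩ := absA hm φ hφm hh hLI
  obtain ⟨X, rfl⟩ := Ideal.Quotient.mk_surjective X
  obtain ⟨Y, rfl⟩ := Ideal.Quotient.mk_surjective Y
  have hliK : ∀ a b c : R, algebraMap R K a + algebraMap R K b * X + algebraMap R K c * Y ∈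
      m • RbK R K → a ∈ m ∧ b ∈ m ∧ c ∈ m := by
    intro a b c habc
    apply hli a b c
    have := (hπ (algebraMap R _ a + algebraMap R _ b * X + algebraMap R _ c * Y)).2 habc
    rwa [map_add, map_add, map_mul, map_mul] at this
  have hXYb : (X : K) * Y ∈ m • RbK R K := (hπ (X * Y)).1 (by rw [map_mul]; exact hXY)
  have h1m : (1 : R) ∉ m := fun h => hm.ne_top ((Ideal.eq_top_iff_one _).2 h)
  rcases hcase with ⟨hXX, hYY⟩ | ⟨hXX, hYY⟩
  · refine caseb0 hm hInv X.2 Y.2 ?_ ?_ ?_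
    · intro h
      exact h1m (hliK 0 1 0 (by simpa using h)).2.1
    · intro h
      obtain ⟨u, hu, t, ht, hut⟩ := Submodule.mem_sup.1 h
      obtain ⟨r, rfl⟩ := Submodule.mem_span_singleton.1 hu
      refine h1m (hliK 0 (-r) 1 ?_).2.2
      convert ht using 1
      rw [map_zero, map_one, ← hut, Algebra.smul_def, map_neg]
      ring
    · intro z hz
      obtain ⟨g, hg1, hg2⟩ := absC hm φ hφm hh hli hXX hYY hXY (π ⟨z, hz⟩)
      refine ⟨g, (hπ ((⟨z, hz⟩ - algebraMap R _ g) * X)).1 ?_,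
        (hπ ((⟨z, hz⟩ - algebraMap R _ g) * Y)).1 ?_⟩
      · rw [map_mul, map_sub]; exact hg1
      · rw [map_mul, map_sub]; exact hg2
  · refine caseb1 hStab hfr hm X.2 Y.2 hXYb ?_ ?_ hliK
    · exact (hπ (X * X - X)).1 (by rw [map_sub, map_mul]; exact sub_eq_zero.2 hXX)
    · exact (hπ (Y * Y - Y)).1 (by rw [map_sub, map_mul]; exact sub_eq_zero.2 hYY)
end C3

section C4
variable {R : Type*} [CommRing R] [IsDomain R] {K : Type*} [Field K] [Algebra R K]
  [IsFractionRing R K]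

/-- Every intermediate module between `A` and `B` is finitely generated modulo `A`. -/
def PK (A B : Submodule R K) : Prop :=
  ∀ X, A ≤ X → X ≤ B → ∃ G : Submodule R K, G.FG ∧ G ≤ X ∧ X ≤ G ⊔ A

theorem fg_move {X B G : Submodule R K} (hG : G.FG) (h : G ≤ X ⊔ B) :
    ∃ G' : Submodule R K, G'.FG ∧ G' ≤ X ∧ G ≤ G' ⊔ B := by
  revert h
  refine Submodule.fg_induction
    (motive := fun G _ => G ≤ X ⊔ B → ∃ G' : Submodule R K, G'.FG ∧ G' ≤ X ∧ G ≤ G' ⊔ B)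
    ?_ ?_ G hG
  · intro v hv
    obtain ⟨a, ha, b, hb, hab⟩ := Submodule.mem_sup.1 (hv (Submodule.mem_span_singleton_self v))
    refine ⟨Submodule.span R {a}, Submodule.fg_span_singleton a,
      (Submodule.span_singleton_le_iff_mem _ _).2 ha,
      (Submodule.span_singleton_le_iff_mem _ _).2 ?_⟩
    rw [← hab]
    exact Submodule.add_mem_sup (Submodule.mem_span_singleton_self a) hb
  · intro M1 M2 _ _ h1 h2 h
    obtain ⟨G1, a1, b1, c1⟩ := h1 (le_sup_left.trans h)
    obtain ⟨G2, a2, b2, c2⟩ := h2 (le_sup_right.trans h)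
    exact ⟨G1 ⊔ G2, a1.sup a2, sup_le b1 b2, sup_le
      (c1.trans (sup_le_sup_right le_sup_left _)) (c2.trans (sup_le_sup_right le_sup_right _))⟩

theorem PK.trans {A B C : Submodule R K} (hAB : A ≤ B) (h1 : PK A B) (h2 : PK B C) (hBC : B ≤ C) :
    PK A C := by
  intro X hAX hXC
  obtain ⟨G, hG, hGX, hXG⟩ := h2 (X ⊔ B) le_sup_right (sup_le hXC hBC)
  obtain ⟨G1, hG1, hG1X, hGG1⟩ := fg_move hG hGX
  obtain ⟨G2, hG2, hG2X, hXG2⟩ := h1 (X ⊓ B) (le_inf hAX hAB) inf_le_right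
  refine ⟨G1 ⊔ G2, hG1.sup hG2, sup_le hG1X (hG2X.trans inf_le_left), ?_⟩
  intro x hx
  have h3 : x ∈ G1 ⊔ B := (sup_le hGG1 le_sup_right) (hXG (Submodule.mem_sup_left hx))
  obtain ⟨g, hg, b, hb, rfl⟩ := Submodule.mem_sup.1 h3
  have hbX : b ∈ X := by
    have := sub_mem hx (hG1X hg)
    rwa [add_sub_cancel_left] at this
  rw [sup_assoc]
  exact Submodule.add_mem_sup hg (hXG2 ⟨hbX, hb⟩)

theorem PK.mono {A B B' : Submodule R K} (h : PK A B) (h' : B' ≤ B) : PK A B' :=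
  fun X hA hB => h X hA (hB.trans h')

theorem PK_single {m : Ideal R} (hm : m.IsMaximal) {A : Submodule R K} {u : K}
    (hu : ∀ r ∈ m, algebraMap R K r * u ∈ A) : PK A (Submodule.span R {u} ⊔ A) := by
  intro X hAX hX
  by_cases h : X ≤ A
  · exact ⟨⊥, Submodule.fg_bot, bot_le, h.trans le_sup_right⟩
  · obtain ⟨v, hv, hvA⟩ := Set.not_subset.1 h
    obtain ⟨s, hs, a, ha, hsa⟩ := Submodule.mem_sup.1 (hX hv)
    obtain ⟨r, rfl⟩ := Submodule.mem_span_singleton.1 hs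
    have hr : r ∉ m := by
      intro hr
      apply hvA
      rw [← hsa, Algebra.smul_def]
      exact add_mem (hu r hr) ha
    obtain ⟨e, i, hi, hei⟩ := hm.exists_inv hr
    have huX : u ∈ X := by
      have h3 := add_mem (algMul e (sub_mem hv (hAX ha))) (hAX (hu i hi))
      have e2 : u = algebraMap R K e * (v - a) + algebraMap R K i * u := by
        have := congrArg (algebraMap R K) hei
        rw [map_add, map_mul, map_one] at this
        rw [← hsa, Algebra.smul_def]
        linear_combination -u * this
      rwa [← e2] at h3
    exact ⟨Submodule.span R {u}, Submodule.fg_span_singleton u,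
      (Submodule.span_singleton_le_iff_mem _ _).2 huX, hX⟩

theorem comap_max {N : Submodule R K} (hN : MaxK (RbK R K) N) :
    ∃ m : Ideal R, m.IsMaximal ∧ ∀ r, r ∈ m ↔ algebraMap R K r ∈ N := by
  obtain ⟨h1, h2, h3, h4⟩ := hN
  let I : Ideal (integralClosure R K) :=
    { carrier := {a | (a : K) ∈ N}
      add_mem' := fun ha hb => N.add_mem ha hb
      zero_mem' := N.zero_mem
      smul_mem' := fun c x hx => h1 (Submodule.mul_mem_mul c.2 hx) }
  have hI : I.IsMaximal := by
    rw [Ideal.isMaximal_iff]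
    refine ⟨h3, fun J x hIJ hxI hxJ => ?_⟩
    obtain ⟨b, hb, hab⟩ := h4 x x.2 hxI
    have h5 : (1 - x * ⟨b, hb⟩ : integralClosure R K) ∈ I := hab
    have := J.add_mem (hIJ h5) (J.mul_mem_right ⟨b, hb⟩ hxJ)
    rwa [sub_add_cancel] at this
  exact ⟨I.comap (algebraMap R (integralClosure R K)),
    Ideal.isMaximal_comap_of_isIntegral_of_isMaximal I, fun r => Iff.rfl⟩

theorem step7 (hStab : StabK R K) (hMori : MoriK R K) (hfr : FracK (RbK R K))
    {A : Submodule R K} (hRA : RbK R K * A ≤ A) (hA1 : A ≤ RbK R K) (hA0 : A ≠ ⊥) :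
    PK A (RbK R K) := by
  obtain ⟨hd, hInv⟩ := steps14 hStab hMori hfr
  have hInv' : ∀ I : Submodule R K, RbK R K * I ≤ I → I ≤ RbK R K → I ≠ ⊥ →
      I * (RbK R K / I) = RbK R K := by
    intro I h1 h2 h3
    apply eq_ring_of_one
    · rw [← mul_assoc]
      exact mulRK h1
    · exact mul_div_le _ _
    · exact hInv I h1 h2 h3
  by_contra hcon
  obtain ⟨x0, hx0, hx⟩ := id hfr
  obtain ⟨A, ⟨hRA, hA1, hA0, hAP⟩, hmax⟩ := hMori x0 hx0
    {A | RbK R K * A ≤ A ∧ A ≤ RbK R K ∧ A ≠ ⊥ ∧ ¬ PK A (RbK R K)} ⟨A, hRA, hA1, hA0, hcon⟩ (by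
      rintro A ⟨hRA, hA1, hA0, -⟩
      refine ⟨hA0, ?_, fun x h => hx x (hA1 h)⟩
      rw [inv_eq_div hRA one_mem_RbK (hInv' A hRA hA1 hA0)]
      exact div_divisorial hd)
  have h1A : (1 : K) ∉ A := by
    intro h
    apply hAP
    rw [eq_ring_of_one hRA hA1 h]
    exact fun X hX hX' => ⟨⊥, Submodule.fg_bot, bot_le, hX'.trans le_sup_right⟩
  obtain ⟨N, hN, hAN⟩ := exists_maxK one_mem_RbK RbK_mul_le hRA hA1 h1A
  obtain ⟨hRN, hN1, h1N, hNinv⟩ := id hN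
  have hN0 : N ≠ ⊥ := by
    rintro rfl
    exact hA0 (le_bot_iff.1 hAN)
  have hNY := hInv' N hRN hN1 hN0
  set Y := RbK R K / N with hY
  have h1Y : (1 : K) ∈ Y := mem_divK.2 fun y hy => by rw [one_mul]; exact hN1 hy
  obtain ⟨X, hX⟩ : ∃ X, X = Y * A := ⟨_, rfl⟩
  have hNX : N * X = A := by
    rw [hX, ← mul_assoc, hNY, ring_mul_mod one_mem_RbK hRA]
  have hAX : A ≤ X := fun a ha => by
    rw [hX, ← one_mul a]
    exact Submodule.mul_mem_mul h1Y ha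
  have hRX : RbK R K * X ≤ X := by
    calc RbK R K * X = Y * (RbK R K * A) := by rw [hX]; ac_rfl
      _ ≤ X := by rw [hX]; exact mulLK hRA
  have hX1 : X ≤ RbK R K := by
    calc X ≤ Y * N := by rw [hX]; exact mulLK hAN
      _ = RbK R K := by rw [mul_comm, hNY]
  have hX0 : X ≠ ⊥ := by
    rintro rfl
    exact hA0 (le_bot_iff.1 hAX)
  have hXne : ¬ X ≤ A := by
    intro h
    have hXA : X = A := le_antisymm h hAX
    apply h1N
    have e : N * RbK R K = RbK R K := by
      have h5 := hInv' A hRA hA1 hA0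
      calc N * RbK R K = N * (A * (RbK R K / A)) := by rw [h5]
        _ = (N * X) * (RbK R K / A) := by rw [hXA, mul_assoc]
        _ = RbK R K := by rw [hNX, h5]
    rw [mul_comm, ring_mul_mod one_mem_RbK hRN] at e
    rw [e]
    exact one_mem_RbK
  have hXP : PK X (RbK R K) := by
    by_contra hXP
    exact hXne (hmax X ⟨hRX, hX1, hX0, hXP⟩ hAX).le
  apply hAP
  refine PK.trans hAX ?_ hXP hX1
  obtain ⟨z, hzX, hzA⟩ := Set.not_subset.1 hXne
  have hzX : z ∈ X := hzX
  have hXX := hInv' X hRX hX1 hX0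
  obtain ⟨X', hX'⟩ : ∃ X', X' = RbK R K / X := ⟨_, rfl⟩
  rw [← hX'] at hXX
  obtain ⟨Z, hZ⟩ : ∃ Z, Z = Submodule.span R {z} * RbK R K ⊔ A := ⟨_, rfl⟩
  have hRZ : RbK R K * Z ≤ Z := by
    rw [hZ, Submodule.mul_sup]
    refine sup_le_sup ?_ hRA
    rw [← mul_assoc, mul_comm (RbK R K), mul_assoc]
    exact mulLK RbK_mul_le
  have hAZ : A ≤ Z := by rw [hZ]; exact le_sup_right
  have hzZ : z ∈ Z := by
    rw [hZ]
    exact Submodule.mem_sup_left (mem_scale.2 ⟨1, one_mem_RbK, mul_one z⟩)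
  have hZX : Z ≤ X := by
    rw [hZ]
    refine sup_le ?_ hAX
    intro v hv
    obtain ⟨t, ht, rfl⟩ := mem_scale.1 hv
    rw [mul_comm]
    exact hRX (Submodule.mul_mem_mul ht hzX)
  have hXZ : X ≤ Z := by
    have hNZ : N ≤ Z * X' := by
      calc N = RbK R K * N := (ring_mul_mod one_mem_RbK hRN).symm
        _ = (N * X) * X' := by rw [← hXX]; ac_rfl
        _ ≤ Z * X' := by rw [hNX]; exact mulRK hAZ
    have h1 : (1 : K) ∈ Z * X' := by
      by_contra h1
      apply hzA
      have h6 : Z * X' ≤ N := by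
        apply hN.le_of _ hNZ _ h1
        · rw [← mul_assoc]
          exact mulRK hRZ
        · exact (mulRK hZX).trans hXX.le
      have h7 : Z ≤ A := by
        calc Z = RbK R K * Z := (ring_mul_mod one_mem_RbK hRZ).symm
          _ = (Z * X') * X := by rw [← hXX]; ac_rfl
          _ ≤ N * X := mulRK h6
          _ = A := hNX
      exact h7 hzZ
    intro v hv
    have h8 : v * 1 ∈ X * (Z * X') := Submodule.mul_mem_mul hv h1
    have h9 : X * (Z * X') ≤ Z := by
      calc X * (Z * X') = (X * X') * Z := by ac_rfl
        _ ≤ Z := by rw [hXX]; exact hRZ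
    rw [mul_one] at h8
    exact h9 h8
  obtain ⟨m, hm, hmN⟩ := comap_max hN
  obtain ⟨w, hw, hRw⟩ := step6 hStab hfr hm hInv
  have hmX : ∀ r ∈ m, ∀ v ∈ X, algebraMap R K r * v ∈ A := by
    intro r hr v hv
    rw [← hNX]
    exact Submodule.mul_mem_mul ((hmN r).1 hr) hv
  have hwzX : w * z ∈ X := hRX (Submodule.mul_mem_mul hw hzX)
  have p1 := PK_single hm (A := A) (u := w * z) (fun r hr => hmX r hr _ hwzX)
  have p2 := PK_single hm (A := Submodule.span R {w * z} ⊔ A) (u := z)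
    (fun r hr => Submodule.mem_sup_right (hmX r hr _ hzX))
  refine (PK.trans le_sup_right p1 p2 le_sup_right).mono ?_
  refine hXZ.trans ?_
  rw [hZ]
  refine sup_le ?_ (le_sup_right.trans le_sup_right)
  intro v hv
  obtain ⟨t, ht, rfl⟩ := mem_scale.1 hv
  obtain ⟨u, hu, c, hc, rfl⟩ := Submodule.mem_sup.1 (hRw ht)
  obtain ⟨p, q, rfl⟩ := Submodule.mem_span_pair.1 hu
  have hzc : z * c ∈ A := by
    have h10 : m • RbK R K ≤ N := by
      refine Submodule.smul_le.2 fun r hr n hn => ?_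
      rw [Algebra.smul_def, mul_comm]
      exact hRN (Submodule.mul_mem_mul hn ((hmN r).1 hr))
    rw [mul_comm, ← hNX]
    exact Submodule.mul_mem_mul (h10 hc) hzX
  have e : z * (p • 1 + q • w + c) = p • z + (q • (w * z) + z * c) := by
    simp only [Algebra.smul_def]; ring
  rw [e]
  exact Submodule.add_mem_sup (Submodule.smul_mem _ _ (Submodule.mem_span_singleton_self z))
    (Submodule.add_mem_sup (Submodule.smul_mem _ _ (Submodule.mem_span_singleton_self _)) hzc)

theorem noeth_C (hStab : StabK R K) (hMori : MoriK R K) (hfr : FracK (RbK R K)) :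
    IsNoetherianRing R := by
  rw [isNoetherianRing_iff_ideal_fg]
  intro I
  by_cases hI : I = ⊥
  · rw [hI]; exact Submodule.fg_bot
  obtain ⟨y, hy, hy0⟩ := Submodule.exists_mem_ne_zero_of_ne_bot hI
  obtain ⟨x, hx0, hx⟩ := id hfr
  have hyK : algebraMap R K y ≠ 0 := by simpa using hy0
  set C := (1 : Submodule R K) / RbK R K with hC
  have hxC : x ∈ C := mem_divK.2 hx
  have hC1 : C ≤ 1 := fun c hc => by simpa using mem_divK.1 hc 1 one_mem_RbK
  have hRC : RbK R K * C ≤ C := Submodule.mul_le.2 fun r hr c hc => mem_divK.2 fun s hs => by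
    have := mem_divK.1 hc _ (mulRb hr hs)
    convert this using 1
    ring
  have hp := step7 hStab hMori hfr (A := Submodule.span R {algebraMap R K y} * C) (by
      rw [← mul_assoc, mul_comm (RbK R K), mul_assoc]
      exact mulLK hRC) (by
      intro v hv
      obtain ⟨c, hc, rfl⟩ := mem_scale.1 hv
      exact mulRb (algRb y) ((Submodule.one_le.2 one_mem_RbK) (hC1 hc))) (by
      intro h
      have : algebraMap R K y * x ∈ Submodule.span R {algebraMap R K y} * C :=
        mem_scale.2 ⟨x, hxC, rfl⟩
      rw [h, Submodule.mem_bot] at this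
      exact mul_ne_zero hyK hx0 this)
  have hle : Submodule.span R {algebraMap R K y} * C ≤ Submodule.span R {algebraMap R K y} := by
    calc _ ≤ Submodule.span R {algebraMap R K y} * 1 := mulLK hC1
      _ = _ := mul_one _
  set I' := Submodule.map (Algebra.linearMap R K) I with hI'
  have hyI : Submodule.span R {algebraMap R K y} ≤ I' :=
    (Submodule.span_singleton_le_iff_mem _ _).2 ⟨y, hy, rfl⟩
  obtain ⟨G, hG, hGI, hIG⟩ := hp I' (hle.trans hyI) (by
    rintro _ ⟨r, -, rfl⟩
    exact algRb r)
  have heq : I' = G ⊔ Submodule.span R {algebraMap R K y} :=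
    le_antisymm (hIG.trans (sup_le_sup_left hle _)) (sup_le hGI hyI)
  have hfg : I'.FG := by
    rw [heq]
    exact hG.sup (Submodule.fg_span_singleton _)
  exact Submodule.fg_of_fg_map_injective (Algebra.linearMap R K)
    (IsFractionRing.injective R K) hfg

theorem part_C (hStab : StabK R K) (hMori : MoriK R K) (hfr : FracK (RbK R K)) (I : Ideal R) :
    I.TwoGenerated := by
  have := noeth_C hStab hMori hfr
  obtain ⟨hd, hInv⟩ := steps14 hStab hMori hfr
  refine two_gen_of_good (K := K) (fun m hm hm0 => ?_) I
  obtain ⟨w, hw, hRw⟩ := step6 hStab hfr hm hInv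
  have hb := hInv (m • RbK R K) (Submodule.mul_le.2 fun a ha c hc => mulb ha hc) (mRb_le m) (by
    intro h
    refine idl_ne_bot (K := K) hm0 (le_bot_iff.1 ?_)
    rw [← h]
    exact Submodule.smul_mono le_rfl (Submodule.one_le.2 one_mem_RbK))
  have hRQ : RbK R K * (RbK R K / (m • RbK R K)) ≤ RbK R K / (m • RbK R K) :=
    Submodule.mul_le.2 fun r hr q hq => mem_divK.2 fun y hy => by
      rw [mul_assoc]
      exact mulRb hr (mem_divK.1 hq y hy)
  refine goodAt_of_D hm0 one_mem_RbK RbK_mul_le (fg_of_frac hfr) hw hRw hRQ ?_ ?_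
  · rw [← idl_mul m (RbK R K), mul_assoc] at hb
    rw [← idl_mul m (RbK R K / _)]
    rw [idl_mul m (RbK R K)] at hb
    exact mulLK hRQ hb
  · rw [← idl_mul]
    refine le_trans (mulRK ?_) (mul_div_le (RbK R K) (m • RbK R K))
    exact Submodule.smul_mono le_rfl (Submodule.one_le.2 one_mem_RbK)
end C4

theorem two_generated_iff_divisorial_stable_mori (R : Type*) [CommRing R] [IsDomain R] :
    ((∀ I : Ideal R, I.TwoGenerated) ↔
      (DivisorialRing R ∧ StableRing R ∧ MoriRing R)) ∧
    (StableRing R → MoriRing R →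
      (∃ x : FractionRing R, x ≠ 0 ∧
        ∀ y ∈ integralClosure R (FractionRing R), x * y ∈ (algebraMap R (FractionRing R)).range) →
      (DivisorialRing R ∧ ∀ I : Ideal R, I.TwoGenerated)) := by
  refine ⟨⟨fun h => ⟨divisorial_A h, stable_A h, mori_A h⟩,
    fun h I => part_B h.1 h.2.1 h.2.2 I⟩, ?_⟩
  rintro hs hm ⟨x, hx0, hx⟩
  have h2 : ∀ I : Ideal R, I.TwoGenerated := fun I =>
    part_C (K := FractionRing R) (StabK_of_stable hs) (MoriK_of_mori hm)
      ⟨x, hx0, fun y hy => by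
        obtain ⟨r, hr⟩ := hx y hy
        exact Submodule.mem_one.2 ⟨r, hr⟩⟩ I
  exact ⟨divisorial_A h2, h2⟩
end
end
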